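/- Fix $l\ge 1$ and pairs of integers $\mathbf{n}_1=(\mathbf{n}_1^1,\mathbf{n}_1^2),\dots,\mathbf{n}_l=(\mathbf{n}_l^1,\mathbf{n}_l^2)$, and set $\mathbf{n}_{l+1}:=(0,0)$. Let $\mathcal{R}$ be a finite collection of dyadic rectangles $R=I\times J$ in the plane, and for each $1\le j\le l+1$ let $(\Phi^j_{R_{\mathbf{n}_j}})_{R\in\mathcal{R}}$ be a family of $L^2$-normalized bump functions adapted to the shifted rectangles $R_{\mathbf{n}_j}=I_{\mathbf{n}_j^1}\times J_{\mathbf{n}_j^2}$, such that at least two of the families $(\Phi^j_{I_{\mathbf{n}_j^1}})_I$, $1\le j\le l+1$, are of $\Psi$ type, and likewise at least two of the families $(\Phi^j_{J_{\mathbf{n}_j^2}})_J$ are of $\Psi$ type. Then for all $1<p_1,\dots,p_l<\infty$ and $0<p<\infty$ with $1/p_1+\cdots+1/p_l=1/p$, the $l$-linear operator $T_{\mathcal{R}}(f_1,\dots,f_l):=\sum_{R\in\mathcal{R}}|R|^{-(l-1)/2}\langle f_1,\Phi^1_{R_{\mathbf{n}_1}}\rangle\cdots\langle f_l,\Phi^l_{R_{\mathbf{n}_l}}\rangle\,\Phi^{l+1}_R$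 maps $L^{p_1}(\mathbb{R}^2)\times\cdots\times L^{p_l}(\mathbb{R}^2)\to L^p(\mathbb{R}^2)$ with norm at most a constant (depending only on $l$, the exponents, and the adaptation constants of the bump families, but not on $\mathcal{R}$ or the shifts) times $\prod_{j=1}^{2}\log^2\langle\mathbf{n}_1^j\rangle\cdots\log^2\langle\mathbf{n}_l^j\rangle$, where $\langle m\rangle:=2+|m|$. -/

import Mathlib

open MeasureTheory Filter Topology ENNReal

/-- `φ` is a bump function adapted to the interval with left endpoint `a` and length `L`,
with adaptation constants `C M`:
`|∂^α φ(x)| ≤ C M * |I|^{-α} * (1 + dist(x, I)/|I|)^{-M}` for all `0 ≤ α ≤ 5`, `M`, `x`. -/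
def IsBumpAdapted (C : ℕ → ℝ) (a L : ℝ) (φ : ℝ → ℂ) : Prop :=
  ContDiff ℝ 5 φ ∧ ∀ α : ℕ, α ≤ 5 → ∀ M : ℕ, ∀ x : ℝ,
    ‖iteratedDeriv α φ x‖ * L ^ α *
      (1 + Metric.infDist x (Set.Icc a (a + L)) / L) ^ M ≤ C M

/-- The `L²`-normalized product bump `|I|^{-1/2}|J|^{-1/2} g(x) h(y)` on a dyadic rectangle
with side lengths `2^{k₁}, 2^{k₂}`. -/
noncomputable def rectBumpProd (k₁ k₂ : ℤ) (g h : ℝ → ℂ) : ℝ × ℝ → ℂ :=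
  fun z => ((((2:ℝ)^k₁) ^ (-(1/2) : ℝ) * ((2:ℝ)^k₂) ^ (-(1/2) : ℝ) : ℝ) : ℂ) * g z.1 * h z.2

/-- The pairing `⟨f, g⟩ = ∫_{ℝ²} f \overline{g}`. -/
noncomputable def pairing (f g : ℝ × ℝ → ℂ) : ℂ :=
  ∫ z : ℝ × ℝ, f z * (starRingEnd ℂ) (g z)

/-- The discrete model operator
`T_𝓡(f₁,…,f_l) = ∑_{R ∈ 𝓡} |R|^{-(l-1)/2} ⟨f₁, Φ¹_{R_{n₁}}⟩ ⋯ ⟨f_l, Φ^l_{R_{n_l}}⟩ Φ^{l+1}_R`.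
A dyadic rectangle is encoded as `((k₁, m₁), (k₂, m₂))`, standing for
`[2^{k₁}m₁, 2^{k₁}(m₁+1)) × [2^{k₂}m₂, 2^{k₂}(m₂+1))`, of area `2^{k₁} 2^{k₂}`. -/
noncomputable def modelOp (l : ℕ) (𝓡 : Finset ((ℤ × ℤ) × (ℤ × ℤ)))
    (Φ : Fin (l + 1) → ((ℤ × ℤ) × (ℤ × ℤ)) → ℝ × ℝ → ℂ)
    (f : Fin l → ℝ × ℝ → ℂ) (x : ℝ × ℝ) : ℂ :=
  ∑ r ∈ 𝓡,
    (((((2:ℝ)^r.1.1 * (2:ℝ)^r.2.1) ^ (-(((l : ℝ) - 1) / 2)) : ℝ)) : ℂ) *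
      (∏ i : Fin l, pairing (f i) (Φ i.castSucc r)) * Φ (Fin.last l) r x

notation "mlm" => mul_le_mul_right
notation "lcmq" => lintegral_const_mul'
notation "maq" => mul_assoc
notation "mlmq" => mul_le_mul_left
notation "loe" => le_of_eq
notation "lmq" => lintegral_mono
notation "mcq" => measurable_const
notation "onq" => ofReal_norm
notation "dem" => div_eq_mul_inv
notation "nto" => ne_top_of_le_ne_top
notation "ala" => add_le_add
notation "mcz" => mul_comm
notation "nnq" => norm_nonneg
notation "mlmz" => mul_le_mul'
notation "lcmz" => lintegral_const_mul
notation "ltz" => le_trans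
notation "mlmw" => mul_le_mul_of_nonneg_left
notation "liq" => lintegral_indicator
notation "mfq" => measurable_fst
notation "plpq" => pow_le_pow_left'
notation "msz" => measurable_snd
notation "mlmv" => mul_le_mul_of_nonneg_right
notation "miv" => measurable_id
notation "znq" => zpow_natCast
notation "ltw" => lintegral_tsum
notation "eil" => enorm_integral_le_lintegral_enorm
notation "lal" => lintegral_add_left
notation "lmo" => le_mul_of_one_le_left
notation "lmoq" => le_mul_of_one_le_right'
notation "aop" => abs_of_pos
notation "scz" => setLIntegral_const
notation "dldq" => div_le_div_of_nonneg_right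
notation "EE" => ℝ≥0∞
notation "TT" => (2:ℝ)
notation "HH" => (1/2:ℝ)
notation "CJ" => (starRingEnd ℂ)
notation "RR" => ℝ × ℝ
notation "NM" => (by norm_num)
notation "PZ" => (by positivity)
notation "SI" => (by simp)
notation "OM" => (by omega)
notation "LI" => (by linarith)
notation "FI" => (by finiteness)
notation "RG" => (by ring)
notation "FP" => (by fun_prop)
open _root_.Finset renaming range → rnq, sum_range_succ → srs, sum_congr → scq, Icc → icq, mem_Icc → miq, mem_range → mrq, sum_le_sum → sls, mem_univ → muq, mul_prod_erase → mpe, prod_le_prod' → plp, prod_mul_distrib → pmd, mul_sum → msq, filter_subset → fsq, prod_congr → pcq, prod_const → pcz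
open _root_.ENNReal renaming ofReal → ofq, rpow_mul → rmq, mul_rpow_of_nonneg → mro, tsum_le_tsum → tlt, tsum_mul_left → tml, rpow_le_rpow → rlr, ofReal_mul → omq, ofReal_pow → opq, ofReal_le_ofReal → olo, rpow_natCast → rnz, tsum_mul_right → tmr, rpow_one → roq, tsum_prod' → tpq, div_le_div_right → dld, rpow_add → raq, mul_ne_top → mnt, rpow_ne_top_of_nonneg → rnt, div_eq_inv_mul → dei, rpow_neg → rnw, lintegral_mul_norm_pow_le → lmn, rpow_two → rtq, tsum_comm → tcq, le_tsum → ltq, mul_inv → miw, tsum_geometric → tgq, mul_div_cancel_right → mdc, ofReal_add → oaq, ofReal_div_of_pos → odo, inv_mul_cancel → imc, ofReal_sum_of_nonneg → oso, add_div → adq, mul_top → mtq, zero_rpow_of_pos → zro, mul_div_cancel → mdcq, inv_ne_top → intq, one_sub_inv_two → osi, ofReal_ne_top → ont, ofReal_inv_of_pos → oio, top_rpow_of_pos → tro, tsum_comp_le_tsum_of_injective → tcl, mul_lt_top → mlt, lt_div_iff_mul_lt → ldi, rpow_le_rpow_of_exponent_le → rlrq, rpow_eq_zero_iff_of_pos →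 rez, ofReal_rpow_of_pos → oro, le_div_iff_mul_le → ldiq, ofReal_le_ofReal_iff → oloq, sum_le_tsum → slt, rpow_le_rpow_of_exponent_ge → rlrz
open _root_.Set renaming indicator_of_mem → iom, Icc → icz, mem_ofPred_eq → moe, mem_iUnion → miz, indicator_of_notMem → ion, mem_preimage → mpq, indicator → inq
open _root_.Complex renaming norm_real → nrq, normSq_eq_norm_sq → nen
open _root_.Real renaming log → lgq, norm_of_nonneg → non, mul_rpow → mrz, rpow_neg → rnv, norm_eq_abs → nea, rpow_pos_of_pos → rpo
open _root_.Nat renaming zero_le → zlq, succ_le_of_lt → slo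
open _root_.Int renaming floor_eq_iff → fei
open _root_.Function renaming comp_def → cdq, Injective → inz, iterate_succ_apply' → isa
open MeasureTheory.Measure renaming restrict_apply_univ → rau, volume_eq_prod → vep
open _root_.Fin renaming eq_castSucc_or_eq_last → eco
noncomputable section
section
variable {c : EE} {x y : ℝ} {g h : ℝ → EE} {f : ℝ → ℂ} {k : ℤ}

structure Grid where
  o : ℤ → ℝ
  m : ℤ → ℤ
  h : ∀ k, o (k+1) = o k + m k * TT^k
namespace Grid
variable (G : Grid)
def idx (k : ℤ) (x : ℝ) : ℤ := ⌊(x - G.o k) / TT^k⌋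
lemma two_pos (k : ℤ) : (0:ℝ) < TT^k := PZ
lemma two_succ (k : ℤ) : TT^(k+1) = 2 * TT^k := by
  rw [zpow_add_one₀ NM]; ring
lemma idx_succ (k : ℤ) (x : ℝ) : G.idx (k+1) x = (G.idx k x - G.m k) / 2 := by
  have h2 := two_pos k
  unfold idx
  rw [G.h, two_succ]
  have : (x - (G.o k + G.m k * TT^k)) / (2 * TT^k)
      = ((x - G.o k) / TT^k - (G.m k : ℤ)) / ((2:ℕ):ℝ) := by
    push_cast; field_simp; ring
  rw [this, Int.floor_div_natCast, Int.floor_sub_intCast]; rfl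
lemma measurable_idx (k : ℤ) : Measurable (G.idx k) := by
  unfold idx
  exact Int.measurable_floor.comp ((measurable_id.sub_const _).div_const _)
def cell (k : ℤ) (x : ℝ) : Set ℝ := {y | G.idx k y = G.idx k x}
lemma measurableSet_cell (k : ℤ) (x : ℝ) : MeasurableSet (G.cell k x) :=
  (G.measurable_idx k) (measurableSet_singleton _)
lemma mem_cell_self (k : ℤ) (x : ℝ) : x ∈ G.cell k x := rfl
lemma cell_eq (k : ℤ) (x : ℝ) : G.cell k x =
    Set.Ico (G.o k + G.idx k x * TT^k) (G.o k + G.idx k x * TT^k + TT^k) := by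
  have h2 := two_pos k
  ext y
  simp only [cell, moe, Set.mem_Ico]
  conv_lhs => lhs; unfold idx
  rw [fei, le_div_iff₀ h2, div_lt_iff₀ h2]
  constructor <;> rintro ⟨a, b⟩ <;> constructor <;> linarith
lemma cell_congr (h : G.idx k x = G.idx k y) : G.cell k x = G.cell k y := by
  unfold cell; rw [h]
lemma dist_of_idx (h : G.idx k y = G.idx k x) : |y - x| ≤ TT^k := by
  have h1 : y ∈ G.cell k x := h
  have h2 := G.mem_cell_self k x
  rw [cell_eq] at h1 h2
  rw [abs_le]; constructor <;> linarith [h1.1, h1.2, h2.1, h2.2]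
lemma idx_mono {j : ℤ} (hjk : j ≤ k) (h : G.idx j x = G.idx j y) :
    G.idx k x = G.idx k y := by
  obtain ⟨n, rfl⟩ := Int.le.dest hjk
  clear hjk
  induction n with
  | zero => simpa using h
  | succ n ih =>
    have : j + ((n+1 : ℕ) : ℤ) = (j + n) + 1 := by push_cast; ring
    rw [this, idx_succ, idx_succ, ih]
lemma volume_cell (k : ℤ) (x : ℝ) : volume (G.cell k x) = ofq (TT^k) := by
  rw [cell_eq, Real.volume_Ico]; congr 1; ring
def sib (k : ℤ) (x : ℝ) : ℝ :=
  if (G.idx k x - G.m k) % 2 = 0 then x + TT^k else x - TT^k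
lemma idx_add (k : ℤ) (x : ℝ) : G.idx k (x + TT^k) = G.idx k x + 1 := by
  have h2 := two_pos k
  unfold idx
  have : (x + TT^k - G.o k) / TT^k = (x - G.o k) / TT^k + 1 := by field_simp; ring
  rw [this, Int.floor_add_one]
lemma idx_sub (k : ℤ) (x : ℝ) : G.idx k (x - TT^k) = G.idx k x - 1 := by
  have := G.idx_add k (x - TT^k)
  rw [sub_add_cancel] at this; omega
lemma sib_sib (k : ℤ) (x : ℝ) : G.sib k (G.sib k x) = x := by
  by_cases h : (G.idx k x - G.m k) % 2 = 0
  · have h1 : G.sib k x = x + TT^k := by unfold sib; rw [if_pos h]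
    rw [h1]; unfold sib; rw [idx_add, if_neg OM]; ring
  · have h1 : G.sib k x = x - TT^k := by unfold sib; rw [if_neg h]
    rw [h1]; unfold sib; rw [idx_sub, if_pos OM]; ring
lemma abs_sib_sub (k : ℤ) (x : ℝ) : |G.sib k x - x| = TT^k := by
  unfold sib; split_ifs
  · rw [add_sub_cancel_left]; exact aop (two_pos k)
  · rw [sub_sub_cancel_left, abs_neg]; exact aop (two_pos k)
lemma idx_succ_sib (k : ℤ) (x : ℝ) : G.idx (k+1) (G.sib k x) = G.idx (k+1) x := by
  rw [idx_succ, idx_succ]; unfold sib; split_ifs with h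
  · rw [idx_add]; omega
  · rw [idx_sub]; omega
lemma idx_sib (k : ℤ) (x y : ℝ) : G.idx k (G.sib k x) = G.idx k (G.sib k y) ↔ G.idx k x = G.idx k y := by
  unfold sib; split_ifs with h h' h' <;> simp only [idx_add, idx_sub] <;> omega
lemma idx_succ_iff (k : ℤ) (x y : ℝ) : G.idx (k+1) y = G.idx (k+1) x ↔
    G.idx k y = G.idx k x ∨ G.idx k y = G.idx k (G.sib k x) := by
  rw [idx_succ, idx_succ]; unfold sib; split_ifs with h
  · rw [idx_add]; omega
  · rw [idx_sub]; omega
lemma idx_sib_ne (k : ℤ) (x : ℝ) : G.idx k (G.sib k x) ≠ G.idx k x := by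
  unfold sib; split_ifs with h
  · rw [idx_add]; omega
  · rw [idx_sub]; omega
lemma measurable_sib (k : ℤ) : Measurable (G.sib k) := by
  unfold sib
  refine Measurable.ite ?_ (measurable_id.add_const _) (measurable_id.sub_const _)
  exact (G.measurable_idx k) (MeasurableSet.of_discrete (s := {i : ℤ | (i - G.m k) % 2 = 0})) 
lemma measurePreserving_sib (k : ℤ) : MeasurePreserving (G.sib k) volume volume := by
  refine ⟨G.measurable_sib k, ?_⟩
  ext s hs
  rw [Measure.map_apply (G.measurable_sib k) hs]
  set A : Set ℝ := {x | (G.idx k x - G.m k) % 2 = 0} with hA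
  have hAm : MeasurableSet A := (G.measurable_idx k) (MeasurableSet.of_discrete (s := {i : ℤ | (i - G.m k) % 2 = 0}))
  rw [← measure_inter_add_sdiff (G.sib k ⁻¹' s) hAm, ← measure_inter_add_sdiff s hAm, add_comm]
  have e1 : (G.sib k ⁻¹' s) ∩ A = (fun x => x + TT^k) ⁻¹' (s \ A) := by
    ext x
    simp only [Set.mem_inter_iff, mpq, Set.mem_sdiff, hA, moe, idx_add]
    constructor
    · rintro ⟨h1, h2⟩; unfold sib at h1; rw [if_pos h2] at h1; exact ⟨h1, OM⟩
    · rintro ⟨h1, h2⟩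
      have h3 : (G.idx k x - G.m k) % 2 = 0 := OM
      unfold sib; rw [if_pos h3]; exact ⟨h1, h3⟩
  have e2 : (G.sib k ⁻¹' s) \ A = (fun x => x - TT^k) ⁻¹' (s ∩ A) := by
    ext x
    simp only [Set.mem_inter_iff, mpq, Set.mem_sdiff, hA, moe, idx_sub]
    constructor
    · rintro ⟨h1, h2⟩; unfold sib at h1; rw [if_neg h2] at h1; exact ⟨h1, OM⟩
    · rintro ⟨h1, h2⟩
      have h3 : ¬ (G.idx k x - G.m k) % 2 = 0 := OM
      unfold sib; rw [if_neg h3]; exact ⟨h1, h3⟩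
  rw [e1, e2, measure_preimage_add_right, (measurePreserving_sub_right volume (TT^k)).measure_preimage (hs.inter hAm).nullMeasurableSet]
lemma lintegral_sib (k : ℤ) (hg : Measurable g) :
    ∫⁻ x, g (G.sib k x) = ∫⁻ x, g x :=
  (G.measurePreserving_sib k).lintegral_comp hg
lemma cell_succ (k : ℤ) (x : ℝ) : G.cell (k+1) x = G.cell k x ∪ G.cell k (G.sib k x) := by
  ext y; exact G.idx_succ_iff k x y
lemma cell_disj (k : ℤ) (x : ℝ) : Disjoint (G.cell k x) (G.cell k (G.sib k x)) := by
  rw [Set.disjoint_left]; intro y h1 h2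
  exact G.idx_sib_ne k x (h2.symm.trans h1)
def len (k : ℤ) : EE := ofq (TT^k)
lemma len_ne_zero (k : ℤ) : len k ≠ 0 := by
  unfold len; rw [Ne, ENNReal.ofReal_eq_zero, not_le]; exact two_pos k
lemma len_ne_top (k : ℤ) : len k ≠ ⊤ := ont
lemma len_succ (k : ℤ) : len (k+1) = 2 * len k := by
  unfold len; rw [two_succ, omq NM]; norm_num
lemma len_add (k u : ℤ) : len (k+u) = len k * len u := by
  unfold len; rw [zpow_add₀ NM, omq (two_pos k).le]
lemma len_nat (n : ℕ) : len n = 2^n := by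
  unfold len; rw [znq, opq NM]; norm_num
def av (k : ℤ) (g : ℝ → EE) (x : ℝ) : EE := (∫⁻ y in G.cell k x, g y) / len k
def E (k : ℤ) (f : ℝ → ℂ) (x : ℝ) : ℂ := (TT^k)⁻¹ • ∫ y in G.cell k x, f y
def D (k : ℤ) (f : ℝ → ℂ) (x : ℝ) : ℂ := G.E k f x - G.E (k+1) f x
lemma av_congr (g) (h : G.idx k x = G.idx k y) : G.av k g x = G.av k g y := by
  unfold av; rw [G.cell_congr h]
lemma E_congr (g) (h : G.idx k x = G.idx k y) : G.E k g x = G.E k g y := by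
  unfold E; rw [G.cell_congr h]
lemma av_succ (k : ℤ) (g : ℝ → EE) (x : ℝ) :
    G.av (k+1) g x = (G.av k g x + G.av k g (G.sib k x)) / 2 := by
  unfold av
  rw [cell_succ, lintegral_union (G.measurableSet_cell _ _) (G.cell_disj k x), len_succ,
    ← adq, dei, dei, dei,
    miw SI SI, maq]
lemma E_succ (k : ℤ) (hf : LocallyIntegrable f) (x : ℝ) :
    G.E (k+1) f x = (1/2 : ℂ) * (G.E k f x + G.E k f (G.sib k x)) := by
  have hi : ∀ x, IntegrableOn f (G.cell k x) := by
    intro x; rw [cell_eq]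
    exact (hf.integrableOn_isCompact isCompact_Icc).mono_set Set.Ico_subset_Icc_self
  unfold E
  rw [cell_succ, setIntegral_union (G.cell_disj k x) (G.measurableSet_cell _ _) (hi _) (hi _), two_succ]
  simp only [Complex.real_smul]; push_cast
  have := (two_pos k).ne'
  have : (2:ℂ)^k ≠ 0 := zpow_ne_zero k two_ne_zero
  field_simp
lemma D_eq (k : ℤ) (hf : LocallyIntegrable f) (x : ℝ) :
    G.D k f x = (1/2 : ℂ) * (G.E k f x - G.E k f (G.sib k x)) := by
  unfold D; rw [G.E_succ k hf]; ring
lemma D_congr (g) (h : G.idx k x = G.idx k y) : G.D k g x = G.D k g y := by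
  unfold D; rw [G.E_congr g h, G.E_congr g (G.idx_mono OM h)]
lemma D_sib (k : ℤ) (hf : LocallyIntegrable f) (x : ℝ) :
    G.D k f (G.sib k x) = - G.D k f x := by
  rw [G.D_eq k hf, G.D_eq k hf, sib_sib]; ring
lemma normD_congr (hf : LocallyIntegrable f)
    (h : G.idx (k+1) y = G.idx (k+1) x) : ‖G.D k f y‖ₑ = ‖G.D k f x‖ₑ := by
  rcases (G.idx_succ_iff k x y).1 h with h | h
  · rw [G.D_congr f h]
  · rw [G.D_congr f h, G.D_sib k hf, enorm_neg]
lemma measurableSet_idx_eq (k : ℤ) : MeasurableSet {p : RR | G.idx k p.1 = G.idx k p.2} := 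
  measurableSet_eq_fun ((G.measurable_idx k).comp mfq) ((G.measurable_idx k).comp msz)
lemma av_eq (k : ℤ) (g : ℝ → EE) (x : ℝ) :
    G.av k g x = (∫⁻ y, {p : RR | G.idx k p.1 = G.idx k p.2}.indicator (fun p => g p.1) (y, x)) / len k := by
  unfold av
  rw [← liq (G.measurableSet_cell k x)]
  rfl
lemma av_le_of (h : ∀ y, G.idx k y = G.idx k x → g y ≤ c) :
    G.av k g x ≤ c := by
  unfold av
  calc _ ≤ (∫⁻ y in G.cell k x, c) / len k := by
        exact dld (setLIntegral_mono mcq fun y hy => h y hy) _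
    _ = c := by
        rw [scz, volume_cell]
        exact mdc (len_ne_zero k) (len_ne_top k)
lemma le_av_of (hg : Measurable g) (h : ∀ y, G.idx k y = G.idx k x → c ≤ g y) :
    c ≤ G.av k g x := by
  unfold av
  calc c = (∫⁻ y in G.cell k x, c) / len k := by
        rw [scz, volume_cell]
        exact (mdc (len_ne_zero k) (len_ne_top k)).symm
    _ ≤ _ := by
        exact dld (setLIntegral_mono hg fun y hy => h y hy) _
lemma av_mono (x : ℝ) (H : ∀ y, g y ≤ h y) : G.av k g x ≤ G.av k h x := by
  unfold av; gcongr; exact H _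
lemma av_const_mul (k : ℤ) (hg : Measurable g) (c : EE) (x : ℝ) :
    G.av k (fun y => c * g y) x = c * G.av k g x := by
  unfold av; rw [lcmz _ hg, mul_div_assoc]
lemma av_mul_congr (k : ℤ) (hg : Measurable g) (x : ℝ)
    (hh : ∀ y, G.idx k y = G.idx k x → h y = h x) :
    G.av k (fun y => h y * g y) x = h x * G.av k g x := by
  rw [← av_const_mul _ _ hg]
  unfold av
  congr 1
  exact setLIntegral_congr_fun (G.measurableSet_cell k x) fun y hy => by rw [hh y hy]
lemma measurable_av_param {Y : Type*} [MeasurableSpace Y] (k : ℤ) {g : ℝ × Y → EE} (hg : Measurable g) :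
    Measurable (fun p : ℝ × Y => G.av k (fun y => g (y, p.2)) p.1) := by
  simp_rw [av_eq]
  refine Measurable.div_const ?_ _
  have hs : MeasurableSet {q : (ℝ × Y) × ℝ | G.idx k q.2 = G.idx k q.1.1} := 
    measurableSet_eq_fun ((G.measurable_idx k).comp msz) ((G.measurable_idx k).comp (measurable_fst.comp mfq))
  have hm : Measurable ({q : (ℝ × Y) × ℝ | G.idx k q.2 = G.idx k q.1.1}.indicator (fun q => g (q.2, q.1.2))) :=
    (hg.comp (measurable_snd.prodMk (measurable_snd.comp mfq))).indicator hs
  exact hm.lintegral_prod_right'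
lemma measurable_av (k : ℤ) (hg : Measurable g) : Measurable (G.av k g) := by
  have := (G.measurable_av_param (Y := ℝ) k (g := fun p => g p.1) (hg.comp mfq))
  have h2 : Measurable (fun x : ℝ => (x, (0:ℝ))) := measurable_id.prodMk mcq
  have h3 := this.comp h2
  simp only [cdq] at h3
  exact h3
lemma measurable_E_param {Y : Type*} [MeasurableSpace Y] (k : ℤ) {f : ℝ × Y → ℂ} (hf : Measurable f) :
    Measurable (fun p : ℝ × Y => G.E k (fun y => f (y, p.2)) p.1) := by
  have hs : MeasurableSet {q : (ℝ × Y) × ℝ | G.idx k q.2 = G.idx k q.1.1} := 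
    measurableSet_eq_fun ((G.measurable_idx k).comp msz) ((G.measurable_idx k).comp (measurable_fst.comp mfq))
  have hm : Measurable ({q : (ℝ × Y) × ℝ | G.idx k q.2 = G.idx k q.1.1}.indicator (fun q => f (q.2, q.1.2))) :=
    (hf.comp (measurable_snd.prodMk (measurable_snd.comp mfq))).indicator hs
  have h2 := (hm.stronglyMeasurable.integral_prod_right' (ν := volume)).measurable.const_smul ((TT^k)⁻¹)
  convert h2 using 2 with p
  simp only [E, Pi.smul_apply]
  congr 1
  rw [← integral_indicator (G.measurableSet_cell k _)]
  rfl
lemma measurable_E (k : ℤ) (hf : Measurable f) : Measurable (G.E k f) := by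
  have := (G.measurable_E_param (Y := ℝ) k (f := fun p => f p.1) (hf.comp mfq))
  have h2 : Measurable (fun x : ℝ => (x, (0:ℝ))) := measurable_id.prodMk mcq
  have h3 := this.comp h2
  simp only [cdq] at h3
  exact h3
lemma lintegral_av_mul (k : ℤ) (hg : Measurable g) (hh : Measurable h) :
    ∫⁻ x, G.av k g x * h x = ∫⁻ x, g x * G.av k h x := by
  have key : ∀ g h : ℝ → EE, Measurable g → Measurable h → ∫⁻ x, G.av k g x * h x =
     (∫⁻ x, ∫⁻ y, {p : RR | G.idx k p.1 = G.idx k p.2}.indicator (fun p => g p.1 * h p.2) (y, x)) / len k := by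
    intro g h hg hh
    rw [dei, ← lcmq _ _ (by simp [len_ne_zero])]
    congr 1; ext x
    rw [av_eq, dei, maq]
    congr 1
    rw [← lintegral_mul_const]
    · congr 1; ext y; by_cases hy : G.idx k y = G.idx k x <;> simp [inq, hy]
    · exact ((hg.comp mfq).indicator (G.measurableSet_idx_eq k)).comp (measurable_id.prodMk mcq)
  rw [key g h hg hh]
  simp_rw [mcz (g _)]
  rw [key h g hh hg]
  congr 1
  rw [lintegral_lintegral_swap]
  · congr 1; ext x; congr 1; ext y
    by_cases hy : G.idx k x = G.idx k y
    · simp [inq, hy, mcz]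
    · simp [inq, hy, Ne.symm hy]
  · exact ((((hh.comp msz).mul (hg.comp mfq)).indicator (G.measurableSet_idx_eq k)).comp measurable_swap).aemeasurable
lemma av_one (k : ℤ) (x : ℝ) : G.av k (fun _ => 1) x = 1 :=
  le_antisymm (G.av_le_of fun _ _ => le_rfl) (G.le_av_of mcq fun _ _ => le_rfl)
lemma lintegral_av (k : ℤ) (hg : Measurable g) : ∫⁻ x, G.av k g x = ∫⁻ x, g x := by
  have := G.lintegral_av_mul k hg (measurable_const (a := (1:EE)))
  simpa [av_one] using this
lemma enorm_E_le (k : ℤ) (f : ℝ → ℂ) (x : ℝ) : ‖G.E k f x‖ₑ ≤ G.av k (fun y => ‖f y‖ₑ) x := by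
  unfold E av
  rw [enorm_smul, dei]
  gcongr
  · rw [len, ← onq, norm_inv, nea, aop (two_pos k),
      oio (two_pos k)]
  · exact eil _
end Grid
end
section
variable {s : ℝ}

lemma len_eq_zpow (j : ℤ) : Grid.len j = (2:EE)^j := by
  rcases Int.eq_nat_or_neg j with ⟨n, rfl | rfl⟩
  · rw [Grid.len_nat, znq]
  · have h : Grid.len (-n) * Grid.len n = 1 := by
      rw [← Grid.len_add]; simp [Grid.len]
    rw [ENNReal.zpow_neg, znq, ← Grid.len_nat]
    exact ENNReal.eq_inv_of_mul_eq_one_left h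
lemma exists_len {a : EE} (h0 : a ≠ 0) (ht : a ≠ ⊤) : ∃ j : ℤ, Grid.len j < a ∧ a ≤ Grid.len (j+1) := by
  obtain ⟨n, hn⟩ := ENNReal.exists_mem_Ioc_zpow h0 ht (y := 2) NM NM
  exact ⟨n, by rw [len_eq_zpow]; exact hn.1, by rw [len_eq_zpow]; exact hn.2⟩
lemma len_mono {i j : ℤ} (h : i ≤ j) : Grid.len i ≤ Grid.len j := by
  unfold Grid.len
  exact olo (zpow_le_zpow_right₀ NM h)
def geoC (s : ℝ) : EE := ∑' i : ℕ, (((2:EE)^(-s)))^i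
lemma geoC_ne_top (hs : 0 < s) : geoC s ≠ ⊤ := by
  unfold geoC
  rw [tgq]
  simp only [ne_eq, ENNReal.inv_eq_top, tsub_eq_zero_iff_le, not_le]
  exact ENNReal.rpow_lt_one_of_one_lt_of_neg NM LI
lemma sum_len_le (hs : 0 < s) (g : EE) :
    ∑' j : ℤ, (if Grid.len j < g then (Grid.len j)^s else 0) ≤ geoC s * g^s := by
  rcases eq_or_ne g 0 with rfl | h0
  · simp
  rcases eq_or_ne g ⊤ with rfl | ht
  · rw [tro hs, mtq]
    · exact le_top
    · unfold geoC
      intro h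
      have := ENNReal.tsum_eq_zero.1 h 0
      simp at this
  obtain ⟨J, hJ, hJ'⟩ := exists_len h0 ht
  have hinj : inz (fun i : ℕ => J - (i:ℤ)) := by
    intro a b h; simp at h; exact h
  rw [← hinj.tsum_eq]
  · unfold geoC
    rw [← tmr]
    refine tlt fun i => ?_
    split_ifs
    · rw [sub_eq_add_neg, Grid.len_add, mro _ _ hs.le, mcz]
      have : (Grid.len (-(i:ℤ)))^s = ((2:EE)^(-s))^i := by
        rw [len_eq_zpow, ENNReal.zpow_neg, znq, rnw, ← ENNReal.inv_pow, ENNReal.inv_rpow, 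
          ← rnz, ← rnz, ← rmq, ← rmq, mcz]
      rw [this]
      gcongr
    · exact zero_le
  · intro j hj
    simp only [Function.mem_support, ne_eq, ite_eq_right_iff, not_forall] at hj
    obtain ⟨h1, _⟩ := hj
    have : j ≤ J := by
      by_contra h
      have := len_mono (show J + 1 ≤ j by omega)
      exact absurd (lt_of_lt_of_le h1 (hJ'.trans this)) (lt_irrefl _)
    exact ⟨(J - j).toNat, by simp; omega⟩
lemma marcinkiewicz {α : Type*} [MeasurableSpace α] (μ : Measure α) {r : ℝ} (hr : 1 < r) (C : EE)
    {G g : α → EE} (hG : Measurable G) (hg : Measurable g)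
    (H : ∀ j : ℤ, Grid.len j * μ {x | 2 * Grid.len j < G x} ≤ C * ∫⁻ x in {x | Grid.len j < g x}, g x ∂μ) :
    ∫⁻ x, G x ^ r ∂μ ≤ (4^r * geoC (r-1)) * C * ∫⁻ x, g x ^ r ∂μ := by
  have hpt : ∀ a : EE, a ^ r ≤ ∑' j : ℤ, (if 2 * Grid.len j < a then (4 * Grid.len j)^r else 0) := by
    intro a
    rcases eq_or_ne a 0 with rfl | h0
    · rw [zro LI]; exact zero_le
    rcases eq_or_ne a ⊤ with rfl | ht
    · have hinj : inz (fun i : ℕ => (i:ℤ)) := Nat.cast_injective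
      refine ltz ?_ (tcl hinj _)
      have : ∀ i : ℕ, (1:EE) ≤ (if 2 * Grid.len (i:ℤ) < ⊤ then (4 * Grid.len (i:ℤ))^r else 0) := by
        intro i
        rw [if_pos (mlt NM (Grid.len_ne_top _).lt_top)]
        refine ENNReal.one_le_rpow ?_ LI
        rw [Grid.len_nat]
        calc (1:EE) ≤ 4 * 1^i := NM
          _ ≤ _ := by gcongr; norm_num
      refine ltz ?_ (tlt this)
      rw [ENNReal.tsum_const_eq_top_of_ne_zero NM]; exact le_top
    · obtain ⟨J, hJ, hJ'⟩ := exists_len h0 ht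
      refine ltz ?_ (ltq (J-1))
      have e : Grid.len J = 2 * Grid.len (J-1) := by rw [← Grid.len_succ]; congr 1; ring
      rw [← e, if_pos hJ]
      refine rlr ?_ LI
      refine hJ'.trans ?_
      rw [Grid.len_succ, e, ← maq]; norm_num
  have hm : ∀ j : ℤ, MeasurableSet {x | 2 * Grid.len j < G x} := fun j => measurableSet_lt mcq hG
  have hm' : ∀ j : ℤ, MeasurableSet {x | Grid.len j < g x} := fun j => measurableSet_lt mcq hg
  calc ∫⁻ x, G x ^ r ∂μ ≤ ∫⁻ x, ∑' j : ℤ, (if 2 * Grid.len j < G x then (4 * Grid.len j)^r else 0) ∂μ :=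
        lmq fun x => hpt _
    _ = ∑' j : ℤ, (4 * Grid.len j)^r * μ {x | 2 * Grid.len j < G x} := by
        rw [ltw]
        · congr 1; ext j
          rw [← scz, ← liq (hm j)]
          congr 1; ext x
          by_cases hx : 2 * Grid.len j < G x <;> simp [inq, hx]
        · intro j
          exact (Measurable.ite (hm j) mcq mcq).aemeasurable
    _ ≤ ∑' j : ℤ, 4^r * (Grid.len j)^(r-1) * (C * ∫⁻ x in {x | Grid.len j < g x}, g x ∂μ) := by
        refine tlt fun j => ?_
        rw [mro _ _ LI, maq, maq]
        refine mlm ?_ _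
        calc (Grid.len j)^r * μ {x | 2 * Grid.len j < G x} 
            = (Grid.len j)^(r-1) * (Grid.len j * μ {x | 2 * Grid.len j < G x}) := by
              rw [← maq]; congr 1
              conv_rhs => rw [← roq (Grid.len j), ← rmq, one_mul]
              rw [← raq _ _ (Grid.len_ne_zero j) (Grid.len_ne_top j)]; congr 1; ring
          _ ≤ _ := mlm (H j) _
    _ = 4^r * C * ∫⁻ x, ∑' j : ℤ, (if Grid.len j < g x then (Grid.len j)^(r-1) else 0) * g x ∂μ := by
        rw [ltw]
        · rw [← tml]
          congr 1; ext j
          have : ∫⁻ x, (if Grid.len j < g x then (Grid.len j)^(r-1) else 0) * g x ∂μ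
             = (Grid.len j)^(r-1) * ∫⁻ x in {x | Grid.len j < g x}, g x ∂μ := by
            rw [← lcmz _ hg, ← liq (hm' j)]
            congr 1; ext x
            by_cases hx : Grid.len j < g x <;> simp [inq, hx]
          rw [this]; ring
        · intro j
          exact ((Measurable.ite (hm' j) mcq mcq).mul hg).aemeasurable
    _ ≤ 4^r * C * ∫⁻ x, geoC (r-1) * g x ^ r ∂μ := by
        gcongr with x
        rw [tmr]
        rcases eq_or_ne (g x) 0 with h0 | h0
        · simp [h0]
        rcases eq_or_ne (g x) ⊤ with ht | ht
        · rw [ht, tro LI, mtq (a := geoC _)]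
          · exact le_top
          · unfold geoC
            intro h
            have := ENNReal.tsum_eq_zero.1 h 0
            simp at this
        calc _ ≤ geoC (r-1) * (g x)^(r-1) * g x := by gcongr; exact sum_len_le LI _
          _ = _ := by
            rw [maq]; congr 1
            conv_lhs => rw [← roq (g x), ← rmq, one_mul]
            rw [← raq _ _ h0 ht]; congr 1; ring
    _ = _ := by
        rw [lcmz _ (hg.pow_const r)]; ring
end
section
variable {x : ℝ} {V h : ℝ → EE} {N j : ℤ}

namespace Grid
variable (G : Grid)
def topset (lam : EE) (g V : ℝ → EE) (N j : ℤ) : Set ℝ :=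
  {x | lam * G.av j V x < G.av j g x ∧ ∀ i, j < i → i ≤ N → ¬ (lam * G.av i V x < G.av i g x)}
variable {G} {lam : EE} {g V : ℝ → EE}
lemma topset_inv {y : ℝ} (h : G.idx j y = G.idx j x) (hx : x ∈ G.topset lam g V N j) :
    y ∈ G.topset lam g V N j := by
  refine ⟨by rw [G.av_congr V h, G.av_congr g h]; exact hx.1, fun i hi hN => ?_⟩
  have h' := G.idx_mono hi.le h
  rw [G.av_congr V h', G.av_congr g h']; exact hx.2 i hi hN
lemma measurableSet_topset (hg : Measurable g) (hV : Measurable V) (N j : ℤ) :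
    MeasurableSet (G.topset lam g V N j) := by
  have h1 : ∀ i, MeasurableSet {x | lam * G.av i V x < G.av i g x} := fun i =>
    measurableSet_lt ((G.measurable_av i hV).const_mul _) (G.measurable_av i hg)
  have : G.topset lam g V N j = {x | lam * G.av j V x < G.av j g x} ∩
      ⋂ i : ℤ, ⋂ _ : j < i, ⋂ _ : i ≤ N, {x | lam * G.av i V x < G.av i g x}ᶜ := by
    ext x; simp [topset]
  rw [this]
  exact (h1 j).inter (MeasurableSet.iInter fun i => MeasurableSet.iInter fun _ => MeasurableSet.iInter fun _ => (h1 i).compl)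
lemma topset_disj {i : ℤ} (hi : i ≤ N) (hj : j ≤ N) (hij : i ≠ j) :
    Disjoint (G.topset lam g V N i) (G.topset lam g V N j) := by
  rw [Set.disjoint_left]; intro x h1 h2
  rcases lt_or_gt_of_ne hij with h | h
  · exact h1.2 j h hj h2.1
  · exact h2.2 i h hi h1.1
lemma exists_topset (hj : j ≤ N) (h : lam * G.av j V x < G.av j g x) :
    ∃ i, j ≤ i ∧ i ≤ N ∧ x ∈ G.topset lam g V N i := by
  obtain ⟨i, ⟨h1, h2⟩, h3⟩ := Int.exists_greatest_of_bdd (P := fun i => lam * G.av i V x < G.av i g x ∧ i ≤ N)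
    ⟨N, fun z hz => hz.2⟩ ⟨j, h, hj⟩
  exact ⟨i, h3 j ⟨h, hj⟩, h2, h1, fun i' hi' hN hb => by have := h3 i' ⟨hb, hN⟩; omega⟩
lemma lintegral_inv_set (k : ℤ) (hg : Measurable g) {s : Set ℝ} (hs : MeasurableSet s)
    (hinv : ∀ x y, G.idx k y = G.idx k x → x ∈ s → y ∈ s) :
    ∫⁻ x in s, g x = ∫⁻ x in s, G.av k g x := by
  have e : ∀ x, G.av k (s.indicator (fun _ => (1:EE))) x = s.indicator (fun _ => (1:EE)) x := by
    intro x
    have := G.av_mul_congr k (g := fun _ => (1:EE)) (h := s.indicator (fun _ => (1:EE))) mcq x (by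
      intro y hy
      by_cases hx : x ∈ s
      · simp [hx, hinv x y hy hx]
      · have : y ∉ s := fun h => hx (hinv y x hy.symm h)
        simp [hx, this])
    simpa [av_one] using this
  have h1 := G.lintegral_av_mul k hg (measurable_const.indicator hs : Measurable (s.indicator (fun _ => (1:EE))))
  simp_rw [e] at h1
  rw [← liq hs, ← liq hs]
  have h2 : ∀ f : ℝ → EE, (fun x => f x * s.indicator (fun _ => (1:EE)) x) = s.indicator f := by
    intro f; ext x; by_cases hx : x ∈ s <;> simp [hx]
  rw [h2, h2] at h1
  exact h1.symm
lemma topset_sum (hg : Measurable g) (hV : Measurable V) (N : ℤ) (S : Finset ℤ) (hS : ∀ j ∈ S, j ≤ N) :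
    ∑ j ∈ S, lam * ∫⁻ x in G.topset lam g V N j, V x ≤ ∫⁻ x in ⋃ j ∈ S, G.topset lam g V N j, g x := by
  rw [lintegral_biUnion_finset (fun i hi j hj hij => topset_disj (hS i hi) (hS j hj) hij)
    (fun j _ => measurableSet_topset hg hV N j)]
  refine sls fun j _ => ?_
  have hm := measurableSet_topset (G := G) (lam := lam) hg hV N j
  rw [lintegral_inv_set j hV hm (fun x y h hx => topset_inv h hx), lintegral_inv_set j hg hm (fun x y h hx => topset_inv h hx),
    ← lcmz _ (G.measurable_av j hV)]
  exact setLIntegral_mono (G.measurable_av j hg) fun x hx => hx.1.le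
def MV (G : Grid) (V h : ℝ → EE) (x : ℝ) : EE := ⨆ j : ℤ, G.av j (fun y => h y * V y) x / G.av j V x
lemma measurable_MV (hV : Measurable V) (hh : Measurable h) : Measurable (G.MV V h) :=
  Measurable.iSup fun j => (G.measurable_av j (hh.mul hV)).div (G.measurable_av j hV)
lemma weak_MV (hV : Measurable V) (hh : Measurable h)
    (h0 : ∀ j x, G.av j V x ≠ 0) (ht : ∀ j x, G.av j V x ≠ ⊤) (lam : EE) :
    lam * ∫⁻ x in {x | lam < G.MV V h x}, V x ≤ ∫⁻ x, h x * V x := by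
  have hhV : Measurable (fun y => h y * V y) := hh.mul hV
  have e : {x | lam < G.MV V h x} = ⋃ N : ℕ, ⋃ j ∈ icq (-(N:ℤ)) N, G.topset lam (fun y => h y * V y) V N j := by
    ext x
    simp only [moe, MV, lt_iSup_iff, miz, miq, exists_prop]
    constructor
    · rintro ⟨j, hj⟩
      rw [ldi (Or.inl (h0 j x)) (Or.inl (ht j x))] at hj
      obtain ⟨i, h1, h2, h3⟩ := exists_topset (N := j.natAbs) OM hj
      exact ⟨j.natAbs, i, ⟨ OM, h2⟩, h3⟩
    · rintro ⟨N, j, _, hj⟩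
      exact ⟨j, by rw [ldi (Or.inl (h0 j x)) (Or.inl (ht j x))]; exact hj.1⟩
  have hmono : Monotone (fun N : ℕ => ⋃ j ∈ icq (-(N:ℤ)) N, G.topset lam (fun y => h y * V y) V N j) := by
    intro N N' hN x hx
    simp only [miz, miq, exists_prop] at hx ⊢
    obtain ⟨j, ⟨h1, h2⟩, h3⟩ := hx
    obtain ⟨i, h1', h2', h3'⟩ := exists_topset (N := (N':ℤ)) OM h3.1
    exact ⟨i, ⟨ OM, h2'⟩, h3'⟩
  have hm : ∀ N : ℕ, MeasurableSet (⋃ j ∈ icq (-(N:ℤ)) N, G.topset lam (fun y => h y * V y) V N j) := fun N =>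
    Finset.measurableSet_biUnion _ fun j _ => measurableSet_topset hhV hV _ _
  rw [e]
  have h1 : ∫⁻ x in (⋃ N : ℕ, ⋃ j ∈ icq (-(N:ℤ)) N, G.topset lam (fun y => h y * V y) V N j), V x
      = ⨆ N : ℕ, ∫⁻ x in (⋃ j ∈ icq (-(N:ℤ)) N, G.topset lam (fun y => h y * V y) V N j), V x := by
    simp_rw [← withDensity_apply V (MeasurableSet.iUnion hm), ← withDensity_apply V (hm _)]
    exact hmono.measure_iUnion
  rw [h1, ENNReal.mul_iSup]
  refine iSup_le fun N => ?_
  rw [lintegral_biUnion_finset (fun i hi j hj hij => topset_disj (miq.1 hi).2 (miq.1 hj).2 hij)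
    (fun j _ => measurableSet_topset hhV hV _ j), msq]
  refine (topset_sum hhV hV N _ (fun j hj => (miq.1 hj).2)).trans ?_
  exact setLIntegral_le_lintegral _ _
lemma av_add (k : ℤ) {g : ℝ → EE} (hg : Measurable g) (x : ℝ) :
    G.av k (fun y => g y + h y) x = G.av k g x + G.av k h x := by
  unfold av; rw [lal hg, adq]
theorem MV_bound {r : ℝ} (hr : 1 < r) (hV : Measurable V) (hh : Measurable h)
    (h0 : ∀ j x, G.av j V x ≠ 0) (ht : ∀ j x, G.av j V x ≠ ⊤) :
    ∫⁻ x, G.MV V h x ^ r * V x ≤ (4^r * geoC (r-1)) * ∫⁻ x, h x ^ r * V x := by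
  have key := marcinkiewicz (volume.withDensity V) hr 1 (measurable_MV (G := G) hV hh) hh ?_
  · rw [lintegral_withDensity_eq_lintegral_mul _ hV ((measurable_MV hV hh).pow_const r), 
      lintegral_withDensity_eq_lintegral_mul _ hV (hh.pow_const r), mul_one] at key
    simpa [mcz] using key
  · intro j
    set lam := len j
    set h1 : ℝ → EE := {x | lam < h x}.indicator h
    have hs : MeasurableSet {x | lam < h x} := measurableSet_lt mcq hh
    have hh1 : Measurable h1 := hh.indicator hs
    have hle : ∀ x, G.MV V h x ≤ lam + G.MV V h1 x := by
      intro x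
      refine iSup_le fun i => ?_
      have : G.av i (fun y => h y * V y) x ≤ lam * G.av i V x + G.av i (fun y => h1 y * V y) x := by
        rw [← av_const_mul _ _ hV, ← av_add _ (hV.const_mul _)]
        refine av_mono _ _ fun y => ?_
        rw [← add_mul]; gcongr
        by_cases hy : lam < h y
        · simp [h1, hy]
        · exact (not_lt.1 hy).trans le_self_add
      calc _ ≤ (lam * G.av i V x + G.av i (fun y => h1 y * V y) x) / G.av i V x := by gcongr
        _ = lam + G.av i (fun y => h1 y * V y) x / G.av i V x := by
            rw [adq, mdc (h0 i x) (ht i x)]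
        _ ≤ _ := by gcongr; exact le_iSup (fun i => G.av i (fun y => h1 y * V y) x / G.av i V x) i
    have hsub : {x | 2 * lam < G.MV V h x} ⊆ {x | lam < G.MV V h1 x} := by
      intro x hx
      simp only [moe] at hx ⊢
      have := hx.trans_le (hle x)
      rw [two_mul] at this
      exact (ENNReal.add_lt_add_iff_left (len_ne_top j)).1 this
    calc _ ≤ lam * (volume.withDensity V) {x | lam < G.MV V h1 x} := by gcongr
      _ = lam * ∫⁻ x in {x | lam < G.MV V h1 x}, V x := by
          rw [withDensity_apply _ (measurableSet_lt mcq (measurable_MV hV hh1))]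
      _ ≤ ∫⁻ x, h1 x * V x := weak_MV hV hh1 h0 ht lam
      _ = _ := by
          rw [one_mul, setLIntegral_withDensity_eq_setLIntegral_mul _ hV hh hs, ← liq hs]
          congr 1; ext x
          by_cases hx : lam < h x <;> simp [h1, inq, hx, mcz]
end Grid
end
section
variable {L : ℕ} {g h : ℝ → EE} {k n u : ℤ}

def gsgn (k : ℤ) : ℤ := if Even k then 1 else -1
def grid : Bool → Grid
  | false => ⟨fun _ => 0, fun _ => 0, by intro k; simp⟩
  | true => ⟨fun k => gsgn k * TT^k / 3, fun k => - gsgn k, by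
      intro k
      have : gsgn (k+1) = - gsgn k := by
        unfold gsgn; by_cases h : Even k <;> simp [h]
      rw [this, Grid.two_succ]; push_cast; ring⟩
lemma grid_cover (K : ℤ) {c ρ : ℝ} (hρ : 0 ≤ ρ) (h : 2 * ρ < TT^K / 3) :
    ∃ α, ∀ y ∈ icz (c - ρ) (c + ρ), (grid α).idx K y = (grid α).idx K c := by
  have h2 := Grid.two_pos K
  have hYX : (c + ρ) / TT^K - (c - ρ) / TT^K < 1/3 := by
    rw [← sub_div, div_lt_iff₀ h2]; linarith
  have mono : ∀ α, (grid α).idx K (c - ρ) = (grid α).idx K (c + ρ) →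
      ∀ y ∈ icz (c - ρ) (c + ρ), (grid α).idx K y = (grid α).idx K c := by
    intro α he
    have hm : Monotone ((grid α).idx K) := by
      intro a b hab; unfold Grid.idx; gcongr
    intro y hy
    have a1 := hm hy.1
    have a2 := hm hy.2
    have a3 := hm (show c - ρ ≤ c by linarith)
    have a4 := hm (show c ≤ c + ρ by linarith)
    omega
  by_cases he : (grid false).idx K (c - ρ) = (grid false).idx K (c + ρ)
  · exact ⟨false, mono _ he⟩
  refine ⟨true, mono _ ?_⟩
  unfold Grid.idx grid at he ⊢
  simp only [sub_zero] at he ⊢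
  set X := (c - ρ) / TT^K
  set Y := (c + ρ) / TT^K
  have hXY : X ≤ Y := by apply dldq _ h2.le; linarith
  have hlt : ⌊X⌋ < ⌊Y⌋ := lt_of_le_of_ne (Int.floor_mono hXY) he
  have hX : X < (⌊Y⌋:ℝ) := Int.floor_lt.1 hlt
  have hY : (⌊Y⌋:ℝ) ≤ Y := Int.floor_le Y
  have eX : ∀ w : ℝ, (w - gsgn K * TT^K / 3) / TT^K = w / TT^K - gsgn K / 3 := by
    intro w; field_simp
  rw [eX, eX]
  change ⌊X - _⌋ = ⌊Y - _⌋
  unfold gsgn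
  split_ifs
  · have e1 : ⌊X - ((1:ℤ):ℝ)/3⌋ = ⌊Y⌋ - 1 := by
      rw [fei]; push_cast; constructor <;> linarith
    have e2 : ⌊Y - ((1:ℤ):ℝ)/3⌋ = ⌊Y⌋ - 1 := by
      rw [fei]; push_cast; constructor <;> linarith
    rw [e1, e2]
  · have e1 : ⌊X - ((-1:ℤ):ℝ)/3⌋ = ⌊Y⌋ := by
      rw [fei]; push_cast; constructor <;> linarith
    have e2 : ⌊Y - ((-1:ℤ):ℝ)/3⌋ = ⌊Y⌋ := by
      rw [fei]; push_cast; constructor <;> linarith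
    rw [e1, e2]
def sball (n u k : ℤ) (x : ℝ) : Set ℝ :=
  icz (x + n * TT^k - TT^(k+u)) (x + n * TT^k + TT^(k+u))
def BB (n u k : ℤ) (g : ℝ → EE) (x : ℝ) : EE := (∫⁻ y in sball n u k x, g y) / Grid.len (k+u)
def MS (n : ℤ) (g : ℝ → EE) (x : ℝ) : EE := ⨆ k : ℤ, BB n 0 k g x
lemma measurableSet_sball (n u k : ℤ) (x : ℝ) : MeasurableSet (sball n u k x) := measurableSet_Icc
lemma volume_sball (n u k : ℤ) (x : ℝ) : volume (sball n u k x) = 2 * Grid.len (k+u) := by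
  unfold sball; rw [Real.volume_Icc, Grid.len, show (2:EE) = ofq 2 by norm_num, ← omq NM]
  congr 1; ring
lemma mem_sball {x y : ℝ} : y ∈ sball n u k x ↔ |y - x - n * TT^k| ≤ TT^(k+u) := by
  unfold sball; rw [abs_le, Set.mem_Icc]; constructor <;> rintro ⟨a, b⟩ <;> constructor <;> linarith
lemma measurableSet_sball_rel (n u k : ℤ) : MeasurableSet {p : RR | p.1 ∈ sball n u k p.2} := by
  simp_rw [mem_sball]
  exact measurableSet_le FP mcq
lemma measurable_BB_param {Y : Type*} [MeasurableSpace Y] (n u k : ℤ) {g : ℝ × Y → EE} (hg : Measurable g) :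
    Measurable (fun p : ℝ × Y => BB n u k (fun y => g (y, p.2)) p.1) := by
  unfold BB
  refine Measurable.div_const ?_ _
  have hs : MeasurableSet {q : (ℝ × Y) × ℝ | q.2 ∈ sball n u k q.1.1} :=
    (measurable_snd.prodMk (measurable_fst.comp mfq)) (measurableSet_sball_rel n u k)
  have hm : Measurable ({q : (ℝ × Y) × ℝ | q.2 ∈ sball n u k q.1.1}.indicator (fun q => g (q.2, q.1.2))) :=
    (hg.comp (measurable_snd.prodMk (measurable_snd.comp mfq))).indicator hs
  convert hm.lintegral_prod_right' (ν := volume) using 2 with p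
  rw [← liq (measurableSet_sball _ _ _ _)]
  rfl
lemma measurable_BB (n u k : ℤ) (hg : Measurable g) : Measurable (BB n u k g) := by
  have := (measurable_BB_param (Y := ℝ) n u k (g := fun p => g p.1) (hg.comp mfq))
  have h2 : Measurable (fun x : ℝ => (x, (0:ℝ))) := measurable_id.prodMk mcq
  have h3 := this.comp h2
  simp only [cdq] at h3
  exact h3
lemma measurable_MS_param {Y : Type*} [MeasurableSpace Y] (n : ℤ) {g : ℝ × Y → EE} (hg : Measurable g) :
    Measurable (fun p : ℝ × Y => MS n (fun y => g (y, p.2)) p.1) := by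
  unfold MS; exact Measurable.iSup fun k => measurable_BB_param n 0 k hg
lemma measurable_MS (n : ℤ) (hg : Measurable g) : Measurable (MS n g) :=
  Measurable.iSup fun k => measurable_BB n 0 k hg
lemma BB_mono (x : ℝ) (H : ∀ y, g y ≤ h y) : BB n u k g x ≤ BB n u k h x := by
  unfold BB; gcongr; exact H _
lemma BB_add (n u k : ℤ) (hg : Measurable g) (x : ℝ) :
    BB n u k (fun y => g y + h y) x = BB n u k g x + BB n u k h x := by
  unfold BB; rw [lal hg, adq]
lemma BB_const (n u k : ℤ) (c : EE) (x : ℝ) : BB n u k (fun _ => c) x = 2 * c := by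
  unfold BB; rw [scz, volume_sball, ← maq,
    mdc (Grid.len_ne_zero _) (Grid.len_ne_top _), mcz]
lemma exists_av_of_BB (n k : ℤ) (g : ℝ → EE) (x : ℝ) :
    ∃ α, BB n 0 k g x ≤ 8 * (grid α).av (k+3) g (x + n * TT^k) := by
  have h2 := Grid.two_pos k
  have h8 : TT^(k+3) = 8 * TT^k := by rw [zpow_add₀ NM]; norm_num; ring
  obtain ⟨α, hα⟩ := grid_cover (k+3) (c := x + n * TT^k) (ρ := TT^k) h2.le (by rw [h8]; linarith)
  refine ⟨α, ?_⟩
  unfold BB Grid.av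
  have hl : Grid.len (k+3) = 8 * Grid.len k := by
    rw [show k + 3 = ((k+1)+1)+1 by ring, Grid.len_succ, Grid.len_succ, Grid.len_succ, ← maq, ← maq]; norm_num
  rw [hl, add_zero, dei, dei, miw SI SI, ← maq, ← maq,
    ENNReal.mul_inv_cancel NM NM, one_mul]
  gcongr
  intro y hy
  refine hα y ?_
  unfold sball at hy; rw [add_zero] at hy; exact hy
lemma MS_weak (hn : |(n:ℝ)| ≤ 2^L) (hg : Measurable g) (lam : EE) :
    lam * volume {x | 8 * lam < MS n g x} ≤ 2 * (L + 3) * ∫⁻ x, g x := by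
  have e : {x | 8 * lam < MS n g x} = ⋃ N : ℕ, ⋃ k ∈ icq (-(N:ℤ)) N, {x | 8 * lam < BB n 0 k g x} := by
    ext x
    simp only [moe, MS, lt_iSup_iff, miz, miq, exists_prop]
    constructor
    · rintro ⟨k, hk⟩; exact ⟨k.natAbs, k, OM, hk⟩
    · rintro ⟨N, k, _, hk⟩; exact ⟨k, hk⟩
  have hmono : Monotone (fun N : ℕ => ⋃ k ∈ icq (-(N:ℤ)) N, {x | 8 * lam < BB n 0 k g x}) := by
    intro N N' hN x hx
    simp only [miz, miq, exists_prop] at hx ⊢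
    obtain ⟨k, h1, h2⟩ := hx
    exact ⟨k, OM, h2⟩
  rw [e, hmono.measure_iUnion, ENNReal.mul_iSup]
  refine iSup_le fun N => ?_
  set S := icq (-(N:ℤ)+3) (N+3) with hS
  let O : Bool → ℤ → Set ℝ := fun α i => (grid α).topset lam g (fun _ => 1) (N+3) i
  have hO : ∀ α i, MeasurableSet (O α i) := fun α i => Grid.measurableSet_topset hg mcq _ _
  have hsub : (⋃ k ∈ icq (-(N:ℤ)) N, {x | 8 * lam < BB n 0 k g x}) ⊆
      ⋃ α ∈ (Finset.univ : Finset Bool), ⋃ i ∈ S, ((⋃ i0 ∈ rnq L, (fun x => x + n * TT^(i-3-i0)) ⁻¹' O α i) ∪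
        (⋃ ε ∈ icq (-1:ℤ) 1, (fun x => x + ε * TT^i) ⁻¹' O α i)) := by
    intro x hx
    simp only [miz, miq, exists_prop, moe] at hx
    obtain ⟨k, hk, hx⟩ := hx
    obtain ⟨α, hα⟩ := exists_av_of_BB n k g x
    have hb : lam < (grid α).av (k+3) g (x + n * TT^k) := by
      have := hx.trans_le hα
      exact (ENNReal.mul_lt_mul_iff_right NM NM).1 this
    obtain ⟨i, h1, h2, h3⟩ := Grid.exists_topset (G := grid α) (V := fun _ => 1) (lam := lam) (g := g) (N := N+3) (j := k+3) OM (by rw [Grid.av_one, mul_one]; exact hb)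
    simp only [miz, exists_prop]
    refine ⟨α, muq _, i, by rw [hS, miq]; omega, ?_⟩
    by_cases hi : i - (k+3) < L
    · left
      simp only [miz, exists_prop]
      refine ⟨(i-(k+3)).toNat, by rw [mrq]; omega, ?_⟩
      have : i - 3 - ((i-(k+3)).toNat : ℤ) = k := OM
      rw [mpq, this]; exact h3
    · right
      simp only [miz, exists_prop]
      have hd : |(n:ℝ) * TT^k| < TT^i := by
        rw [abs_mul, aop (Grid.two_pos k)]
        calc |(n:ℝ)| * TT^k ≤ 2^L * TT^k := by gcongr
          _ = TT^((L:ℤ)+k) := by rw [zpow_add₀ NM, znq]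
          _ < _ := zpow_lt_zpow_right₀ NM OM
      set z := x + n * TT^k with hz
      have h2i := Grid.two_pos i
      rw [abs_lt] at hd
      have c1 : (grid α).idx i z ≤ (grid α).idx i x + 1 := by
        rw [← Grid.idx_add]; unfold Grid.idx; gcongr; linarith [hd.2]
      have c2 : (grid α).idx i x - 1 ≤ (grid α).idx i z := by
        rw [← Grid.idx_sub]; unfold Grid.idx; gcongr; linarith [hd.1]
      have mem : ∀ w, (grid α).idx i w = (grid α).idx i z → w ∈ O α i := fun w hw => Grid.topset_inv hw h3
      rcases (show (grid α).idx i z = (grid α).idx i x - 1 ∨ (grid α).idx i z = (grid α).idx i x ∨ (grid α).idx i z = (grid α).idx i x + 1 by omega) with h | h | h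
      · refine ⟨-1, by decide, mpq.2 (mem _ ?_)⟩
        rw [h, ← Grid.idx_sub]; congr 1; push_cast; ring
      · refine ⟨0, by decide, mpq.2 (mem _ ?_)⟩
        rw [h]; congr 1; push_cast; ring
      · refine ⟨1, by decide, mpq.2 (mem _ ?_)⟩
        rw [h, ← Grid.idx_add]; congr 1; push_cast; ring
  have hmeas : volume (⋃ k ∈ icq (-(N:ℤ)) N, {x | 8 * lam < BB n 0 k g x}) ≤ 
      ∑ α : Bool, ∑ i ∈ S, (L+3) * volume (O α i) := by
    refine (measure_mono hsub).trans ?_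
    refine (measure_biUnion_finset_le _ _).trans (sls fun α _ => ?_)
    refine (measure_biUnion_finset_le _ _).trans (sls fun i _ => ?_)
    refine (measure_union_le _ _).trans ?_
    rw [add_mul]
    gcongr
    · refine (measure_biUnion_finset_le _ _).trans ?_
      simp_rw [measure_preimage_add_right]
      simp
    · refine (measure_biUnion_finset_le _ _).trans ?_
      simp_rw [measure_preimage_add_right]
      simp
  calc _ ≤ lam * ∑ α : Bool, ∑ i ∈ S, (L+3) * volume (O α i) := by gcongr
    _ = (L+3) * ∑ α : Bool, ∑ i ∈ S, lam * ∫⁻ x in O α i, 1 := by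
        simp_rw [setLIntegral_one, msq]
        refine scq rfl fun _ _ => scq rfl fun _ _ => RG
    _ ≤ (L+3) * ∑ α : Bool, ∫⁻ x, g x := by
        gcongr with α _
        refine (Grid.topset_sum hg mcq (N+3) S (fun j hj => (miq.1 hj).2)).trans ?_
        exact setLIntegral_le_lintegral _ _
    _ = _ := by simp; ring
theorem MS_bound {r : ℝ} (hr : 1 < r) (hn : |(n:ℝ)| ≤ 2^L) (hg : Measurable g) :
    ∫⁻ x, MS n g x ^ r ≤ 8^r * (4^r * geoC (r-1)) * (2 * (L+3)) * ∫⁻ x, g x ^ r := by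
  have hm := measurable_MS n hg
  have key := marcinkiewicz volume hr (2 * (L+3)) (G := fun x => MS n g x / 8) (hm.div_const _) hg ?_
  · have : ∀ x, MS n g x ^ r = 8^r * (MS n g x / 8)^r := by
      intro x
      rw [← mro _ _ LI, mdcq NM NM]
    simp_rw [this]
    rw [lcmz _ ((hm.div_const _).pow_const r), maq, maq]
    refine mlm ?_ _
    refine key.trans (loe RG)
  · intro j
    set lam := Grid.len j with hlam
    set h1 : ℝ → EE := {x | lam < g x}.indicator g
    have hs : MeasurableSet {x | lam < g x} := measurableSet_lt mcq hg
    have hh1 : Measurable h1 := hg.indicator hs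
    have hle : ∀ x, MS n g x ≤ 2 * lam + MS n h1 x := by
      intro x
      refine iSup_le fun k => ?_
      calc BB n 0 k g x ≤ BB n 0 k (fun y => lam + h1 y) x := by
            refine BB_mono _ fun y => ?_
            by_cases hy : lam < g y
            · simp [h1, hy]
            · exact (not_lt.1 hy).trans le_self_add
        _ = 2 * lam + BB n 0 k h1 x := by rw [BB_add _ _ _ mcq, BB_const]
        _ ≤ _ := by gcongr; exact le_iSup (fun k => BB n 0 k h1 x) k
    have hsub : {x | 2 * lam < MS n g x / 8} ⊆ {x | 8 * lam < MS n h1 x} := by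
      intro x hx
      simp only [moe] at hx ⊢
      rw [ldi SI SI] at hx
      have := hx.trans_le (hle x)
      by_contra hc
      rw [not_lt] at hc
      have h3 : 2 * lam * 8 < 2 * lam + 8 * lam := this.trans_le (by gcongr)
      have h4 : 2 * lam + 8 * lam ≤ 2 * lam * 8 := by
        rw [← add_mul, mul_right_comm]; gcongr; norm_num
      exact absurd (h3.trans_le h4) (lt_irrefl _)
    calc _ ≤ lam * volume {x | 8 * lam < MS n h1 x} := by gcongr
      _ ≤ 2 * (L + 3) * ∫⁻ x, h1 x := MS_weak hn hh1 lam
      _ = _ := by rw [liq hs]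
end
section
variable {e θ : ℝ}

lemma mean_rpow_le (h0 : 0 < θ) (h1 : θ < 1) (he : 0 ≤ e) (he1 : e < 1) :
    ((1+e)^θ + (1-e)^θ)/2 ≤ 1 - θ*(1-θ)/4 * e^2 := by
  let f : ℝ → ℝ := fun e => ((1+e)^θ + (1-e)^θ)/2 + θ*(1-θ)/4 * e^2
  have hd : ∀ x ∈ Set.Ico (0:ℝ) 1, HasDerivAt f ((θ * (1+x)^(θ-1) - θ * (1-x)^(θ-1))/2 + θ*(1-θ)/4*(2*x)) x := by
    intro x hx
    have a1 : HasDerivAt (fun e : ℝ => (1+e)^θ) (θ * (1+x)^(θ-1)) x := by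
      exact (((hasDerivAt_id' x).const_add 1).rpow_const (p := θ) (Or.inl (by linarith [hx.1]))).congr_deriv RG
    have a2 : HasDerivAt (fun e : ℝ => (1-e)^θ) (-(θ * (1-x)^(θ-1))) x := by
      exact (((hasDerivAt_id' x).const_sub 1).rpow_const (p := θ) (Or.inl (by linarith [hx.2]))).congr_deriv RG
    have a3 : HasDerivAt (fun e : ℝ => θ*(1-θ)/4 * e^2) (θ*(1-θ)/4*(2*x)) x := by
      have := (hasDerivAt_pow 2 x).const_mul (θ*(1-θ)/4)
      simpa using this
    have := ((a1.add a2).div_const 2).add a3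
    refine HasDerivAt.congr_deriv this RG
  have hanti : AntitoneOn f (Set.Ico 0 1) := by
    apply antitoneOn_of_deriv_nonpos (convex_Ico 0 1)
    · exact fun x hx => (hd x hx).continuousAt.continuousWithinAt
    · intro x hx; exact (hd x (interior_subset hx)).differentiableAt.differentiableWithinAt
    · intro x hx
      have hx := interior_subset hx
      rw [(hd x hx).deriv]
      have b1 : (1+x)^(θ-1) ≤ 1 := Real.rpow_le_one_of_one_le_of_nonpos (by linarith [hx.1]) LI
      have b2 : 1 + (1-θ)*x ≤ (1-x)^(θ-1) := by
        have hpos : 0 < 1 - x := by linarith [hx.2]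
        have := rpow_one_add_le_one_add_mul_self (s := -x) (by linarith [hx.2]) (p := 1-θ) LI LI
        rw [show θ - 1 = -(1-θ) by ring, rnv hpos.le, le_inv_comm₀ (by nlinarith [hx.1]) (rpo hpos _)]
        rw [show (1:ℝ) - x = 1 + -x by ring]
        refine this.trans ?_
        have hq : 0 < 1 + (1-θ)*x := by nlinarith [hx.1]
        rw [← one_div, le_div_iff₀ hq]
        nlinarith [sq_nonneg ((1-θ)*x)]
      nlinarith [hx.1]
  have := hanti (Set.left_mem_Ico.2 one_pos) ⟨he, he1⟩ he
  simp only [f] at this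
  norm_num at this
  linarith
lemma quad_form {A B D : ℝ} (hA : 0 ≤ A) (hB : 0 ≤ B) (h : D^2 ≤ A*B) (p d : ℂ) :
    0 ≤ A * ‖p‖^2 + B * ‖d‖^2 + 2 * D * (p * CJ d).re := by
  have h1 : |(p * CJ d).re| ≤ ‖p‖ * ‖d‖ := by
    refine (Complex.abs_re_le_norm _).trans ?_
    rw [norm_mul, RCLike.norm_conj]
  have h2 : |D| * (‖p‖ * ‖d‖) * 2 ≤ A * ‖p‖^2 + B * ‖d‖^2 := by
    have h3 : |D| ≤ √A * √B := by
      rw [← Real.sqrt_mul hA]; exact Real.abs_le_sqrt h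
    have h4 : |D| * (‖p‖ * ‖d‖) ≤ (√A * √B) * (‖p‖ * ‖d‖) := by gcongr
    have h5 := sq_nonneg (√A * ‖p‖ - √B * ‖d‖)
    have h6 := Real.sq_sqrt hA
    have h7 := Real.sq_sqrt hB
    nlinarith
  have h3 : |D * (p * CJ d).re| ≤ |D| * (‖p‖ * ‖d‖) := by rw [abs_mul]; gcongr
  have := neg_abs_le (D * (p * CJ d).re)
  linarith
lemma haar_pointwise_aux (h0 : 0 < θ) (h1 : θ < 1) (he : 0 ≤ e) (he1 : e < 1) (p d : ℂ) :
    ‖p‖^2 + θ*(1-θ)/4 * ‖d‖^2 ≤ (‖p+d‖^2 * (1+e)^(-θ) + ‖p-d‖^2*(1-e)^(-θ))/2 := by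
  set c := θ*(1-θ)/4 with hc
  have hc0 : 0 ≤ c := by have : 0 < 1-θ := LI
                         positivity
  have hc1 : c ≤ 1 := by nlinarith
  have ha : 0 < 1 + e := LI
  have hb : 0 < 1 - e := LI
  have hmean := mean_rpow_le h0 h1 he he1
  rw [← hc] at hmean
  rw [rnv ha.le, rnv hb.le]
  have hs : (1 + e)^θ * (1-e)^θ = (1-e^2)^θ := by
    rw [← mrz ha.le hb.le]; congr 1; ring
  have hge : 1 - e^2 ≤ (1-e^2)^θ := by
    conv_lhs => rw [← Real.rpow_one (1-e^2)]
    exact Real.rpow_le_rpow_of_exponent_ge (by nlinarith) (by nlinarith [sq_nonneg e]) h1.le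
  have hle1 : (1-e^2)^θ ≤ 1 := Real.rpow_le_one (by nlinarith) (by nlinarith [sq_nonneg e]) h0.le
  set a := (1+e)^θ
  set b := (1-e)^θ
  have hap : 0 < a := rpo ha _
  have hbp : 0 < b := rpo hb _
  have hsum : 2 * (a*b) ≤ a + b := by
    have : a * b ≤ 1 := hs ▸ hle1
    nlinarith [sq_nonneg (a-b), mul_pos hap hbp, sq_nonneg (a+b-2)]
  have e1 : ‖p+d‖^2 = ‖p‖^2 + ‖d‖^2 + 2 * (p * CJ d).re := by
    rw [← nen, ← nen, ← nen, Complex.normSq_add]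
  have e2 : ‖p-d‖^2 = ‖p‖^2 + ‖d‖^2 - 2 * (p * CJ d).re := by
    rw [← nen, ← nen, ← nen, Complex.normSq_sub]
  have hsum' : 1 ≤ (a⁻¹ + b⁻¹)/2 := by
    have : (a⁻¹ + b⁻¹)/2 = (a + b)/(2*(a*b)) := by field_simp; ring
    rw [this, le_div_iff₀ PZ]; linarith
  have key : ((a⁻¹ - b⁻¹)/2)^2 ≤ ((a⁻¹+b⁻¹)/2 - 1) * ((a⁻¹+b⁻¹)/2 - c) := by
    have e3 : ((a⁻¹+b⁻¹)/2 - 1) * ((a⁻¹+b⁻¹)/2 - c) - ((a⁻¹ - b⁻¹)/2)^2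
        = (1 + c*(a*b) - (1+c)*((a+b)/2)) / (a*b) := by field_simp; ring
    have : 0 ≤ (1 + c*(a*b) - (1+c)*((a+b)/2)) / (a*b) := by
      apply div_nonneg _ PZ
      rw [hs]; nlinarith [mul_nonneg hc0 hc0, sq_nonneg e, mul_nonneg (mul_nonneg hc0 hc0) (sq_nonneg e)]
    linarith
  have := quad_form (A := (a⁻¹+b⁻¹)/2 - 1) (B := (a⁻¹+b⁻¹)/2 - c) (D := (a⁻¹ - b⁻¹)/2) LI LI key p d
  rw [e1, e2]
  nlinarith
lemma haar_pointwise (h0 : 0 < θ) (h1 : θ < 1) {a b : ℝ} (ha : 0 < a) (hb : 0 < b) (u v : ℂ) :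
    (‖(1/2:ℂ) * (u+v)‖^2 + θ*(1-θ)/4 * ‖(1/2:ℂ)*(u-v)‖^2) * ((a+b)/2)^(-θ) ≤ (‖u‖^2 * a^(-θ) + ‖v‖^2*b^(-θ))/2 := by
  wlog hab : b ≤ a generalizing a b u v
  · have := this hb ha v u LI
    rw [add_comm v u, add_comm b a, ← neg_sub u v, mul_neg, norm_neg] at this
    linarith
  set s := (a+b)/2 with hs
  have hsp : 0 < s := PZ
  set e := (a-b)/(a+b) with he
  have e1 : a = s*(1+e) := by rw [hs, he]; field_simp; ring
  have e2 : b = s*(1-e) := by rw [hs, he]; field_simp; ring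
  have he0 : 0 ≤ e := div_nonneg LI LI
  have he1 : e < 1 := by rw [he, div_lt_one LI]; linarith
  have := haar_pointwise_aux h0 h1 he0 he1 ((1/2:ℂ) * (u+v)) ((1/2:ℂ)*(u-v))
  rw [show (1/2:ℂ) * (u+v) + (1/2:ℂ)*(u-v) = u by ring, show (1/2:ℂ) * (u+v) - (1/2:ℂ)*(u-v) = v by ring] at this
  rw [e1, e2, mrz hsp.le LI, mrz hsp.le LI]
  calc _ ≤ (‖u‖^2 * (1+e)^(-θ) + ‖v‖^2*(1-e)^(-θ))/2 * s^(-θ) := by gcongr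
    _ = _ := RG
end
section
variable {a c : EE} {x θ : ℝ} {Z g v σ : ℝ → EE} {k n u : ℤ}

lemma cs_lint {α : Type*} [MeasurableSpace α] (μ : Measure α) {g v σ : α → EE} (hg : Measurable g)
    (hv : Measurable v) (hσ : Measurable σ) (h : ∀ x, v x * σ x = 1) :
    (∫⁻ x, g x ∂μ)^2 ≤ (∫⁻ x, g x^2 * v x ∂μ) * ∫⁻ x, σ x ∂μ := by
  have h1 := lmn (μ := μ) (f := fun x => g x^2 * v x) (g := σ) ((hg.pow_const 2).mul hv).aemeasurable
    hσ.aemeasurable (p := 1/2) (q := 1/2) NM NM NM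
  have e : ∀ x, (g x^2 * v x)^HH * (σ x)^HH = g x := by
    intro x
    rw [← mro _ _ NM, maq, h, mul_one, ← rnz, ← rmq]
    norm_num
  simp_rw [e] at h1
  calc _ ≤ ((∫⁻ x, g x^2 * v x ∂μ)^HH * (∫⁻ x, σ x ∂μ)^HH)^2 := by gcongr
    _ = _ := by
      rw [mul_pow, ← rnz, ← rnz, ← rmq, ← rmq]; norm_num
lemma jensen_lint {α : Type*} [MeasurableSpace α] (μ : Measure α) {Z : α → EE} (hZ : Measurable Z) (h0 : 0 < θ) (h1 : θ < 1) :
    ∫⁻ x, Z x^θ ∂μ ≤ (∫⁻ x, Z x ∂μ)^θ * (μ Set.univ)^(1-θ) := by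
  have h1 := lmn (μ := μ) (f := Z) (g := fun _ => 1) hZ.aemeasurable
    aemeasurable_const (p := θ) (q := 1-θ) h0.le LI RG
  simpa using h1
lemma div_mul_div_sq {b : EE} (h : c ≠ 0) (h' : c ≠ ⊤) : (a/c) * (b/c) = (a*b)/c^2 := by
  rw [dem, dem, dem, pow_two, miw (Or.inl h) (Or.inl h')]; ring
lemma rpow_div_mul (h0 : 0 < θ) (h : c ≠ 0) (h' : c ≠ ⊤) : (a^θ * c^(1-θ))/c = (a/c)^θ := by
  rw [ENNReal.div_rpow_of_nonneg _ _ h0.le, mul_div_assoc, dem, dem]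
  congr 1
  rw [← rnw, ← ENNReal.rpow_neg_one, ← raq _ _ h h']; congr 1; ring
lemma BB_cs (n u k : ℤ) (hg : Measurable g)
    (hv : Measurable v) (hσ : Measurable σ) (h : ∀ x, v x * σ x = 1) (x : ℝ) :
    BB n u k g x ^2 ≤ BB n u k (fun y => g y^2 * v y) x * BB n u k σ x := by
  unfold BB
  rw [pow_two, div_mul_div_sq (Grid.len_ne_zero _) (Grid.len_ne_top _), div_mul_div_sq (Grid.len_ne_zero _) (Grid.len_ne_top _), ← pow_two]
  exact dld (cs_lint _ hg hv hσ h) _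
namespace Grid
variable (G : Grid)
lemma av_cs (k : ℤ) (hg : Measurable g)
    (hv : Measurable v) (hσ : Measurable σ) (h : ∀ x, v x * σ x = 1) (x : ℝ) :
    G.av k g x ^2 ≤ G.av k (fun y => g y^2 * v y) x * G.av k σ x := by
  unfold av
  rw [pow_two, div_mul_div_sq (Grid.len_ne_zero _) (Grid.len_ne_top _), div_mul_div_sq (Grid.len_ne_zero _) (Grid.len_ne_top _), ← pow_two]
  exact dld (cs_lint _ hg hv hσ h) _
lemma av_jensen (k : ℤ) (hZ : Measurable Z) (h0 : 0 < θ) (h1 : θ < 1) (x : ℝ) :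
    G.av k (fun y => Z y^θ) x ≤ G.av k Z x^θ := by
  unfold av
  rw [← rpow_div_mul h0 (len_ne_zero k) (len_ne_top k)]
  refine dld ((jensen_lint _ hZ h0 h1).trans ?_) _
  rw [rau, volume_cell]; rfl
lemma av_le_BB (k : ℤ) (g : ℝ → EE) (x : ℝ) : G.av k g x ≤ BB 0 0 k g x := by
  unfold av BB
  rw [add_zero]
  refine dld (lintegral_mono_set fun y hy => ?_) _
  rw [mem_sball]
  have := G.dist_of_idx hy
  simpa using this
lemma av_pos (k : ℤ) (hg : Measurable g) (h : ∀ x, g x ≠ 0) (x : ℝ) : G.av k g x ≠ 0 := by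
  unfold av
  rw [ENNReal.div_ne_zero]
  refine ⟨?_, len_ne_top k⟩
  rw [← pos_iff_ne_zero, setLIntegral_pos_iff hg]
  rw [show Function.support g = Set.univ from Set.eq_univ_of_forall h, Set.univ_inter, volume_cell]
  exact pos_iff_ne_zero.2 (len_ne_zero k)
end Grid
lemma BB_jensen (n u k : ℤ) (hZ : Measurable Z) (h0 : 0 < θ) (h1 : θ < 1) (x : ℝ) :
    BB n u k (fun y => Z y^θ) x ≤ 2 * BB n u k Z x^θ := by
  unfold BB
  rw [← rpow_div_mul h0 (Grid.len_ne_zero _) (Grid.len_ne_top _), ← mul_div_assoc]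
  refine dld ((jensen_lint _ hZ h0 h1).trans ?_) _
  rw [rau, volume_sball, mro _ _ LI]
  calc _ = 2^(1-θ) * ((∫⁻ x in sball n u k x, Z x)^θ * (Grid.len (k+u))^(1-θ)) := RG
    _ ≤ 2 * _ := by
      refine mlmq ?_ _
      conv_rhs => rw [← roq 2]
      exact rlrq NM LI
lemma sball_symm {y : ℝ} : y ∈ sball n u k x ↔ x ∈ sball (-n) u k y := by
  rw [mem_sball, mem_sball, ← abs_neg]; push_cast
  rw [show -(y - x - n * TT^k) = x - y - -(n:ℝ) * TT^k by ring]
lemma BB_eq (n u k : ℤ) (g : ℝ → EE) (x : ℝ) :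
    BB n u k g x = (∫⁻ y, {p : RR | p.1 ∈ sball n u k p.2}.indicator 1 (y, x) * g y) / Grid.len (k+u) := by
  unfold BB
  rw [← liq (measurableSet_sball n u k x)]
  congr 2; ext y
  by_cases h : y ∈ sball n u k x
  · rw [iom h, iom (by exact h)]; simp
  · rw [ion h, ion (by exact h)]; simp
lemma BB_adjoint (n u k : ℤ) {h : ℝ → EE} (hg : Measurable g) (hh : Measurable h) :
    ∫⁻ x, BB n u k g x * h x = ∫⁻ x, g x * BB (-n) u k h x := by
  have hm : Measurable ({p : RR | p.1 ∈ sball n u k p.2}.indicator (1 : RR → EE)) :=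
    measurable_one.indicator (measurableSet_sball_rel n u k)
  have e1 : ∀ x, BB n u k g x * h x = ∫⁻ y, ({p : RR | p.1 ∈ sball n u k p.2}.indicator 1 (y, x) * g y * h x) / Grid.len (k+u) := by
    intro x
    simp_rw [dem]
    have h1 : Measurable (fun y => ({p : RR | p.1 ∈ sball n u k p.2}.indicator 1 (y, x) : EE) * g y) :=
      (hm.comp (measurable_id.prodMk mcq)).mul hg
    rw [lintegral_mul_const _ (h1.mul_const _), lintegral_mul_const _ h1, BB_eq, dem]; ring
  have e2 : ∀ y, g y * BB (-n) u k h y = ∫⁻ x, ({p : RR | p.1 ∈ sball n u k p.2}.indicator 1 (y, x) * g y * h x) / Grid.len (k+u) := by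
    intro y
    simp_rw [dem]
    have h1 : Measurable (fun x => ({p : RR | p.1 ∈ sball n u k p.2}.indicator 1 (y, x) : EE) * h x) :=
      (hm.comp (measurable_const.prodMk miv)).mul hh
    have : ∀ x, ({p : RR | p.1 ∈ sball n u k p.2}.indicator 1 (y, x) * g y * h x) * (Grid.len (k+u))⁻¹ =
      g y * (({p : RR | p.1 ∈ sball n u k p.2}.indicator 1 (y, x) * h x) * (Grid.len (k+u))⁻¹) := by intro x; ring
    simp_rw [this]
    rw [lcmz _ (h1.mul_const _), lintegral_mul_const _ h1, BB_eq, dem]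
    congr 3; ext x
    congr 1
    by_cases hx : y ∈ sball n u k x
    · rw [iom (by exact sball_symm.1 hx), iom (by exact hx)]; rfl
    · rw [ion (by exact fun h => hx (sball_symm.2 h)), ion (by exact hx)]
  simp_rw [e1, e2]
  rw [lintegral_lintegral_swap]
  apply Measurable.aemeasurable
  simp only [Function.uncurry_def]
  exact (((hm.comp measurable_swap).mul (hg.comp msz)).mul (hh.comp mfq)).div_const _
lemma BB_mono_set {n' u' k' : ℤ} (g : ℝ → EE) {x' : ℝ} (h : sball n u k x ⊆ sball n' u' k' x') (N : ℕ)
    (hk : k' + u' = k + u + N) : BB n u k g x ≤ 2^N * BB n' u' k' g x' := by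
  unfold BB
  rw [hk, Grid.len_add (k+u) N, Grid.len_nat]
  calc _ ≤ (∫⁻ y in sball n' u' k' x', g y) / Grid.len (k+u) := dld (lintegral_mono_set h) _
    _ = _ := by
      rw [← mul_div_assoc, mcz (Grid.len (k+u)), ENNReal.mul_div_mul_left _ _ SI SI]
lemma BB_conv (n k : ℤ) (u : ℕ) (hg : Measurable g) (x : ℝ) :
    BB n u k g x ≤ BB 0 0 (k+u+1) (BB n 0 k g) x := by
  have hs := measurableSet_sball 0 0 (k+u+1) x
  have e : ∫⁻ y in sball 0 0 (k+u+1) x, BB n 0 k g y = ∫⁻ y, g y * BB (-n) 0 k ((sball 0 0 (k+u+1) x).indicator 1) y := by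
    rw [← BB_adjoint n 0 k hg (measurable_one.indicator hs), ← liq hs]
    congr 1; ext y; by_cases h : y ∈ sball 0 0 (k+u+1) x <;> simp [h]
  unfold BB at e ⊢
  rw [e, add_zero (k+u+1), Grid.len_succ]
  rw [← liq (measurableSet_sball n u k x)]
  rw [← ENNReal.mul_div_mul_left _ _ (c := 2) NM NM, ← lcmz _ (hg.indicator (measurableSet_sball _ _ _ _))]
  refine dld (lmq fun z => ?_) _
  by_cases hz : z ∈ sball n u k x
  · rw [iom hz, mcz]
    refine mlm ?_ _
    have : ∀ y ∈ sball (-n) 0 k z, (sball 0 0 (k+u+1) x).indicator (1 : ℝ → EE) y = 1 := by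
      intro y hy
      refine iom ?_ _
      rw [mem_sball] at *
      push_cast at *
      have e1 : TT^(k+u+1+0) = 2 * TT^(k+u) := by rw [add_zero, Grid.two_succ]
      have e2 : TT^k ≤ TT^(k+u) := zpow_le_zpow_right₀ NM OM
      rw [add_zero] at hy
      rw [e1]
      rw [abs_le] at *; constructor <;> linarith
    rw [setLIntegral_congr_fun (measurableSet_sball _ _ _ _) this, scz, volume_sball, one_mul, mdc (Grid.len_ne_zero _) (Grid.len_ne_top _)]
  · rw [ion hz]; simp
end
section
variable {g : ℝ → EE}

structure GW (θ : ℝ) (C Λ : EE) (n : ℤ) (v Z : ℝ → EE) : Prop where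
  t0 : 0 < θ
  t1 : θ < 1
  mZ : Measurable Z
  pos : ∀ x, Z x ≠ 0
  fin : ∀ x, Z x ≠ ⊤
  hv : ∀ x, v x = Z x ^ (-θ)
  hC : C ≠ ⊤
  h0 : ∀ k x, BB 0 0 k v x * BB 0 0 k Z x ^ θ ≤ C
  hn : ∀ k x, BB (-n) 0 k v x * BB 0 0 (k+1) Z x ^ θ ≤ C * Λ
namespace GW
variable {θ : ℝ} {C Λ : EE} {n : ℤ} {v Z : ℝ → EE} (H : GW θ C Λ n v Z)
include H
lemma mv : Measurable v := by rw [show v = fun x => Z x ^ (-θ) from funext H.hv]; exact H.mZ.pow_const _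
lemma ms : Measurable (fun x => Z x ^ θ) := H.mZ.pow_const _
lemma vs (x : ℝ) : v x * Z x ^ θ = 1 := by
  rw [H.hv, ← raq _ _ (H.pos x) (H.fin x)]; simp
lemma vpos (x : ℝ) : v x ≠ 0 := by intro h; have := H.vs x; simp [h] at this
lemma spos (x : ℝ) : Z x ^ θ ≠ 0 := by intro h; have := H.vs x; simp [h] at this
lemma BBv_pos (k : ℤ) (x : ℝ) : BB 0 0 k v x ≠ 0 := fun h =>
  (grid false).av_pos k H.mv H.vpos x (nonpos_iff_eq_zero.1 (h ▸ (grid false).av_le_BB k v x))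
lemma BBZ_pos (k : ℤ) (x : ℝ) : BB 0 0 k Z x ≠ 0 := fun h =>
  (grid false).av_pos k H.mZ H.pos x (nonpos_iff_eq_zero.1 (h ▸ (grid false).av_le_BB k Z x))
lemma BBZ_fin (k : ℤ) (x : ℝ) : BB 0 0 k Z x ≠ ⊤ := by
  intro h
  have := H.h0 k x
  rw [h, tro H.t0, mtq (H.BBv_pos k x)] at this
  exact H.hC (top_le_iff.1 this)
lemma BBv_fin (k : ℤ) (x : ℝ) : BB 0 0 k v x ≠ ⊤ := by
  intro h
  have := H.h0 k x
  rw [h, ENNReal.top_mul] at this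
  · exact H.hC (top_le_iff.1 this)
  · rw [Ne, rez H.t0]; exact H.BBZ_pos k x
lemma h0' (k : ℤ) (x : ℝ) : BB 0 0 k v x * BB 0 0 k (fun y => Z y^θ) x ≤ 2 * C :=
  calc _ ≤ BB 0 0 k v x * (2 * BB 0 0 k Z x^θ) := mlm (BB_jensen 0 0 k H.mZ H.t0 H.t1 x) _
    _ = 2 * (BB 0 0 k v x * BB 0 0 k Z x^θ) := RG
    _ ≤ _ := mlm (H.h0 k x) _
lemma hn' (k : ℤ) (x : ℝ) : BB (-n) 0 k v x * BB 0 0 (k+1) (fun y => Z y^θ) x ≤ 2 * (C * Λ) :=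
  calc _ ≤ BB (-n) 0 k v x * (2 * BB 0 0 (k+1) Z x^θ) := mlm (BB_jensen 0 0 _ H.mZ H.t0 H.t1 x) _
    _ = 2 * (BB (-n) 0 k v x * BB 0 0 (k+1) Z x^θ) := RG
    _ ≤ _ := mlm (H.hn k x) _
lemma Faux (m k : ℤ) (A : EE) (hA : ∀ y, BB (-m) 0 k v y * BB 0 0 (k+1) (fun y => Z y^θ) y ≤ A)
    (hg : Measurable g) : ∫⁻ x, BB m 0 k g x^2 * v x ≤ 2 * A * ∫⁻ x, g x^2 * v x := by
  have hgv : Measurable (fun y => g y^2 * v y) := (hg.pow_const 2).mul H.mv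
  have hb := measurable_BB m 0 k H.ms
  calc ∫⁻ x, BB m 0 k g x^2 * v x ≤ ∫⁻ x, BB m 0 k (fun y => g y^2 * v y) x * (BB m 0 k (fun y => Z y^θ) x * v x) := by
        refine lmq fun x => ?_
        simp only
        rw [← maq]
        exact mlmq (BB_cs m 0 k hg H.mv H.ms H.vs x) _
    _ = ∫⁻ y, (g y^2 * v y) * BB (-m) 0 k (fun x => BB m 0 k (fun y => Z y^θ) x * v x) y := BB_adjoint m 0 k hgv (hb.mul H.mv)
    _ ≤ ∫⁻ y, (g y^2 * v y) * (2 * A) := by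
        refine lmq fun y => mlm ?_ _
        have : BB (-m) 0 k (fun x => BB m 0 k (fun y => Z y^θ) x * v x) y ≤ 2 * BB 0 0 (k+1) (fun y => Z y^θ) y * BB (-m) 0 k v y := by
          unfold BB
          rw [← mul_div_assoc, ← lcmz _ H.mv]
          refine dld (setLIntegral_mono (H.mv.const_mul _) fun x hx => mlmq ?_ _) _
          refine (BB_mono_set _ (n' := 0) (u' := 0) (k' := k+1) (x' := y) (fun z hz => ?_) 1 (by push_cast; ring)).trans (by rw [pow_one]; rfl)
          rw [mem_sball] at *
          rw [add_zero, Grid.two_succ]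
          push_cast at *
          rw [add_zero] at hx hz
          rw [abs_le] at *; constructor <;> linarith
        refine this.trans ?_
        rw [maq, mcz (BB 0 0 (k+1) _ y)]
        exact mlm (hA y) _
    _ = _ := by rw [lintegral_mul_const _ hgv, mcz]
lemma F2 (k : ℤ) (hg : Measurable g) : ∫⁻ x, BB n 0 k g x^2 * v x ≤ 4 * (C * Λ) * ∫⁻ x, g x^2 * v x :=
  (H.Faux n k _ (H.hn' k) hg).trans_eq RG
lemma F1 (k : ℤ) (hg : Measurable g) : ∫⁻ x, BB 0 0 k g x^2 * v x ≤ 8 * C * ∫⁻ x, g x^2 * v x := by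
  refine (H.Faux 0 k (4 * C) (fun y => ?_) hg).trans_eq RG
  calc _ ≤ (2 * BB 0 0 (k+1) v y) * BB 0 0 (k+1) (fun y => Z y^θ) y := by
        refine mlmq ?_ _
        refine (BB_mono_set v (n' := 0) (u' := 0) (k' := k+1) (x' := y) (fun z hz => ?_) 1 (by push_cast; ring)).trans (by rw [pow_one])
        rw [mem_sball] at *
        rw [add_zero, Grid.two_succ]; rw [add_zero] at hz
        have := Grid.two_pos k
        push_cast at *
        rw [abs_le] at *; constructor <;> linarith
    _ = 2 * (BB 0 0 (k+1) v y * BB 0 0 (k+1) (fun y => Z y^θ) y) := RG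
    _ ≤ 2 * (2 * C) := mlm (H.h0' _ _) _
    _ = _ := RG
lemma F2u (k : ℤ) (u : ℕ) (hg : Measurable g) :
    ∫⁻ x, BB n u k g x^2 * v x ≤ 32 * C^2 * Λ * ∫⁻ x, g x^2 * v x :=
  calc _ ≤ ∫⁻ x, BB 0 0 (k+u+1) (BB n 0 k g) x^2 * v x := by
        refine lmq fun x => mlmq ?_ _
        have := BB_conv n k u hg x
        gcongr
    _ ≤ 8 * C * ∫⁻ x, BB n 0 k g x^2 * v x := H.F1 _ (measurable_BB n 0 k hg)
    _ ≤ 8 * C * (4 * (C * Λ) * ∫⁻ x, g x^2 * v x) := mlm (H.F2 k hg) _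
    _ = _ := RG
variable (G : Grid)
lemma av0 (k : ℤ) (x : ℝ) : G.av k v x * G.av k Z x^θ ≤ C :=
  (mlmz (G.av_le_BB k v x) (rlr (G.av_le_BB k Z x) H.t0.le)).trans (H.h0 k x)
lemma av0' (k : ℤ) (x : ℝ) : G.av k v x * G.av k (fun y => Z y^θ) x ≤ C :=
  (mlm (G.av_jensen k H.mZ H.t0 H.t1 x) _).trans (H.av0 G k x)
lemma avZ_fin (k : ℤ) (x : ℝ) : G.av k Z x ≠ ⊤ := nto (H.BBZ_fin k x) (G.av_le_BB k Z x)
lemma avv_fin (k : ℤ) (x : ℝ) : G.av k v x ≠ ⊤ := nto (H.BBv_fin k x) (G.av_le_BB k v x)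
lemma avs_fin (k : ℤ) (x : ℝ) : G.av k (fun y => Z y^θ) x ≠ ⊤ :=
  nto (rnt H.t0.le (H.avZ_fin G k x)) (G.av_jensen k H.mZ H.t0 H.t1 x)
lemma F3 (hg : Measurable g) :
    ∫⁻ x, (⨆ j, G.av j g x)^2 * v x ≤ C^2 * (4^TT * geoC (2-1))^2 * ∫⁻ x, g x^2 * v x := by
  have hgv : Measurable (fun y => g y * v y) := hg.mul H.mv
  have hM1 := G.measurable_MV H.ms hgv
  have hM1s : Measurable (fun y => G.MV (fun y => Z y^θ) (fun y => g y * v y) y * Z y^θ) := hM1.mul H.ms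
  have key : ∀ x, (⨆ j, G.av j g x) ≤ C * G.MV v (fun y => G.MV (fun y => Z y^θ) (fun y => g y * v y) y * Z y^θ) x := by
    intro x
    refine iSup_le fun j => ?_
    set a := G.av j g x / G.av j (fun y => Z y^θ) x with ha
    have hs0 := G.av_pos j H.ms H.spos x
    have hst := H.avs_fin G j x
    have hv0 := G.av_pos j H.mv H.vpos x
    have hvt := H.avv_fin G j x
    have e : ∀ y, g y * v y * Z y^θ = g y := fun y => by rw [maq, H.vs, mul_one]
    have h1 : ∀ y, G.idx j y = G.idx j x → a ≤ G.MV (fun y => Z y^θ) (fun y => g y * v y) y := by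
      intro y hy
      unfold Grid.MV
      refine ltz ?_ (le_iSup _ j)
      simp_rw [e]
      rw [G.av_congr g hy, G.av_congr _ hy]
    have h2 : a ≤ G.av j (fun y => G.MV (fun y => Z y^θ) (fun y => g y * v y) y * Z y^θ * v y) x := by
      refine Grid.le_av_of G (hM1s.mul H.mv) fun y hy => ?_
      rw [maq, mcz _ (v y), H.vs, mul_one]; exact h1 y hy
    calc G.av j g x = a * G.av j (fun y => Z y^θ) x := by rw [ha, ENNReal.div_mul_cancel hs0 hst]
      _ = (G.av j v x * G.av j (fun y => Z y^θ) x) * (a / G.av j v x) := by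
          rw [mcz (G.av j v x), maq, mdcq hv0 hvt, mcz]
      _ ≤ C * _ := by
          refine mlmz (H.av0' G j x) ?_
          refine (dld h2 _).trans ?_
          unfold Grid.MV
          exact le_iSup (fun i => G.av i (fun y => (⨆ j, G.av j (fun y => g y * v y * Z y^θ) y / G.av j (fun y => Z y^θ) y) * Z y^θ * v y) x / G.av i v x) j
  calc _ ≤ ∫⁻ x, C^2 * (G.MV v (fun y => G.MV (fun y => Z y^θ) (fun y => g y * v y) y * Z y^θ) x^TT * v x) := by
        refine lmq fun x => ?_
        simp only
        rw [← maq]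
        refine mlmq ?_ _
        rw [rtq, ← mul_pow]
        exact plpq (key x) 2
    _ = C^2 * ∫⁻ x, (G.MV v (fun y => G.MV (fun y => Z y^θ) (fun y => g y * v y) y * Z y^θ) x^TT * v x) :=
        lcmz _ (((G.measurable_MV H.mv hM1s).pow_const _).mul H.mv)
    _ ≤ C^2 * ((4^TT * geoC (2-1)) * ∫⁻ x, (G.MV (fun y => Z y^θ) (fun y => g y * v y) x * Z x^θ)^TT * v x) :=
        mlm (G.MV_bound NM H.mv hM1s (fun j x => G.av_pos j H.mv H.vpos x) (H.avv_fin G)) _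
    _ = C^2 * ((4^TT * geoC (2-1)) * ∫⁻ x, (G.MV (fun y => Z y^θ) (fun y => g y * v y) x)^TT * Z x^θ) := by
        congr 3; ext x
        rw [rtq, rtq, mul_pow, maq, pow_two (Z x^θ), maq, mcz (Z x^θ) (v x), H.vs, mul_one]
    _ ≤ C^2 * ((4^TT * geoC (2-1)) * ((4^TT * geoC (2-1)) * ∫⁻ x, (g x * v x)^TT * Z x^θ)) :=
        mlm (mlm (G.MV_bound NM H.ms hgv (fun j x => G.av_pos j H.ms H.spos x) (H.avs_fin G)) _) _
    _ = _ := by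
        have : ∀ x, (g x * v x)^TT * Z x^θ = g x^2 * v x := by
          intro x
          rw [rtq, mul_pow, maq, pow_two (v x), maq, H.vs, mul_one]
        simp_rw [this]; ring
end GW
end
section
variable {f : ℝ → ℂ}

lemma haar_enn {θ : ℝ} (h0 : 0 < θ) (h1 : θ < 1) {a b : EE} (ha : a ≠ 0) (hb : b ≠ 0) (ha' : a ≠ ⊤) (hb' : b ≠ ⊤) (u v : ℂ) :
    (‖(1/2:ℂ) * (u+v)‖ₑ^2 + ofq (θ*(1-θ)/4) * ‖(1/2:ℂ)*(u-v)‖ₑ^2) * ((a+b)/2)^(-θ) ≤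
      (‖u‖ₑ^2 * a^(-θ) + ‖v‖ₑ^2*b^(-θ))/2 := by
  have pa := ENNReal.toReal_pos ha ha'
  have pb := ENNReal.toReal_pos hb hb'
  have h := olo (haar_pointwise h0 h1 pa pb u v)
  have hc : 0 ≤ θ*(1-θ)/4 := by have : 0 < 1-θ := LI
                                positivity
  generalize θ*(1-θ)/4 = c at *
  rw [omq PZ, oaq PZ PZ, omq hc,
    odo (x := _ + _) NM, oaq PZ PZ, omq PZ, omq PZ,
    opq (nnq _), opq (nnq _), opq (nnq _), opq (nnq _),
    onq, onq, onq, onq,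
    ← oro PZ, ← oro pa, ← oro pb,
    odo NM, oaq pa.le pb.le, ENNReal.ofReal_toReal ha', ENNReal.ofReal_toReal hb'] at h
  simpa using h
namespace GW
variable {θ : ℝ} {C Λ : EE} {n : ℤ} {v Z : ℝ → EE} (H : GW θ C Λ n v Z) (G : Grid)
include H
lemma haar_step (k : ℤ) (hf : LocallyIntegrable f) (hm : Measurable f) :
    (∫⁻ x, ‖G.E (k+1) f x‖ₑ^2 * G.av (k+1) Z x^(-θ)) + ofq (θ*(1-θ)/4) * ∫⁻ x, ‖G.D k f x‖ₑ^2 * G.av (k+1) Z x^(-θ)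
      ≤ ∫⁻ x, ‖G.E k f x‖ₑ^2 * G.av k Z x^(-θ) := by
  have mE : ∀ k, Measurable fun x => ‖G.E k f x‖ₑ^2 := fun k => (G.measurable_E k hm).enorm.pow_const 2
  have mD : Measurable fun x => ‖G.D k f x‖ₑ^2 := ((G.measurable_E k hm).sub (G.measurable_E (k+1) hm)).enorm.pow_const 2
  have mA : ∀ k, Measurable fun x => G.av k Z x^(-θ) := fun k => (G.measurable_av k H.mZ).pow_const _
  have mQ : Measurable fun x => ‖G.E k f x‖ₑ^2 * G.av k Z x^(-θ) := (mE k).mul (mA k)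
  have mQ1 : Measurable fun x => ‖G.E (k+1) f x‖ₑ^2 * G.av (k+1) Z x^(-θ) := (mE _).mul (mA _)
  have mQD : Measurable fun x => ‖G.D k f x‖ₑ^2 * G.av (k+1) Z x^(-θ) := mD.mul (mA _)
  rw [← lcmz _ mQD, ← lal mQ1]
  calc _ ≤ ∫⁻ x, (‖G.E k f x‖ₑ^2 * G.av k Z x^(-θ) + ‖G.E k f (G.sib k x)‖ₑ^2 * G.av k Z (G.sib k x)^(-θ))/2 := by
        refine lmq fun x => ?_
        have := haar_enn H.t0 H.t1 (G.av_pos k H.mZ H.pos x) (G.av_pos k H.mZ H.pos (G.sib k x)) (H.avZ_fin G k x) (H.avZ_fin G k _) (G.E k f x) (G.E k f (G.sib k x))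
        rw [← G.av_succ, ← G.E_succ k hf, ← G.D_eq k hf, add_mul, maq] at this
        exact this
    _ = _ := by
        simp_rw [dem]
        rw [lintegral_mul_const' _ _ NM, lal mQ,
          G.lintegral_sib k mQ, ← two_mul, mcz, ← maq, imc NM NM, one_mul]
lemma haar_top (k : ℤ) (hm : Measurable f) :
    ∫⁻ x, ‖G.E k f x‖ₑ^2 * G.av k Z x^(-θ) ≤ ∫⁻ x, ‖f x‖ₑ^2 * v x := by
  have hfv : Measurable (fun x => ‖f x‖ₑ^2 * v x) := (hm.enorm.pow_const 2).mul H.mv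
  calc _ ≤ ∫⁻ x, G.av k (fun x => ‖f x‖ₑ^2 * v x) x := by
        refine lmq fun x => ?_
        calc _ ≤ (G.av k (fun x => ‖f x‖ₑ) x)^2 * G.av k Z x^(-θ) := mlmq (plpq (G.enorm_E_le k f x) 2) _
          _ ≤ (G.av k (fun x => ‖f x‖ₑ^2 * v x) x * G.av k Z x^θ) * G.av k Z x^(-θ) := by
            refine mlmq ((G.av_cs k hm.enorm H.mv H.ms H.vs x).trans ?_) _
            exact mlm (G.av_jensen k H.mZ H.t0 H.t1 x) _
          _ = _ := by
            rw [maq, ← raq _ _ (G.av_pos k H.mZ H.pos x) (H.avZ_fin G k x)]; simp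
    _ = _ := G.lintegral_av k hfv
lemma F4 (hf : LocallyIntegrable f) (hm : Measurable f) :
    ∑' j : ℤ, ∫⁻ x, ‖G.D j f x‖ₑ^2 * v x ≤ C * (ofq (θ*(1-θ)/4))⁻¹ * ∫⁻ x, ‖f x‖ₑ^2 * v x := by
  have mD : ∀ k, Measurable fun x => ‖G.D k f x‖ₑ^2 := fun k => ((G.measurable_E k hm).sub (G.measurable_E (k+1) hm)).enorm.pow_const 2
  have mA : ∀ k, Measurable fun x => G.av k Z x^(-θ) := fun k => (G.measurable_av k H.mZ).pow_const _
  set c := ofq (θ*(1-θ)/4) with hc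
  have hc0 : c ≠ 0 := by
    have := H.t0; have h1 : 0 < 1 - θ := by linarith [H.t1]
    rw [hc, Ne, ENNReal.ofReal_eq_zero, not_le]; positivity
  set q : ℤ → EE := fun j => ∫⁻ x, ‖G.D j f x‖ₑ^2 * G.av (j+1) Z x^(-θ) with hq
  have h1 : ∀ j, ∫⁻ x, ‖G.D j f x‖ₑ^2 * v x ≤ C * q j := by
    intro j
    calc _ = ∫⁻ x, ‖G.D j f x‖ₑ^2 * G.av (j+1) v x := by
          have h2 := G.lintegral_av (j+1) (g := fun x => ‖G.D j f x‖ₑ^2 * v x) ((mD j).mul H.mv)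
          rw [← h2]
          refine lintegral_congr fun x => ?_
          have := G.av_mul_congr (j+1) H.mv x (h := fun x => ‖G.D j f x‖ₑ^2) (fun y hy => by rw [G.normD_congr hf hy])
          simpa using this
      _ ≤ ∫⁻ x, C * (‖G.D j f x‖ₑ^2 * G.av (j+1) Z x^(-θ)) := by
          refine lmq fun x => ?_
          have h3 := H.av0 G (j+1) x
          have : G.av (j+1) v x ≤ C * G.av (j+1) Z x^(-θ) := by
            rw [rnw, ← dem, ldiq]
            · exact h3
            · left; rw [Ne, rez H.t0]; exact G.av_pos _ H.mZ H.pos x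
            · left; exact rnt H.t0.le (H.avZ_fin G _ x)
          calc _ ≤ ‖G.D j f x‖ₑ^2 * (C * G.av (j+1) Z x^(-θ)) := mlm this _
            _ = _ := RG
      _ = _ := lcmz _ ((mD j).mul (mA _))
  have h2 : ∀ (a : ℤ) (m : ℕ), (∫⁻ x, ‖G.E (a+m) f x‖ₑ^2 * G.av (a+m) Z x^(-θ)) + c * ∑ i ∈ rnq m, q (a+i) ≤ ∫⁻ x, ‖f x‖ₑ^2 * v x := by
    intro a m
    induction m with
    | zero => simpa using H.haar_top G a hm
    | succ m ih =>
      refine ltz ?_ ih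
      rw [srs, mul_add, add_comm (c * _) (c * _), ← add_assoc]
      refine add_le_add_left ?_ _
      have := H.haar_step G (a+m) hf hm
      push_cast; rw [← add_assoc]; exact this
  have h3 : ∑' j, q j ≤ c⁻¹ * ∫⁻ x, ‖f x‖ₑ^2 * v x := by
    rw [ENNReal.tsum_eq_iSup_sum]
    refine iSup_le fun S => ?_
    obtain ⟨N, hN⟩ : ∃ N : ℕ, ∀ j ∈ S, |j| ≤ N := by
      refine ⟨S.sup Int.natAbs, fun j hj => ?_⟩
      have := Finset.le_sup (f := Int.natAbs) hj
      rw [Int.abs_eq_natAbs]; exact_mod_cast this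
    have h4 := (le_add_left le_rfl).trans (h2 (-N) (2*N+1))
    rw [mcz c⁻¹, ← dem, ldiq (Or.inl hc0) (Or.inl ont), mcz]
    refine ltz (mlm ?_ _) h4
    calc ∑ j ∈ S, q j ≤ ∑ j ∈ (rnq (2*N+1)).image (fun i : ℕ => -(N:ℤ) + i), q j := by
          refine Finset.sum_le_sum_of_subset fun j hj => ?_
          have := hN j hj; rw [abs_le] at this
          rw [Finset.mem_image]; exact ⟨(j + N).toNat, by rw [mrq]; omega, OM⟩
      _ = _ := Finset.sum_image (fun i _ j _ h => by simpa using h)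
  calc _ ≤ ∑' j, C * q j := tlt h1
    _ = C * ∑' j, q j := tml
    _ ≤ C * (c⁻¹ * _) := mlm h3 _
    _ = _ := RG
end GW
end
section
variable {c : EE} {r x y θ : ℝ} {g : ℝ → EE} {n : ℤ}

structure SA (A Λ : EE) (n : ℤ) (W : ℝ → EE) : Prop where
  mW : Measurable W
  pos : ∀ x, W x ≠ 0
  fin : ∀ x, W x ≠ ⊤
  hA1 : 1 ≤ A
  hA : A ≠ ⊤
  hL : 1 ≤ Λ
  m0 : ∀ x, MS 0 W x ≤ A * W x
  mp : ∀ x, MS n W x ≤ A * Λ * W x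
  mm : ∀ x, MS (-n) W x ≤ A * Λ * W x
lemma BB_const_mul (n u k : ℤ) (hg : Measurable g) (c : EE) (x : ℝ) :
    BB n u k (fun y => c * g y) x = c * BB n u k g x := by
  unfold BB; rw [lcmz _ hg, mul_div_assoc]
lemma BB_mul_le {u k : ℤ} (hg : Measurable g) {D : EE}
    (h : ∀ y ∈ sball n u k x, g y * c ≤ D) : BB n u k g x * c ≤ 2 * D := by
  rw [← BB_const n u k D x, mcz, ← BB_const_mul _ _ _ hg]
  unfold BB
  refine dld (setLIntegral_mono mcq fun y hy => ?_) _
  rw [mcz]; exact h y hy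
namespace SA
variable {A Λ : EE} {n : ℤ} {W : ℝ → EE} (H : SA A Λ n W)
include H
lemma b0 (k : ℤ) (x : ℝ) : BB 0 0 k W x ≤ A * W x := (le_iSup (fun k => BB 0 0 k W x) k).trans (H.m0 x)
lemma b0' (k : ℤ) (hy : y ∈ sball 0 0 k x) : BB 0 0 k W x ≤ 2 * A * W y := by
  refine (BB_mono_set W (n' := 0) (u' := 0) (k' := k+1) (x' := y) (fun z hz => ?_) 1 (by push_cast; ring)).trans ?_
  · rw [mem_sball] at *
    rw [add_zero, Grid.two_succ]; rw [add_zero] at hz hy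
    push_cast at *
    rw [abs_le] at *; constructor <;> linarith
  · rw [pow_one, maq]; exact mlm (H.b0 _ _) _
lemma b2 (m : ℤ) (hm : ∀ x, MS m W x ≤ A * Λ * W x) (k : ℤ) (x : ℝ) : BB m 2 k W x ≤ A^2 * Λ * W x :=
  calc _ ≤ BB 0 0 (k+(2:ℕ)+1) (BB m 0 k W) x := BB_conv m k 2 H.mW x
    _ ≤ BB 0 0 (k+(2:ℕ)+1) (fun y => A * Λ * W y) x := BB_mono x fun y => (le_iSup (fun k => BB m 0 k W y) k).trans (hm y)
    _ = A * Λ * BB 0 0 (k+(2:ℕ)+1) W x := BB_const_mul _ _ _ H.mW _ _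
    _ ≤ A * Λ * (A * W x) := mlm (H.b0 _ _) _
    _ = _ := RG
lemma aux2 (k : ℤ) (hy : y ∈ sball (-n) 0 k x) : BB 0 0 (k+1) W x ≤ 2 * A^2 * Λ * W y := by
  refine (BB_mono_set W (n' := n) (u' := 2) (k' := k) (x' := y) (fun z hz => ?_) 1 (by push_cast; ring)).trans ?_
  · rw [mem_sball] at *
    rw [zpow_add₀ NM]; rw [add_zero, Grid.two_succ] at hz; rw [add_zero] at hy
    have := Grid.two_pos k
    push_cast at *
    rw [abs_le] at *; constructor <;> linarith
  · rw [pow_one, maq, maq, ← maq (A^2)]; exact mlm (H.b2 n H.mp _ _) _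
lemma aux3 (k : ℤ) (hy : y ∈ sball 0 0 (k+1) x) : BB (-n) 0 k W x ≤ 4 * A^2 * Λ * W y := by
  refine (BB_mono_set W (n' := -n) (u' := 2) (k' := k) (x' := y) (fun z hz => ?_) 2 (by push_cast; ring)).trans ?_
  · rw [mem_sball] at *
    rw [zpow_add₀ NM]; rw [add_zero, Grid.two_succ] at hy; rw [add_zero] at hz
    have := Grid.two_pos k
    push_cast at *
    rw [abs_le] at *; constructor <;> linarith
  · rw [maq 4, maq 4]
    refine (mlm (H.b2 _ H.mm _ _) _).trans_eq NM
lemma hAA : A ≤ A^2 := by rw [pow_two]; exact lmo (zero_le) H.hA1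
lemma gw_neg (t0 : 0 < θ) (t1 : θ < 1) : GW θ (8 * A^2) Λ n (fun x => W x^(-θ)) W := by
  have cv : ∀ (a c : EE) y, 1 ≤ c → a ≤ c * W y → W y^(-θ) * a^θ ≤ c := by
    intro a c y hc h
    calc _ ≤ W y^(-θ) * (c * W y)^θ := mlm (rlr h t0.le) _
      _ = c^θ * (W y^θ * W y^(-θ)) := by rw [mro _ _ t0.le]; ring
      _ = c^θ := by rw [← raq _ _ (H.pos y) (H.fin y)]; simp
      _ ≤ c^(1:ℝ) := rlrq hc t1.le
      _ = c := SI
  have o1 : 1 ≤ 2 * A := H.hA1.trans (lmo (zero_le) NM)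
  have o2 : 1 ≤ 2 * A^2 * Λ := (o1.trans (mlm H.hAA _)).trans (le_mul_of_one_le_right (zero_le) H.hL)
  refine ⟨t0, t1, H.mW, H.pos, H.fin, fun _ => rfl, mnt NM (ENNReal.pow_ne_top H.hA), ?_, ?_⟩
  · intro k x
    refine (BB_mul_le (H.mW.pow_const _) fun y hy => cv _ (2*A) y o1 (H.b0' k hy)).trans ?_
    calc 2 * (2 * A) = 4 * A := RG
      _ ≤ 8 * A^2 := mlmz NM H.hAA
  · intro k x
    refine (BB_mul_le (H.mW.pow_const _) fun y hy => cv _ (2*A^2*Λ) y o2 (H.aux2 k hy)).trans ?_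
    calc 2 * (2 * A^2 * Λ) = 4 * A^2 * Λ := RG
      _ ≤ 8 * A^2 * Λ := by gcongr; norm_num
lemma gw_pos (t0 : 0 < θ) (t1 : θ < 1) : GW θ (8 * A^2) Λ n W (fun x => W x^(-θ⁻¹)) := by
  have ti : 0 < θ⁻¹ := inv_pos.2 t0
  have cv : ∀ (k x : _) (b c : EE), (∀ y ∈ sball 0 0 k x, b ≤ c * W y) → b * (BB 0 0 k (fun x => W x^(-θ⁻¹)) x)^θ ≤ 2 * c := by
    intro k x b c h
    have h1 := BB_mul_le (n := 0) (u := 0) (k := k) (x := x) (g := fun x => W x^(-θ⁻¹)) (H.mW.pow_const _) (c := b^θ⁻¹) (D := c^θ⁻¹) fun y hy => by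
      calc _ ≤ W y^(-θ⁻¹) * (c * W y)^θ⁻¹ := mlm (rlr (h y hy) ti.le) _
        _ = c^θ⁻¹ * (W y^θ⁻¹ * W y^(-θ⁻¹)) := by rw [mro _ _ ti.le]; ring
        _ = c^θ⁻¹ := by rw [← raq _ _ (H.pos y) (H.fin y)]; simp
        _ ≤ _ := le_rfl
    have h2 := rlr h1 t0.le
    rw [mro _ _ t0.le, mro _ _ t0.le, ← rmq, ← rmq, inv_mul_cancel₀ t0.ne',
      roq, roq, mcz] at h2
    refine h2.trans (mlmq ?_ _)
    conv_rhs => rw [← roq 2]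
    exact rlrq NM t1.le
  refine ⟨t0, t1, H.mW.pow_const _, fun x => ?_, fun x => ?_, fun x => ?_, mnt NM (ENNReal.pow_ne_top H.hA), fun k x => ?_, fun k x => ?_⟩
  · rw [rnw, Ne, ENNReal.inv_eq_zero]; exact rnt ti.le (H.fin x)
  · rw [rnw, Ne, ENNReal.inv_eq_top, rez ti]; exact H.pos x
  · rw [← rmq, neg_mul_neg, inv_mul_cancel₀ t0.ne', roq]
  · refine (cv k x _ (2*A) (fun y hy => H.b0' k hy)).trans ?_
    calc 2 * (2 * A) = 4 * A := RG
      _ ≤ 8 * A^2 := mlmz NM H.hAA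
  · refine (cv (k+1) x _ (4*A^2*Λ) (fun y hy => H.aux3 k hy)).trans_eq ?_
    rw [← maq, ← maq]; norm_num
end SA
lemma tsum_rpow_le {ι : Type*} (a δ : ι → EE) (h0 : ∀ i, δ i ≠ 0) (ht : ∀ i, δ i ≠ ⊤) {q : ℝ} (hq : 0 < q) :
    (∑' i, a i)^q ≤ (∑' i, δ i)^q * ∑' i, (a i / δ i)^q := by
  calc (∑' i, a i)^q ≤ (∑' i, δ i * ⨆ j, a j / δ j)^q := by
        refine rlr (tlt fun i => ?_) hq.le
        calc a i = δ i * (a i / δ i) := (mdcq (h0 i) (ht i)).symm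
          _ ≤ _ := mlm (le_iSup (fun j => a j / δ j) i) _
    _ = (∑' i, δ i)^q * (⨆ j, a j / δ j)^q := by rw [tmr, mro _ _ hq.le]
    _ ≤ _ := by
        refine mlm ?_ _
        have := (ENNReal.orderIsoRpow q hq).map_iSup (fun j => a j / δ j)
        simp only [ENNReal.orderIsoRpow_apply] at this
        rw [this]
        exact iSup_le fun j => ltq j
def N0 (n : ℤ) (Λ : EE) (g : ℝ → EE) (x : ℝ) : EE := MS 0 g x + Λ⁻¹ * (MS n g x + MS (-n) g x)
lemma MS_tsum (n : ℤ) {g : ℕ → ℝ → EE} (hg : ∀ j, Measurable (g j)) (x : ℝ) : MS n (fun y => ∑' j, g j y) x ≤ ∑' j, MS n (g j) x := by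
  refine iSup_le fun k => ?_
  have : BB n 0 k (fun y => ∑' j, g j y) x = ∑' j, BB n 0 k (g j) x := by
    unfold BB
    simp_rw [dem]
    rw [ltw fun j => (hg j).aemeasurable, tmr]
  rw [this]
  exact tlt fun j => le_iSup (fun k => BB n 0 k (g j) x) k
lemma MS_mul (n : ℤ) (hg : Measurable g) (c : EE) (x : ℝ) : MS n (fun y => c * g y) x = c * MS n g x := by
  unfold MS; simp_rw [BB_const_mul _ _ _ hg]; rw [ENNReal.mul_iSup]
lemma MS_le_const (n : ℤ) (h : ∀ y, g y ≤ c) (x : ℝ) : MS n g x ≤ 2 * c :=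
  iSup_le fun k => (BB_mono x h).trans_eq (BB_const n 0 k c x)
lemma N0_tsum (n : ℤ) (Λ : EE) {g : ℕ → ℝ → EE} (hg : ∀ j, Measurable (g j)) (x : ℝ) : N0 n Λ (fun y => ∑' j, g j y) x ≤ ∑' j, N0 n Λ (g j) x := by
  unfold N0
  rw [ENNReal.tsum_add, tml, ENNReal.tsum_add]
  exact ala (MS_tsum 0 hg x) (mlm (ala (MS_tsum n hg x) (MS_tsum _ hg x)) _)
lemma N0_mul (n : ℤ) (Λ : EE) (hg : Measurable g) (c : EE) (x : ℝ) : N0 n Λ (fun y => c * g y) x = c * N0 n Λ g x := by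
  unfold N0; rw [MS_mul _ hg, MS_mul _ hg, MS_mul _ hg]; ring
lemma N0_le_const (n : ℤ) {Λ : EE} (hΛ : 1 ≤ Λ) (h : ∀ y, g y ≤ c) (x : ℝ) : N0 n Λ g x ≤ 6 * c :=
  calc _ ≤ 2 * c + 1 * (2 * c + 2 * c) := ala (MS_le_const 0 h x) (mlmz (ENNReal.inv_le_one.2 hΛ) (ala (MS_le_const n h x) (MS_le_const _ h x)))
    _ = _ := RG
lemma add3_rpow (hr : 0 < r) (a b c : EE) : (a + b + c)^r ≤ 3^r * (a^r + b^r + c^r) := by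
  have := tsum_rpow_le ![a,b,c] (fun _ => 1) SI SI hr
  simpa [tsum_fintype, Fin.sum_univ_succ, add_assoc, show (1:EE)+(1+1) = 3 by norm_num] using this
lemma N0_bound (hr : 1 < r) {L : ℕ} (hn : |(n:ℝ)| ≤ 2^L) (hg : Measurable g) :
    ∫⁻ x, N0 n (L+3) g x ^ r ≤ 3^r * (10 * (8^r * (4^r * geoC (r-1)))) * ∫⁻ x, g x ^ r := by
  set K := 8^r * (4^r * geoC (r-1)) with hK
  have hr0 : 0 < r := LI
  have h0 := MS_bound hr (n := 0) (L := 0) SI hg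
  have h1 := MS_bound hr hn hg
  have h2 := MS_bound hr (n := -n) (L := L) (by simpa using hn) hg
  rw [← hK] at h0 h1 h2
  have hl : ((L:EE)+3)⁻¹^r * (2 * (L+3)) ≤ 2 := by
    have ht : (L:EE)+3 ≠ ⊤ := FI
    have e : (L:EE)+3 = (L+3)^(1:ℝ) := SI
    conv_lhs => rw [mcz, maq]; enter [2]; rw [ENNReal.inv_rpow, ← rnw]; enter [1]; rw [e]
    rw [← raq _ _ SI ht]
    conv_rhs => rw [← mul_one 2]
    refine mlm ?_ _
    refine ENNReal.rpow_le_one_of_one_le_of_neg ?_ LI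
    exact le_add_left NM
  have m0 := (measurable_MS 0 hg).pow_const r
  have m1 := (measurable_MS n hg).pow_const r
  have m2 := (measurable_MS (-n) hg).pow_const r
  calc _ ≤ ∫⁻ x, 3^r * (MS 0 g x^r + ((L:EE)+3)⁻¹^r * MS n g x^r + ((L:EE)+3)⁻¹^r * MS (-n) g x^r) := by
        refine lmq fun x => ?_
        unfold N0
        rw [mul_add, ← add_assoc, ← mro _ _ hr0.le, ← mro _ _ hr0.le]
        exact add3_rpow hr0 _ _ _
    _ = 3^r * ((∫⁻ x, MS 0 g x^r) + ((L:EE)+3)⁻¹^r * (∫⁻ x, MS n g x^r) + ((L:EE)+3)⁻¹^r * (∫⁻ x, MS (-n) g x^r)) := by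
        rw [lcmq _ _ FI, lintegral_add_right _ (m2.const_mul _), lintegral_add_right _ (m1.const_mul _), lcmz _ m1, lcmz _ m2]
    _ ≤ 3^r * (K * (2 * ((0:ℕ)+3)) * (∫⁻ x, g x^r) + ((L:EE)+3)⁻¹^r * (K * (2 * (L+3)) * ∫⁻ x, g x^r) + ((L:EE)+3)⁻¹^r * (K * (2 * (L+3)) * ∫⁻ x, g x^r)) := by
        gcongr
    _ = 3^r * (K * 6 * (∫⁻ x, g x^r) + 2 * ((((L:EE)+3)⁻¹^r * (2 * (L+3))) * K * ∫⁻ x, g x^r)) := by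
        congr 1; rw [Nat.cast_zero, zero_add, show (2:EE)*3 = 6 by norm_num]; ring
    _ ≤ 3^r * (K * 6 * (∫⁻ x, g x^r) + 2 * (2 * K * ∫⁻ x, g x^r)) := by gcongr
    _ = _ := RG
end
section
variable {w : RR → EE} {r : ℝ}

def NN (n₁ n₂ : ℤ) (Λ₁ Λ₂ : EE) (w : RR → EE) (p : RR) : EE :=
  N0 n₁ Λ₁ (fun x => w (x, p.2)) p.1 + N0 n₂ Λ₂ (fun y => w (p.1, y)) p.2
lemma measurable_N0_param (n : ℤ) (Λ : EE) (hw : Measurable w) :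
    Measurable (fun p : RR => N0 n Λ (fun x => w (x, p.2)) p.1) := by
  unfold N0
  exact (measurable_MS_param 0 hw).add (((measurable_MS_param n hw).add (measurable_MS_param (-n) hw)).const_mul _)
lemma measurable_N0_param' (n : ℤ) (Λ : EE) (hw : Measurable w) :
    Measurable (fun p : RR => N0 n Λ (fun y => w (p.1, y)) p.2) := by
  have := (measurable_N0_param n Λ (hw.comp measurable_swap)).comp measurable_swap
  simp only [cdq] at this
  exact this
lemma mfst (hw : Measurable w) (y : ℝ) : Measurable (fun x => w (x, y)) := hw.comp (measurable_id.prodMk mcq)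
lemma msnd (hw : Measurable w) (x : ℝ) : Measurable (fun y => w (x, y)) := hw.comp (measurable_const.prodMk miv)
lemma lint_fst (hw : Measurable w) : ∫⁻ p, w p = ∫⁻ y, ∫⁻ x, w (x, y) := by
  rw [vep, lintegral_prod_symm _ hw.aemeasurable]
lemma lint_snd (hw : Measurable w) : ∫⁻ p, w p = ∫⁻ x, ∫⁻ y, w (x, y) := by
  rw [vep, lintegral_prod _ hw.aemeasurable]
lemma NN_bound (hr : 1 < r) : ∃ B : EE, B ≠ ⊤ ∧ 12 ≤ B ∧ ∀ (n₁ n₂ : ℤ) (L₁ L₂ : ℕ), |(n₁:ℝ)| ≤ 2^L₁ → |(n₂:ℝ)| ≤ 2^L₂ →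
    ∀ w : RR → EE, Measurable w → ∫⁻ p, NN n₁ n₂ (L₁+3) (L₂+3) w p^r ≤ B^r * ∫⁻ p, w p^r := by
  have hr0 : 0 < r := LI
  set K := (3:EE)^r * (10 * (8^r * (4^r * geoC (r-1)))) with hK
  have hKt : K ≠ ⊤ := by
    have := geoC_ne_top (s := r-1) LI
    rw [hK]; finiteness
  refine ⟨max 12 ((3^r*(2*K))^(r⁻¹)), FI, le_max_left _ _, ?_⟩
  intro n₁ n₂ L₁ L₂ h1 h2 w hw
  have m1 := (measurable_N0_param n₁ (L₁+3) hw).pow_const r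
  have m2 := (measurable_N0_param' n₂ (L₂+3) hw).pow_const r
  have i1 : ∫⁻ p : RR, N0 n₁ (L₁+3) (fun x => w (x, p.2)) p.1^r ≤ K * ∫⁻ p, w p^r := by
    rw [lint_fst m1, lint_fst (hw.pow_const r), ← lcmq _ _ hKt]
    exact lmq fun y => N0_bound hr h1 (mfst hw y)
  have i2 : ∫⁻ p : RR, N0 n₂ (L₂+3) (fun y => w (p.1, y)) p.2^r ≤ K * ∫⁻ p, w p^r := by
    rw [lint_snd m2, lint_snd (hw.pow_const r), ← lcmq _ _ hKt]
    exact lmq fun y => N0_bound hr h2 (msnd hw y)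
  calc _ ≤ ∫⁻ p : RR, 3^r * (N0 n₁ (L₁+3) (fun x => w (x, p.2)) p.1^r + N0 n₂ (L₂+3) (fun y => w (p.1, y)) p.2^r) := by
        refine lmq fun p => ?_
        have := add3_rpow hr0 (N0 n₁ (L₁+3) (fun x => w (x, p.2)) p.1) (N0 n₂ (L₂+3) (fun y => w (p.1, y)) p.2) 0
        rw [zro hr0, add_zero, add_zero] at this
        exact this
    _ = 3^r * ((∫⁻ p : RR, N0 n₁ (L₁+3) (fun x => w (x, p.2)) p.1^r) + ∫⁻ p : RR, N0 n₂ (L₂+3) (fun y => w (p.1, y)) p.2^r) := by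
        rw [lcmq _ _ FI, lal m1]
    _ ≤ 3^r * (K * (∫⁻ p, w p^r) + K * (∫⁻ p, w p^r)) := by gcongr
    _ = (3^r*(2*K)) * ∫⁻ p, w p^r := RG
    _ ≤ _ := by
        refine mlmq ?_ _
        calc _ = ((3^r*(2*K))^(r⁻¹))^r := by rw [← rmq, inv_mul_cancel₀ hr0.ne', roq]
          _ ≤ _ := rlr (le_max_right _ _) hr0.le
lemma rdf (hr : 1 < r) : ∃ A : EE, A ≠ ⊤ ∧ ∀ (n₁ n₂ : ℤ) (L₁ L₂ : ℕ), |(n₁:ℝ)| ≤ 2^L₁ → |(n₂:ℝ)| ≤ 2^L₂ →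
    ∀ (w : RR → EE) (b : EE), Measurable w → b ≠ ⊤ → (∀ p, w p ≤ b) → (∀ p, w p ≠ 0) →
    ∃ W : RR → EE, Measurable W ∧ (∀ p, w p ≤ W p) ∧ ∫⁻ p, W p^r ≤ 2^r * 2 * ∫⁻ p, w p^r ∧
      (∀ y, SA A (L₁+3) n₁ (fun x => W (x,y))) ∧ (∀ x, SA A (L₂+3) n₂ (fun y => W (x,y))) := by
  have hr0 : 0 < r := LI
  obtain ⟨B, hBt, hB, HB⟩ := NN_bound hr
  have hB0 : B ≠ 0 := fun h => by rw [h] at hB; norm_num at hB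
  refine ⟨4 * B, FI, ?_⟩
  intro n₁ n₂ L₁ L₂ h1 h2 w b hw hbt hb hw0
  set N := NN n₁ n₂ (L₁+3) (L₂+3) with hN
  have hL : ∀ L : ℕ, (1:EE) ≤ (L:EE)+3 := fun L => le_add_left NM
  have mN : ∀ j, Measurable (N^[j] w) := by
    intro j
    induction j with
    | zero => exact hw
    | succ j ih => rw [isa, hN]; exact (measurable_N0_param _ _ ih).add (measurable_N0_param' _ _ ih)
  have bN : ∀ j p, N^[j] w p ≤ B^j * b := by
    intro j
    induction j with
    | zero => simpa using hb
    | succ j ih =>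
      intro p; rw [isa, hN, NN]
      calc _ ≤ 6 * (B^j*b) + 6 * (B^j*b) := ala (N0_le_const _ (hL _) (fun y => ih _) _) (N0_le_const _ (hL _) (fun y => ih _) _)
        _ = 12 * (B^j*b) := by rw [← add_mul]; norm_num
        _ ≤ B * (B^j*b) := by gcongr
        _ = _ := RG
  have iN : ∀ j, ∫⁻ p, N^[j] w p^r ≤ (B^j)^r * ∫⁻ p, w p^r := by
    intro j
    induction j with
    | zero => simp
    | succ j ih =>
      rw [isa]
      calc _ ≤ B^r * ∫⁻ p, (N^[j] w p)^r := HB n₁ n₂ L₁ L₂ h1 h2 _ (mN j)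
        _ ≤ B^r * ((B^j)^r * ∫⁻ p, w p^r) := by gcongr
        _ = _ := by rw [← maq, ← mro _ _ hr0.le, pow_succ']
  set c : EE := (4 * B)⁻¹ with hc
  have hc0 : c ≠ 0 := by rw [hc]; exact ENNReal.inv_ne_zero.2 FI
  have hct : c ≠ ⊤ := by rw [hc]; exact intq.2 (by simp [hB0])
  have hcB : c * B = 4⁻¹ := by
    rw [hc, miw (Or.inl NM) (Or.inl NM), maq, imc hB0 hBt, mul_one]
  have hgeo : ∑' j : ℕ, (2⁻¹:EE)^j = 2 := by rw [tgq, osi, inv_inv]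
  set W : RR → EE := fun p => ∑' j : ℕ, c^j * N^[j] w p with hW
  have mW : Measurable W := Measurable.tsum fun j => (mN j).const_mul _
  have hwW : ∀ p, w p ≤ W p := fun p => by
    have := ltq (f := fun j : ℕ => c^j * N^[j] w p) 0
    simpa using this
  have hWt : ∀ p, W p ≠ ⊤ := fun p => by
    refine ne_top_of_le_ne_top (b := 2 * b) FI ?_
    rw [← hgeo, ← tmr]
    refine tlt fun j => ?_
    calc _ ≤ c^j * (B^j * b) := mlm (bN j p) _
      _ = (4⁻¹)^j * b := by rw [← maq, ← mul_pow, hcB]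
      _ ≤ _ := by gcongr; norm_num
  have hW0 : ∀ p, W p ≠ 0 := fun p h => hw0 p (nonpos_iff_eq_zero.1 (h ▸ hwW p))
  have hNW : ∀ p, N W p ≤ 4 * B * W p := by
    intro p
    have : N W p ≤ ∑' j : ℕ, c^j * N (N^[j] w) p := by
      have e : ∀ g, N g p = N0 n₁ (L₁+3) (fun x => g (x, p.2)) p.1 + N0 n₂ (L₂+3) (fun y => g (p.1, y)) p.2 := fun _ => rfl
      simp only [e, mul_add]
      rw [ENNReal.tsum_add]
      refine ala ((N0_tsum _ _ (fun j => (mfst (mN j) _).const_mul _) _).trans (tlt fun j => ?_)) ((N0_tsum _ _ (fun j => (msnd (mN j) _).const_mul _) _).trans (tlt fun j => ?_))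
      · rw [N0_mul _ _ (mfst (mN j) _)]
      · rw [N0_mul _ _ (msnd (mN j) _)]
    refine this.trans ?_
    have e : ∀ j : ℕ, c^j * N (N^[j] w) p = 4 * B * (c^(j+1) * N^[j+1] w p) := by
      intro j
      rw [isa, pow_succ, ← maq (4*B), mcz (c^j) c, ← maq (4*B), hc, ENNReal.mul_inv_cancel (by simp [hB0]) FI, one_mul]
    simp_rw [e]
    rw [tml]
    refine mlm ?_ _
    exact tcl (fun a b h => by simpa using h) (fun j : ℕ => c^j * N^[j] w p)
  have o1 : 1 ≤ 4 * B := by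
    calc (1:EE) ≤ 4 * 12 := NM
      _ ≤ _ := by gcongr
  have sa : ∀ (n : ℤ) (L : ℕ) (g : ℝ → EE) x, N0 n (L+3) g x ≤ 4 * B * g x → MS 0 g x ≤ 4 * B * g x ∧ MS n g x ≤ 4 * B * (L+3) * g x ∧ MS (-n) g x ≤ 4 * B * (L+3) * g x := by
    intro n L g x h
    unfold N0 at h
    have ht : (L:EE)+3 ≠ ⊤ := FI
    have h0 : (L:EE)+3 ≠ 0 := SI
    have h3 := (le_add_left le_rfl).trans h
    rw [mcz, ← dem, ENNReal.div_le_iff h0 ht, mul_right_comm] at h3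
    exact ⟨(le_add_right le_rfl).trans h, (le_add_right le_rfl).trans h3, (le_add_left le_rfl).trans h3⟩
  refine ⟨W, mW, hwW, ?_, fun y => ?_, fun x => ?_⟩
  · calc _ ≤ ∫⁻ p, 2^r * ∑' j : ℕ, ((2⁻¹)^j * (B^j)⁻¹ * N^[j] w p)^r := by
          refine lmq fun p => ?_
          have := tsum_rpow_le (fun j : ℕ => c^j * N^[j] w p) (fun j => (2⁻¹)^j) (fun j => SI) (fun j => FI) hr0
          rw [hgeo] at this
          refine this.trans_eq ?_
          congr 2; ext j; congr 1
          have e1 : c * 2 = 2⁻¹ * B⁻¹ := ?_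
          · rw [dem, ENNReal.inv_pow (a := 2⁻¹), inv_inv, mul_right_comm, ← mul_pow, e1, mul_pow, ENNReal.inv_pow (a := B)]
          rw [hc, miw (Or.inl NM) (Or.inl NM), mul_right_comm]
          congr 1
          rw [show (4:EE) = 2 * 2 by norm_num, miw (Or.inl NM) (Or.inl NM), maq, imc NM NM, mul_one]
      _ = 2^r * ∑' j : ℕ, ((2⁻¹)^j * (B^j)⁻¹)^r * ∫⁻ p, (N^[j] w p)^r := by
          rw [lcmq _ _ FI, ltw fun j => (((mN j).const_mul _).pow_const r).aemeasurable]
          congr 2; ext j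
          simp_rw [mro _ _ hr0.le]
          rw [lcmz _ ((mN j).pow_const r)]
      _ ≤ 2^r * ∑' j : ℕ, (2⁻¹)^j * ∫⁻ p, w p^r := by
          refine mlm (tlt fun j => ?_) _
          calc _ ≤ ((2⁻¹)^j * (B^j)⁻¹)^r * ((B^j)^r * ∫⁻ p, w p^r) := mlm (iN j) _
            _ = ((2⁻¹)^j)^r * ∫⁻ p, w p^r := by
              rw [← maq, ← mro _ _ hr0.le, maq, imc (pow_ne_zero _ hB0) FI, mul_one]
            _ ≤ ((2⁻¹)^j)^(1:ℝ) * ∫⁻ p, w p^r := by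
              refine mlmq (rlrz (pow_le_one' SI j) hr.le) _
            _ = _ := SI
      _ = _ := by rw [tmr, hgeo]; ring
  · have h : ∀ x, N0 n₁ (L₁+3) (fun x => W (x, y)) x ≤ 4 * B * W (x,y) := fun x => (le_add_right le_rfl).trans (hNW (x,y))
    exact ⟨mfst mW y, fun x => hW0 _, fun x => hWt _, o1, FI, hL _, fun x => (sa _ _ _ x (h x)).1, fun x => (sa _ _ _ x (h x)).2.1, fun x => (sa _ _ _ x (h x)).2.2⟩
  · have h : ∀ y, N0 n₂ (L₂+3) (fun y => W (x, y)) y ≤ 4 * B * W (x,y) := fun y => (le_add_left le_rfl).trans (hNW (x,y))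
    exact ⟨msnd mW x, fun x => hW0 _, fun x => hWt _, o1, FI, hL _, fun x => (sa _ _ _ x (h x)).1, fun x => (sa _ _ _ x (h x)).2.1, fun x => (sa _ _ _ x (h x)).2.2⟩
end
section
variable {p : ℝ}

structure GW2 (θ : ℝ) (C Λ₁ Λ₂ : EE) (n₁ n₂ : ℤ) (V Z : RR → EE) : Prop where
  mV : Measurable V
  g1 : ∀ y, GW θ C Λ₁ n₁ (fun x => V (x,y)) (fun x => Z (x,y))
  g2 : ∀ x, GW θ C Λ₂ n₂ (fun y => V (x,y)) (fun y => Z (x,y))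
lemma rdf' {r : ℝ} (hr : 1 < r) : ∃ A c : EE, A ≠ ⊤ ∧ c ≠ ⊤ ∧ ∀ (n₁ n₂ : ℤ) (L₁ L₂ : ℕ), |(n₁:ℝ)| ≤ 2^L₁ → |(n₂:ℝ)| ≤ 2^L₂ →
    ∀ (u : RR → EE) (b X : EE), Measurable u → b ≠ ⊤ → (∀ p, u p ≤ b) → X ≠ 0 → X ≠ ⊤ → ∫⁻ p, u p^r ≤ X →
    ∃ W : RR → EE, Measurable W ∧ (∀ p, u p ≤ W p) ∧ ∫⁻ p, W p^r ≤ c * X ∧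
      (∀ y, SA A (L₁+3) n₁ (fun x => W (x,y))) ∧ (∀ x, SA A (L₂+3) n₂ (fun y => W (x,y))) := by
  have hr0 : 0 < r := LI
  obtain ⟨A, hA, H⟩ := rdf hr
  refine ⟨A, 2^r*2*(3^r*2), hA, FI, ?_⟩
  intro n₁ n₂ L₁ L₂ h1 h2 u b X hu hb hub hX0 hXt hX
  obtain ⟨g, g0, gm, gi⟩ := exists_pos_lintegral_lt_of_sigmaFinite (volume : Measure (RR)) (ε := 1) NM
  have e0 : X^(r⁻¹) ≠ 0 := by simp [hX0, hXt]
  have et : X^(r⁻¹) ≠ ⊤ := FI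
  have gm' : Measurable (fun p => min (g p : EE) 1) := gm.coe_nnreal_ennreal.min mcq
  have mw : Measurable (fun p => u p + X^(r⁻¹) * min (g p : EE) 1) := hu.add (gm'.const_mul _)
  obtain ⟨W, mW, hW, iW, s1, s2⟩ := H n₁ n₂ L₁ L₂ h1 h2 (fun p => u p + X^(r⁻¹) * min (g p : EE) 1) (b + X^(r⁻¹)) mw FI
    (fun p => ala (hub p) (mul_le_of_le_one_right' (min_le_right _ _))) (fun p => by
      have : (g p : EE) ≠ 0 := by simpa using (g0 p).ne'
      simp [e0, this])
  refine ⟨W, mW, fun p => (le_add_right le_rfl).trans (hW p), iW.trans ?_, s1, s2⟩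
  rw [maq (2^r*2) (3^r*2) X]
  refine mlm ?_ _
  calc _ ≤ ∫⁻ p, 3^r * (u p^r + X * g p) := by
        refine lmq fun p => ?_
        have := add3_rpow hr0 (u p) (X^(r⁻¹) * min (g p : EE) 1) 0
        rw [zro hr0, add_zero, add_zero, mro _ _ hr0.le, ← rmq, inv_mul_cancel₀ hr0.ne', roq] at this
        refine this.trans (mlm (ala le_rfl (mlm ?_ _)) _)
        calc _ ≤ min (g p : EE) 1 ^ (1:ℝ) := rlrz (min_le_right _ _) hr.le
          _ ≤ _ := by rw [roq]; exact min_le_left _ _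
    _ = 3^r * ((∫⁻ p, u p^r) + X * ∫⁻ p, g p) := by
        rw [lcmq _ _ FI, lal (hu.pow_const r), lcmq _ _ hXt]
    _ ≤ 3^r * (X + X * 1) := by gcongr
    _ = _ := RG
def ExtrapAt (p θ : ℝ) (C K : EE) : Prop :=
  ∀ (n₁ n₂ : ℤ) (L₁ L₂ : ℕ), |(n₁:ℝ)| ≤ 2^L₁ → |(n₂:ℝ)| ≤ 2^L₂ →
    ∀ (D b : EE) (F G : RR → EE), Measurable F → Measurable G → b ≠ ⊤ → (∀ z, F z ≤ b) → ∫⁻ z, F z^p ≠ ⊤ →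
    (∀ V Z, GW2 θ C (L₁+3) (L₂+3) n₁ n₂ V Z → ∫⁻ z, G z^2 * V z ≤ D * ∫⁻ z, F z^2 * V z) →
    ∫⁻ z, G z^p ≤ K * D^(p/2) * ∫⁻ z, F z^p
lemma extrap_two : ExtrapAt 2 (1/2) (8*2^2) 1 := by
  intro n₁ n₂ L₁ L₂ h1 h2 D b F G mF mG hb hF iF H
  have sa : ∀ (L : ℕ) (n : ℤ), SA 2 (L+3) n (fun _ => 1) := fun L n => by
    have h : ∀ (n : ℤ) x, MS n (fun _ => 1) x = 2 := fun n x => by simp [MS, BB_const]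
    have hL : (1:EE) ≤ (L:EE)+3 := le_add_left NM
    have : (2:EE) ≤ 2 * (L+3) := lmoq hL
    exact ⟨mcq, SI, SI, NM, NM, hL, fun x => by simp [h], fun x => by simpa [h] using this, fun x => by simpa [h] using this⟩
  have := H (fun _ => 1) (fun _ => 1^(-HH⁻¹)) ⟨mcq, fun y => (sa L₁ n₁).gw_pos NM NM, fun y => (sa L₂ n₂).gw_pos NM NM⟩
  simpa using this
lemma extrap_gt (hp : 2 < p) : ∃ C K : EE, C ≠ ⊤ ∧ K ≠ ⊤ ∧ ExtrapAt p (1/2) C K := by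
  have hr : 1 < p/(p-2) := by rw [lt_div_iff₀ LI]; linarith
  have hr1 : 0 < p/(p-2) := LI
  have hp0 : 0 < p - 2 := LI
  have hpp : 0 < p := LI
  obtain ⟨A, c, hA, hc, H⟩ := rdf' hr
  refine ⟨8*A^2, (c^((p-2)/p))^(p/2), FI, FI, ?_⟩
  intro n₁ n₂ L₁ L₂ h1 h2 D b F G mF mG hb hF iF HG
  have key : ∀ (h : RR → EE) (b' : EE), Measurable h → b' ≠ ⊤ → (∀ z, h z ≤ b') → (∀ z, h z ≤ G z) → ∫⁻ z, h z^p ≠ ⊤ →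
      ∫⁻ z, h z^p ≤ (c^((p-2)/p))^(p/2) * D^(p/2) * ∫⁻ z, F z^p := by
    intro h b' mh hb' hhb hhG hi
    by_cases hX : ∫⁻ z, h z^p = 0
    · rw [hX]; exact zero_le
    have e1 : ∀ z, (h z^(p-2))^(p/(p-2)) = h z^p := fun z => by rw [← rmq, mul_div_cancel₀ _ hp0.ne']
    obtain ⟨W, mW, hW, iW, s1, s2⟩ := H n₁ n₂ L₁ L₂ h1 h2 (fun z => h z^(p-2)) (b'^(p-2)) (∫⁻ z, h z^p) (mh.pow_const _) FI
      (fun z => rlr (hhb z) hp0.le) hX hi (by simp_rw [e1]; exact le_rfl)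
    have h3 := HG W (fun z => W z^(-HH⁻¹)) ⟨mW, fun y => (s1 y).gw_pos NM NM, fun x => (s2 x).gw_pos NM NM⟩
    have h4 : ∫⁻ z, h z^p ≤ ∫⁻ z, G z^2 * W z := by
      refine lmq fun z => ?_
      calc h z^p = h z^2 * h z^(p-2) := by
            rw [← rnz, ← ENNReal.rpow_add_of_nonneg _ _ NM hp0.le]; congr 1; push_cast; ring
        _ ≤ _ := mlmz (plpq (hhG z) 2) (hW z)
    have h5 : ∫⁻ z, F z^2 * W z ≤ (∫⁻ z, F z^p)^(2/p) * (∫⁻ z, W z^(p/(p-2)))^((p-2)/p) := by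
      have := lmn (μ := volume) (f := fun z => F z^p) (g := fun z => W z^(p/(p-2))) (mF.pow_const p).aemeasurable (mW.pow_const _).aemeasurable (p := 2/p) (q := (p-2)/p) PZ PZ (by field_simp; ring)
      refine ltz (loe ?_) this
      congr 1; ext z
      rw [← rmq, ← rmq, mul_div_cancel₀ _ hpp.ne', show p/(p-2)*((p-2)/p) = 1 by field_simp, roq, ← rnz]; rfl
    set X := ∫⁻ z, h z^p
    set Y := ∫⁻ z, F z^p
    have h6 : X ≤ D * Y^(2/p) * c^((p-2)/p) * X^((p-2)/p) := by
      refine h4.trans (h3.trans ?_)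
      rw [maq, maq]
      refine mlm (h5.trans (mlm ?_ _)) _
      rw [← mro _ _ PZ]
      exact rlr iW PZ
    have h7 : X^(2/p) ≤ D * Y^(2/p) * c^((p-2)/p) := by
      have : X^(2/p) * X^((p-2)/p) = X := by
        rw [← raq _ _ hX hi, show 2/p+(p-2)/p = 1 by field_simp; ring, roq]
      exact (ENNReal.mul_le_mul_iff_left (by simp [hX, hi]) FI).1 (this.le.trans h6)
    have h8 := rlr h7 (z := p/2) PZ
    rw [← rmq, show 2/p*(p/2) = 1 by field_simp, roq, mro _ _ PZ, mro _ _ PZ, ← rmq, show 2/p*(p/2) = 1 by field_simp, roq] at h8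
    refine h8.trans_eq RG
  have ms : ∀ N : ℕ, MeasurableSet (Metric.closedBall (0:ℝ×ℝ) N) := fun N => Metric.isClosed_closedBall.measurableSet
  have mh : ∀ N : ℕ, Measurable (fun z => (Metric.closedBall (0:ℝ×ℝ) N).indicator (fun z => min (G z) N) z) := fun N => (mG.min mcq).indicator (ms N)
  have hl : ∫⁻ z, G z^p ≤ liminf (fun N : ℕ => ∫⁻ z, ((Metric.closedBall (0:ℝ×ℝ) N).indicator (fun z => min (G z) N) z)^p) atTop := by
    refine ltz (lmq fun z => ?_) (lintegral_liminf_le fun N => (mh N).pow_const p)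
    refine loe (Tendsto.liminf_eq ?_).symm
    refine ((ENNReal.continuous_rpow_const (y := p)).tendsto _).comp ?_
    have t1 : Tendsto (fun N : ℕ => min (G z) (N:EE)) atTop (𝓝 (min (G z) ⊤)) := tendsto_const_nhds.min ENNReal.tendsto_nat_nhds_top
    rw [min_eq_left le_top] at t1
    refine t1.congr' ?_
    obtain ⟨N0, hN0⟩ := exists_nat_ge ‖z‖
    filter_upwards [eventually_ge_atTop N0] with N hN
    rw [iom]
    rw [mem_closedBall_zero_iff]
    exact hN0.trans (by exact_mod_cast hN)
  refine hl.trans (liminf_le_of_le (by isBoundedDefault) fun a ha => ?_)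
  obtain ⟨N, hN⟩ := ha.exists
  refine hN.trans (key _ N (mh N) FI (fun z => ?_) (fun z => ?_) ?_)
  · exact Set.indicator_le (fun _ _ => min_le_right _ _) z |>.trans le_rfl
  · exact (Set.indicator_le_self' (fun _ _ => zero_le) z).trans (min_le_left _ _)
  · refine ne_top_of_le_ne_top (b := (N:EE)^p * volume (Metric.closedBall (0:ℝ×ℝ) N)) (mnt FI measure_closedBall_lt_top.ne) ?_
    rw [← scz, ← liq (ms N)]
    refine lmq fun z => ?_
    by_cases hz : z ∈ Metric.closedBall (0:ℝ×ℝ) N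
    · simp only [iom hz]; exact rlr (min_le_right _ _) hpp.le
    · simp [ion hz, hpp]
lemma extrap_lt (hp : 1 < p) (hp2 : p < 2) : ∃ C K : EE, C ≠ ⊤ ∧ K ≠ ⊤ ∧ ExtrapAt p (1/p) C K := by
  have h2 : 0 < 2 - p := LI
  have hpp : 0 < p := LI
  have hr : 1 < 1/(2-p) := by rw [lt_div_iff₀ h2]; linarith
  obtain ⟨A, c, hA, hc, H⟩ := rdf' hr
  refine ⟨8*A^2, c^(1-p/2), FI, rnt LI hc, ?_⟩
  intro n₁ n₂ L₁ L₂ h1 h2' D b F G mF mG hb hF iF HG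
  set X := ∫⁻ z, F z^p with hXd
  set Y := if X = 0 then 1 else X with hY
  have hY0 : Y ≠ 0 := by rw [hY]; split_ifs with h; exacts [one_ne_zero, h]
  have hYt : Y ≠ ⊤ := by rw [hY]; split_ifs with h; exacts [by simp, iF]
  have hXY : X ≤ Y := by rw [hY]; split_ifs with h; exacts [by simp [h], le_rfl]
  obtain ⟨W, mW, hW, iW, s1, s2⟩ := H n₁ n₂ L₁ L₂ h1 h2' (fun z => F z^((2-p)*p)) (b^((2-p)*p)) Y (mF.pow_const _) FI
      (fun z => rlr (hF z) PZ) hY0 hYt (by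
        refine ltz (loe ?_) hXY
        congr 1; ext z; rw [← rmq]; congr 1; field_simp)
  have hW0 : ∀ z, W z ≠ 0 := fun z => (s1 z.2).pos z.1
  have hWt : ∀ z, W z ≠ ⊤ := fun z => (s1 z.2).fin z.1
  have t0 : 0 < 1/p := PZ
  have t1 : 1/p < 1 := by rw [div_lt_one hpp]; exact hp
  have mV : Measurable (fun z => W z^(-(1/p))) := mW.pow_const _
  have h3 := HG (fun z => W z^(-(1/p))) W ⟨mV, fun y => (s1 y).gw_neg t0 t1, fun x => (s2 x).gw_neg t0 t1⟩
  have h4 : ∫⁻ z, F z^2 * W z^(-(1/p)) ≤ X := by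
    refine lmq fun z => ?_
    by_cases h0 : F z = 0
    · simp [h0]
    have ht : F z ≠ ⊤ := nto hb (hF z)
    calc _ ≤ F z^2 * (F z^((2-p)*p))^(-(1/p)) := by
          refine mlm ?_ _
          rw [rnw, rnw]
          exact ENNReal.inv_le_inv.2 (rlr (hW z) t0.le)
      _ = _ := by
          rw [← rmq, ← rnz, ← raq _ _ h0 ht]; congr 1; push_cast; field_simp; ring
  have h5 := lmn (μ := volume) (f := fun z => G z^2 * W z^(-(1/p))) (g := fun z => W z^(1/(2-p))) ((mG.pow_const 2).mul mV).aemeasurable (mW.pow_const _).aemeasurable (p := p/2) (q := 1-p/2) PZ LI RG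
  have e : ∀ z, (G z^2 * W z^(-(1/p)))^(p/2) * (W z^(1/(2-p)))^(1-p/2) = G z^p := fun z => by
    rw [mro _ _ PZ, maq, ← rmq, ← rmq, ← raq _ _ (hW0 z) (hWt z), ← rnz, ← rmq]
    rw [show -(1/p)*(p/2) + 1/(2-p)*(1-p/2) = 0 by field_simp; ring, ENNReal.rpow_zero, mul_one]; congr 1; push_cast; ring
  simp_rw [e] at h5
  refine h5.trans ?_
  calc _ ≤ (D * X)^(p/2) * (c * Y)^(1-p/2) := mlmz (rlr (h3.trans (mlm h4 _)) PZ) (rlr iW LI)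
    _ = c^(1-p/2) * D^(p/2) * (X^(p/2) * Y^(1-p/2)) := by
        rw [mro _ _ PZ, mro _ _ LI]; ring
    _ = _ := by
        congr 1
        by_cases h0 : X = 0
        · rw [h0, zro PZ, zero_mul]
        · rw [hY, if_neg h0, ← raq _ _ h0 iF, add_sub_cancel, roq]
theorem extrap (hp : 1 < p) : ∃ (θ : ℝ) (C K : EE), 0 < θ ∧ θ < 1 ∧ C ≠ ⊤ ∧ K ≠ ⊤ ∧ ExtrapAt p θ C K := by
  rcases lt_trichotomy p 2 with h | rfl | h
  · obtain ⟨C, K, hC, hK, H⟩ := extrap_lt hp h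
    exact ⟨1/p, C, K, PZ, by rw [div_lt_one LI]; exact hp, hC, hK, H⟩
  · exact ⟨_, _, _, NM, NM, NM, NM, extrap_two⟩
  · obtain ⟨C, K, hC, hK, H⟩ := extrap_gt h
    exact ⟨1/2, C, K, NM, NM, hC, hK, H⟩
end
section
variable {n : ℕ} {a q r x y : ℝ} {g : ℝ → EE}

namespace Grid
variable (G : Grid)
lemma meas_of_idx {k : ℤ} (h : ∀ x y, G.idx k x = G.idx k y → g x = g y) : Measurable g := by
  have : g = Function.extend (G.idx k) g 0 ∘ G.idx k := by
    ext x; exact (Function.FactorsThrough.extend_apply (fun a b hab => h a b hab) 0 x).symm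
  rw [this]
  exact (measurable_of_countable _).comp (G.measurable_idx k)
lemma doob (hr : 1 < r) (hg : Measurable g) :
    ∫⁻ x, (⨆ j : ℤ, G.av j g x)^r ≤ (4^r * geoC (r-1)) * ∫⁻ x, g x^r := by
  have := G.MV_bound hr (V := fun _ => 1) mcq hg (by simp [av_one]) (by simp [av_one])
  simpa [MV, av_one] using this
def Adp (K : ℤ) {H : Type} [NormedAddCommGroup H] (e : ℕ → ℝ → H) : Prop :=
  (∀ (n : ℕ) x y, G.idx (K-n) x = G.idx (K-n) y → e n x = e n y) ∧ ∀ (n : ℕ) x, e n (G.sib (K-n) x) = - e n x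
section
variable {G} {K : ℤ} {H : Type} [NormedAddCommGroup H] [InnerProductSpace ℂ H] {e : ℕ → ℝ → H} (he : G.Adp K e)
include he
lemma Adp.cell {i : ℕ} (hi : i < n) (h : G.idx (K-n+1) x = G.idx (K-n+1) y) : e i x = e i y :=
  he.1 _ _ _ (G.idx_mono OM h)
lemma Adp.psum (h : G.idx (K-n+1) x = G.idx (K-n+1) y) :
    ∑ i ∈ rnq n, e i x = ∑ i ∈ rnq n, e i y :=
  scq rfl fun i hi => he.cell (mrq.1 hi) h
lemma Adp.nrm (n : ℕ) (h : G.idx (K-n+1) x = G.idx (K-n+1) y) : ‖e n x‖ = ‖e n y‖ := by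
  rcases (G.idx_succ_iff _ _ _).1 h with h | h
  · rw [he.1 n _ _ h]
  · rw [he.1 n _ _ h, he.2, norm_neg]
lemma Adp.orth (N : ℕ) : ∫⁻ x, ‖∑ i ∈ rnq N, e i x‖ₑ^2 = ∑ i ∈ rnq N, ∫⁻ x, ‖e i x‖ₑ^2 := by
  induction N with
  | zero => simp
  | succ n ih =>
    have m1 : ∀ s : ℂ, Measurable fun x => ‖(∑ i ∈ rnq n, e i x) + s • e n x‖ₑ^2 := fun s =>
      G.meas_of_idx (k := K-n) fun x y h => by
        rw [he.1 n x y h, he.psum (G.idx_mono OM h)]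
    have m2 : Measurable fun x => ‖e n x‖ₑ^2 := G.meas_of_idx (k := K-n) fun x y h => by rw [he.1 n x y h]
    have m3 : Measurable fun x => ‖∑ i ∈ rnq n, e i x‖ₑ^2 := G.meas_of_idx (k := K-n+1) fun x y h => by rw [he.psum h]
    rw [srs, ← ih]
    simp_rw [srs]
    have s1 : ∫⁻ x, ‖(∑ i ∈ rnq n, e i x) + e n x‖ₑ^2 = ∫⁻ x, ‖(∑ i ∈ rnq n, e i x) - e n x‖ₑ^2 := by
      have h1 := m1 1
      simp only [one_smul] at h1
      rw [← G.lintegral_sib (K-n) h1]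
      congr 1; ext x
      rw [he.2, he.psum (G.idx_succ_sib (K-n) x), sub_eq_add_neg]
    have s2 : (∫⁻ x, ‖(∑ i ∈ rnq n, e i x) + e n x‖ₑ^2) + ∫⁻ x, ‖(∑ i ∈ rnq n, e i x) - e n x‖ₑ^2
        = 2 * ((∫⁻ x, ‖∑ i ∈ rnq n, e i x‖ₑ^2) + ∫⁻ x, ‖e n x‖ₑ^2) := by
      have h1 := m1 1
      simp only [one_smul] at h1
      rw [← lal h1, ← lal m3, ← lcmq _ _ SI]
      congr 1; ext x
      have := parallelogram_law_with_norm ℂ (∑ i ∈ rnq n, e i x) (e n x)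
      simp only [← onq, ← opq (nnq _)]
      rw [← oaq PZ PZ, ← oaq PZ PZ, show (2:EE) = ofq 2 by simp, ← omq NM]
      congr 1
    rw [← s1, ← two_mul] at s2
    exact (ENNReal.mul_right_inj SI SI).1 s2
lemma Adp.le_av {N : ℕ} (hn : n ≤ N) (x : ℝ) :
    ‖∑ i ∈ rnq n, e i x‖ₑ ≤ G.av (K-n+1) (fun y => ‖∑ i ∈ rnq N, e i y‖ₑ) x := by
  induction hn using Nat.decreasingInduction generalizing x with
  | self => exact G.le_av_of (G.meas_of_idx (k := K-N+1) fun x y h => by rw [he.psum h]) fun y h => by rw [he.psum h]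
  | of_succ n hn ih =>
    have h1 := ih x
    have h2 := ih (G.sib (K-n) x)
    rw [show K - ((n+1 : ℕ):ℤ) + 1 = K - n by push_cast; ring, srs] at h1 h2
    rw [he.2, he.psum (G.idx_succ_sib (K-n) x)] at h2
    rw [G.av_succ, ldiq SI SI, mcz, ← ENNReal.coe_ofNat]
    refine ltz ?_ (ala h1 h2)
    refine ltz (loe ?_) (enorm_add_le _ _)
    rw [add_add_add_comm, add_neg_cancel, add_zero, ← two_smul ℂ, enorm_smul]
    congr 1; simp [← onq]
lemma Adp.max_le (N : ℕ) (hr : 1 < r) :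
    ∃ M : ℝ → EE, Measurable M ∧ (∀ x, ∀ n ≤ N, ‖∑ i ∈ rnq n, e i x‖ₑ ≤ M x) ∧
      ∫⁻ x, M x^r ≤ (4^r * geoC (r-1)) * ∫⁻ x, ‖∑ i ∈ rnq N, e i x‖ₑ^r := by
  have m : Measurable (fun y => ‖∑ i ∈ rnq N, e i y‖ₑ) := G.meas_of_idx (k := K-N+1) fun x y h => by rw [he.psum h]
  exact ⟨_, Measurable.iSup fun j => G.measurable_av j m, fun x n hn => (he.le_av hn x).trans (le_iSup (fun j => G.av j _ x) _), G.doob hr m⟩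
end
lemma sum_conc (ha : 0 < a) (ha1 : a ≤ 1) (d : ℕ → ℝ) (hd : ∀ i, 0 ≤ d i) (N : ℕ) :
    ∑ i ∈ rnq N, (∑ j ∈ rnq (i+1), d j)^(a-1) * d i ≤ a⁻¹ * (∑ j ∈ rnq N, d j)^a := by
  induction N with
  | zero => simp [ha.ne']
  | succ n ih =>
    rw [srs]
    refine (ala ih le_rfl).trans ?_
    set S := ∑ j ∈ rnq n, d j with hS
    have hS0 : 0 ≤ S := Finset.sum_nonneg fun i _ => hd i
    rw [srs, ← hS]
    rcases (add_nonneg hS0 (hd n)).eq_or_lt with h | h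
    · have : d n = 0 := by linarith [hd n]
      simp [this]
    have h1 := rpow_one_add_le_one_add_mul_self (s := - d n/(S + d n)) (by rw [neg_div, neg_le_neg_iff, div_le_one h]; linarith) ha.le ha1
    have h2 : 1 + -d n/(S+d n) = S/(S+d n) := by field_simp; ring
    rw [h2, Real.div_rpow hS0 h.le, div_le_iff₀ PZ] at h1
    have h3 : (S+d n)^(a-1) = (S+d n)^a / (S+d n) := by rw [Real.rpow_sub h, Real.rpow_one]
    rw [h3]
    have : a⁻¹ * S^a ≤ a⁻¹ * ((1 + a * (-d n/(S+d n))) * (S+d n)^a) := by gcongr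
    refine (ala this le_rfl).trans_eq ?_
    field_simp; ring
lemma abel {H : Type} [NormedAddCommGroup H] [InnerProductSpace ℂ H] (e g : ℕ → H) (β : ℕ → ℝ) (hβ : ∀ n, β n ≤ β (n+1)) (h0 : 0 ≤ β 0) (N : ℕ)
    (h : ∀ n, e n = (β (n+1) : ℂ) • g n) (M : ℝ) (hM : ∀ n ≤ N, ‖∑ i ∈ rnq n, g i‖ ≤ M) :
    ‖∑ i ∈ rnq N, e i‖ ≤ 2 * β N * M := by
  have hb : ∀ n, 0 ≤ β n := fun n => by induction n with
    | zero => exact h0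
    | succ n ih => exact ih.trans (hβ n)
  have hM0 : 0 ≤ M := (nnq _).trans (hM 0 OM)
  have key : ∀ n ≤ N, ‖∑ i ∈ rnq n, e i - (β n : ℂ) • ∑ i ∈ rnq n, g i‖ ≤ β n * M := by
    intro n
    induction n with
    | zero => intro _; simpa using mul_nonneg h0 hM0
    | succ n ih =>
      intro hn
      have : ∑ i ∈ rnq (n+1), e i - (β (n+1) : ℂ) • ∑ i ∈ rnq (n+1), g i =
          (∑ i ∈ rnq n, e i - (β n : ℂ) • ∑ i ∈ rnq n, g i) - ((β (n+1) - β n : ℝ) : ℂ) • ∑ i ∈ rnq n, g i := by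
        rw [srs, srs, h n]; push_cast; module
      rw [this]
      refine (norm_sub_le _ _).trans ?_
      rw [norm_smul, nrq, non (by linarith [hβ n])]
      have := mlmw (hM n OM) (sub_nonneg.2 (hβ n))
      linarith [ih OM]
  have h1 := norm_le_insert' (∑ i ∈ rnq N, e i) ((β N : ℂ) • ∑ i ∈ rnq N, g i)
  rw [norm_smul, nrq, non (hb N)] at h1
  have := mlmw (hM N le_rfl) (hb N)
  linarith [key N le_rfl]
def Syn (q : ℝ) (C : EE) : Prop := ∀ (G : Grid) (K : ℤ) (H : Type) [NormedAddCommGroup H] [InnerProductSpace ℂ H] (e : ℕ → ℝ → H) (N : ℕ), G.Adp K e →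
  ∫⁻ x, ‖∑ i ∈ rnq N, e i x‖ₑ^q ≤ C * ∫⁻ x, (∑ i ∈ rnq N, ‖e i x‖ₑ^2)^(q/2)
lemma syn_le (ha : 0 < a) (ha1 : a ≤ 1) : ∃ C : EE, C ≠ ⊤ ∧ Syn (2*a) C := by
  have hg := geoC_ne_top (s := 2-1) NM
  refine ⟨2^(2*a) * (4^TT * geoC (2-1) * ofq a⁻¹)^a, FI, ?_⟩
  intro G K H _ _ e N he
  set S : ℕ → ℝ → ℝ := fun n x => ∑ i ∈ rnq n, ‖e i x‖^2 with hS
  have S0 : ∀ n x, 0 ≤ S n x := fun n x => Finset.sum_nonneg fun i _ => PZ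
  have Sc : ∀ (n:ℕ) x y, G.idx (K-n+1) x = G.idx (K-n+1) y → S n x = S n y := fun n x y h =>
    scq rfl fun i hi => by rw [he.cell (mrq.1 hi) h]
  have Sc' : ∀ (n:ℕ) x y, G.idx (K-n+1) x = G.idx (K-n+1) y → S (n+1) x = S (n+1) y := fun n x y h => by
    simp only [hS, srs]; rw [he.nrm n h]; congr 1; exact Sc n x y h
  set g : ℕ → ℝ → H := fun n x => ((S (n+1) x^((a-1)/2) : ℝ) : ℂ) • e n x with hgd
  have hg' : G.Adp K g := ⟨fun n x y h => by
      simp only [hgd]; rw [he.1 n x y h, Sc' n x y (G.idx_mono OM h)], fun n x => by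
      simp only [hgd]; rw [he.2, Sc' n _ _ (G.idx_succ_sib (K-n) x), smul_neg]⟩
  obtain ⟨M, mM, hM, iM⟩ := hg'.max_le N (r := 2) NM
  have mS : Measurable fun x => ofq (S N x)^a := G.meas_of_idx (k := K-N+1) fun x y h => by rw [Sc N x y h]
  have eS : ∀ x, ∑ i ∈ rnq N, ‖e i x‖ₑ^2 = ofq (S N x) := fun x => by
    rw [hS, oso fun i _ => PZ]; simp [opq]
  have p1 : ∀ x, ‖∑ i ∈ rnq N, e i x‖ₑ ≤ 2 * ofq (S N x)^((1-a)/2) * M x := by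
    intro x
    obtain ⟨i, hi, hmax⟩ := Finset.exists_max_image (rnq (N+1)) (fun n => ‖∑ i ∈ rnq n, g i x‖) ⟨0, SI⟩
    have ab := abel (fun n => e n x) (fun n => g n x) (fun n => S n x^((1-a)/2)) (fun n => Real.rpow_le_rpow (S0 _ _) (by simp only [hS, srs]; linarith [sq_nonneg ‖e n x‖]) LI)
      (Real.rpow_nonneg (S0 _ _) _) N (fun n => by
        simp only [hgd]
        rcases (S0 (n+1) x).eq_or_lt with h | h
        · have : ‖e n x‖^2 = 0 := by
            have h1 := S0 n x
            simp only [hS, srs] at h h1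
            nlinarith [sq_nonneg ‖e n x‖]
          have : e n x = 0 := by simpa using this
          simp [this]
        · rw [smul_smul, ← Complex.ofReal_mul, ← Real.rpow_add h]; ring_nf; simp) _ (fun n hn => hmax n (mrq.2 OM))
    have := olo ab
    rw [onq, omq (by have := S0 N x; positivity), omq NM, onq, ← ENNReal.ofReal_rpow_of_nonneg (S0 N x) LI] at this
    refine this.trans ?_
    rw [show ofq 2 = 2 by simp]
    exact mlm (hM x i (by simpa [Nat.lt_succ_iff] using hi)) _
  have i2 : ∫⁻ x, M x^TT ≤ (4^TT * geoC (2-1) * ofq a⁻¹) * ∫⁻ x, ofq (S N x)^a := by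
    refine iM.trans ?_
    rw [maq _ (ofq a⁻¹)]
    refine mlm ?_ _
    simp_rw [rtq]
    rw [hg'.orth, ← lintegral_finsetSum _ (fun (i:ℕ) _ => G.meas_of_idx (k := K-i) fun x y h => by rw [hg'.1 i x y h]), ← lcmq _ _ SI]
    refine lmq fun x => ?_
    have := olo (sum_conc ha ha1 (fun i => ‖e i x‖^2) (fun i => PZ) N)
    rw [oso fun i _ => mul_nonneg (Real.rpow_nonneg (S0 _ _) _) PZ, omq PZ, ← ENNReal.ofReal_rpow_of_nonneg (S0 N x) ha.le] at this
    refine ltz (loe (scq rfl fun i _ => ?_)) this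
    rw [← onq, ← opq (nnq _)]
    congr 1
    simp only [hgd]
    rw [norm_smul, nrq, non (Real.rpow_nonneg (S0 _ _) _), mul_pow, ← Real.rpow_natCast, ← Real.rpow_mul (S0 _ _)]
    congr 2; push_cast; ring
  simp_rw [eS]
  calc _ ≤ ∫⁻ x, 2^(2*a) * ((M x^TT)^a * (ofq (S N x)^a)^(1-a)) := by
        refine lmq fun x => (rlr (p1 x) PZ).trans_eq ?_
        rw [mro _ _ PZ, mro _ _ PZ, ← rmq, ← rmq, ← rmq, maq, mcz (_^((1-a)/2*(2*a)))]
        congr 3; ring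
    _ = 2^(2*a) * ∫⁻ x, ((M x^TT)^a * (ofq (S N x)^a)^(1-a)) := lcmq _ _ FI
    _ ≤ 2^(2*a) * ((∫⁻ x, M x^TT)^a * (∫⁻ x, ofq (S N x)^a)^(1-a)) :=
        mlm (lmn (mM.pow_const _).aemeasurable mS.aemeasurable ha.le LI RG) _
    _ ≤ 2^(2*a) * (((4^TT * geoC (2-1) * ofq a⁻¹) * ∫⁻ x, ofq (S N x)^a)^a * (∫⁻ x, ofq (S N x)^a)^(1-a)) := by
        gcongr
    _ = 2^(2*a) * (4^TT * geoC (2-1) * ofq a⁻¹)^a * ∫⁻ x, ofq (S N x)^a := by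
        rw [mro _ _ ha.le, maq (_^a) (_^a), maq (2^(2*a)), ← ENNReal.rpow_add_of_nonneg _ _ ha.le LI, add_sub_cancel, roq]
    _ = _ := by rw [show 2*a/2 = a by ring]
lemma absorb {A X Y : EE} (hX : X ≠ ⊤) (h : X ≤ A * (Y + (X*Y)^HH)) : X ≤ (1 + (2*A)^TT) * Y := by
  rcases le_total X Y with h1 | h1
  · exact h1.trans (le_mul_of_one_le_left' le_self_add)
  rcases eq_or_ne X 0 with rfl | h0
  · simp
  have h2 : Y ≤ (X*Y)^HH := by
    calc Y = (Y*Y)^HH := by rw [← sq, ← rnz, ← rmq]; norm_num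
      _ ≤ _ := rlr (mlmq h1 _) NM
  have h3 : X ≤ 2 * A * (X*Y)^HH := by
    refine h.trans ((mlm (ala h2 le_rfl) _).trans (loe RG))
  have h4 : X^TT ≤ (2*A)^TT * (X*Y) := by
    refine (rlr h3 (by norm_num : (0:ℝ) ≤ 2)).trans_eq ?_
    rw [mro _ _ NM, ← rmq (X*Y)]; norm_num
  rw [show (2*A)^TT * (X*Y) = X * ((2*A)^TT * Y) by ring, rtq, sq, ENNReal.mul_le_mul_iff_right h0 hX] at h4
  exact h4.trans (mlmq le_add_self _)
lemma syn_double (hq : 1 < 2*q) {C : EE} (hC : C ≠ ⊤) (h : Syn q C) : ∃ C : EE, C ≠ ⊤ ∧ Syn (2*q) C := by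
  have hg := geoC_ne_top (s := 2*q-1) LI
  have q0 : 0 < q := LI
  set Dd : EE := 4^(2*q) * geoC (2*q-1) with hD
  set A : EE := 2^q * (1 + C * (2^q * Dd^HH)) with hA
  have hD' : Dd ≠ ⊤ := FI
  have hA' : A ≠ ⊤ := FI
  refine ⟨1 + (2*A)^TT, FI, ?_⟩
  intro G K H _ _ e N he
  rw [show 2*q/2 = q by ring]
  set S : ℝ → EE := fun x => ∑ i ∈ rnq N, ‖e i x‖ₑ^2 with hS
  set Y := ∫⁻ x, S x^q with hY
  set X := ∫⁻ x, ‖∑ i ∈ rnq N, e i x‖ₑ^(2*q) with hX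
  obtain ⟨M, mM, hM, iM⟩ := he.max_le N hq
  have mS : Measurable S := G.meas_of_idx (k := K-N+1) fun x y h =>
    scq rfl fun i hi => by rw [he.cell (mrq.1 hi) h]
  have X1 : X ≤ (N:EE)^q * Y := by
    rw [hY, ← lcmq _ _ FI]
    refine lmq fun x => ?_
    rw [rmq, ← mro _ _ q0.le]
    refine rlr ?_ q0.le
    have h1 : ‖∑ i ∈ rnq N, e i x‖^2 ≤ N * ∑ i ∈ rnq N, ‖e i x‖^2 := by
      refine (pow_le_pow_left₀ (nnq _) (norm_sum_le _ _) 2).trans ?_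
      simpa using sq_sum_le_card_mul_sum_sq (s := rnq N) (f := fun i => ‖e i x‖)
    have h2 := olo h1
    rw [omq PZ, oso fun i _ => PZ] at h2
    simpa [opq, hS] using h2
  rcases eq_or_ne Y ⊤ with hYt | hYt
  · rw [hYt, mtq PZ]; exact le_top
  refine absorb (nto FI X1) ?_
  set ε : ℕ → ℝ → ℂ := fun n x => ((2 * (inner ℂ (∑ i ∈ rnq n, e i x) (e n x)).re : ℝ) : ℂ) with hε
  have hεA : G.Adp K ε := ⟨fun n x y h => by
      simp only [hε]; rw [he.1 n x y h, he.psum (G.idx_mono OM h)], fun n x => by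
      simp only [hε]; rw [he.2, he.psum (G.idx_succ_sib (K-n) x), inner_neg_right, Complex.neg_re, mul_neg, Complex.ofReal_neg]⟩
  have id1 : ∀ x, ∀ n : ℕ, ((‖∑ i ∈ rnq n, e i x‖^2 : ℝ) : ℂ) = ((∑ i ∈ rnq n, ‖e i x‖^2 : ℝ) : ℂ) + ∑ i ∈ rnq n, ε i x := by
    intro x n
    induction n with
    | zero => simp
    | succ n ih =>
      rw [srs, norm_add_sq (𝕜 := ℂ), srs, srs]
      push_cast at ih ⊢
      rw [ih]; simp only [hε, RCLike.re_eq_complex_re]; push_cast; ring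
  have p1 : ∀ x, ‖∑ i ∈ rnq N, e i x‖ₑ^(2*q) ≤ 2^q * (S x^q + ‖∑ i ∈ rnq N, ε i x‖ₑ^q) := by
    intro x
    have h1 : ‖∑ i ∈ rnq N, e i x‖ₑ^2 ≤ S x + ‖∑ i ∈ rnq N, ε i x‖ₑ := by
      have h2 := enorm_add_le ((∑ i ∈ rnq N, ‖e i x‖^2 : ℝ) : ℂ) (∑ i ∈ rnq N, ε i x)
      rw [← id1] at h2
      rw [← onq, ← onq, nrq, nrq, non PZ, non PZ, oso fun i _ => PZ] at h2
      simpa [opq, hS] using h2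
    rw [rmq, rtq]
    refine (rlr h1 q0.le).trans ?_
    rcases le_total (S x) (‖∑ i ∈ rnq N, ε i x‖ₑ) with h3 | h3
    · refine (rlr ((ala h3 le_rfl).trans (two_mul _).ge) q0.le).trans ?_
      rw [mro _ _ q0.le]
      exact mlm le_add_self _
    · refine (rlr ((ala le_rfl h3).trans (two_mul _).ge) q0.le).trans ?_
      rw [mro _ _ q0.le]
      exact mlm le_self_add _
  have p2 : ∀ x, (∑ i ∈ rnq N, ‖ε i x‖ₑ^2)^(q/2) ≤ 2^q * ((M x^(2*q))^HH * (S x^q)^HH) := by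
    intro x
    have h1 : ∑ i ∈ rnq N, ‖ε i x‖ₑ^2 ≤ (2 * M x)^2 * S x := by
      rw [hS, msq]
      refine sls fun i hi => ?_
      rw [← mul_pow]
      refine plpq ?_ 2
      refine ltz ?_ (mlmq (mlm (hM x i (mrq.1 hi).le) 2) _)
      rw [← onq, ← onq, ← onq, show (2:EE) = ofq 2 by simp, ← omq NM, ← omq PZ]
      refine olo ?_
      rw [hε, nrq, norm_mul, Real.norm_ofNat, maq]
      exact mlmw ((Complex.abs_re_le_norm _).trans (norm_inner_le_norm _ _)) NM
    refine (rlr h1 PZ).trans_eq ?_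
    rw [mro _ _ PZ, ← rtq, ← rmq, show 2*(q/2) = q by ring, mro _ _ q0.le, ← rmq, ← rmq, maq]
    congr 3 <;> ring
  have mS' : Measurable fun x => 2^q * S x^q := (mS.pow_const _).const_mul _
  have i3 : ∫⁻ x, (∑ i ∈ rnq N, ‖ε i x‖ₑ^2)^(q/2) ≤ 2^q * ((Dd*X)^HH * Y^HH) := by
    refine (lmq p2).trans ?_
    rw [lcmq _ _ FI]
    refine mlm ((lmn (mM.pow_const _).aemeasurable (mS.pow_const _).aemeasurable NM NM NM).trans ?_) _
    exact mlmq (rlr iM NM) _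
  calc X ≤ ∫⁻ x, (2^q * S x^q + 2^q * ‖∑ i ∈ rnq N, ε i x‖ₑ^q) := lmq fun x => by rw [← mul_add]; exact p1 x
    _ = 2^q * Y + 2^q * ∫⁻ x, ‖∑ i ∈ rnq N, ε i x‖ₑ^q := by
        rw [lal mS', lcmq _ _ FI, lcmq _ _ FI]
    _ ≤ 2^q * Y + 2^q * (C * (2^q * ((Dd*X)^HH * Y^HH))) := by
        refine ala le_rfl (mlm ((h G K ℂ ε N hεA).trans (mlm i3 _)) _)
    _ = 2^q * Y + 2^q * (C * (2^q * Dd^HH)) * (X*Y)^HH := by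
        rw [mro Dd _ NM, mro X _ NM]; ring
    _ ≤ A * Y + A * (X*Y)^HH := by
        refine ala (mlmq (lmoq le_self_add) _) (mlmq (mlm le_add_self _) _)
    _ = _ := by rw [mul_add]
theorem syn (hq : 0 < q) : ∃ C : EE, C ≠ ⊤ ∧ Syn q C := by
  have : ∀ n : ℕ, ∀ q : ℝ, 0 < q → q ≤ 2^(n+1) → ∃ C : EE, C ≠ ⊤ ∧ Syn q C := by
    intro n
    induction n with
    | zero => intro q h1 h2; simpa [mul_div_cancel₀] using syn_le (a := q/2) LI (by norm_num at h2; linarith)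
    | succ n ih =>
      intro q h1 h2
      rcases le_total q 2 with h3 | h3
      · simpa [mul_div_cancel₀] using syn_le (a := q/2) LI LI
      obtain ⟨C, hC, h⟩ := ih (q/2) LI (by rw [pow_succ] at h2; linarith)
      simpa [mul_div_cancel₀] using syn_double (q := q/2) LI hC h
  obtain ⟨n, hn⟩ := pow_unbounded_of_one_lt q (by norm_num : (1:ℝ) < 2)
  exact this n q hq (hn.le.trans (pow_le_pow_right₀ NM OM))
end Grid
end
section
variable {t : ℕ} {L a d w : ℝ} {φ ψ : ℝ → ℂ}

def cut (t : ℕ) (w : ℝ) : ℝ := if t = 0 then 0 else max 0 (min 1 (2 - w/2^(t-1)))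
def rho (t : ℕ) (w : ℝ) : ℝ := cut (t+1) w - cut t w
lemma cut_mem (t : ℕ) (w : ℝ) : 0 ≤ cut t w ∧ cut t w ≤ 1 := by
  unfold cut; split_ifs
  · simp
  · exact ⟨le_max_left _ _, max_le zero_le_one (min_le_left _ _)⟩
lemma cut_lip (t : ℕ) (w v : ℝ) : |cut t w - cut t v| ≤ |w - v| := by
  unfold cut; split_ifs
  · simp
  · have h : |(2 - w/2^(t-1)) - (2 - v/2^(t-1))| ≤ |w - v| := by
      rw [show (2 - w/2^(t-1)) - (2 - v/2^(t-1)) = -((w - v)/2^(t-1)) by ring, abs_neg, abs_div, aop (by positivity : (0:ℝ) < 2^(t-1))]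
      exact div_le_self (abs_nonneg _) (one_le_pow₀ NM)
    refine (abs_max_sub_max_le_max _ _ _ _).trans ?_
    refine max_le SI ((abs_min_sub_min_le_max _ _ _ _).trans (max_le SI h))
lemma rho_abs (t : ℕ) (w : ℝ) : |rho t w| ≤ 1 := by
  have := cut_mem t w; have := cut_mem (t+1) w
  rw [rho, abs_le]; constructor <;> linarith
lemma rho_lip (t : ℕ) (w v : ℝ) : |rho t w - rho t v| ≤ 2 * |w - v| := by
  rw [rho, rho, show cut (t+1) w - cut t w - (cut (t+1) v - cut t v) = (cut (t+1) w - cut (t+1) v) - (cut t w - cut t v) by ring]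
  linarith [abs_sub (cut (t+1) w - cut (t+1) v) (cut t w - cut t v), cut_lip t w v, cut_lip (t+1) w v]
lemma cut_one (h : w ≤ 2^t) : cut (t+1) w = 1 := by
  have : w/2^t ≤ 1 := (div_le_one PZ).2 h
  simp only [cut, Nat.add_eq_zero_iff, one_ne_zero, and_false, if_false, Nat.add_sub_cancel]
  rw [min_eq_left LI, max_eq_right zero_le_one]
lemma rho_supp (hw : 0 ≤ w) (h : rho t w ≠ 0) : 2^t ≤ 2*(1+w) ∧ w ≤ 2^(t+1) := by
  constructor
  · by_contra! hc
    cases t with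
    | zero => linarith
    | succ t => 
      rw [pow_succ] at hc
      exact h (by rw [rho, cut_one (by rw [pow_succ]; nlinarith [pow_pos (two_pos (α := ℝ)) t]), cut_one LI, sub_self])
  · by_contra! hc
    have h0 : ∀ s ≤ t+1, cut s w = 0 := fun s hs => by
      unfold cut; split_ifs with h1
      · rfl
      have : TT^(s-1) ≤ 2^t := pow_le_pow_right₀ NM OM
      have : 2 ≤ w/2^(s-1) := by rw [le_div_iff₀ PZ]; rw [pow_succ] at hc; linarith
      exact max_eq_left ((min_le_right _ _).trans LI)
    exact h (by rw [rho, h0 _ le_rfl, h0 _ OM, sub_self])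
lemma rho_sum (w : ℝ) : HasSum (fun t => rho t w) 1 := by
  obtain ⟨T, hT⟩ := pow_unbounded_of_one_lt w (by norm_num : (1:ℝ) < 2)
  have h : ∀ t ≥ T, cut (t+1) w = 1 := fun t ht => cut_one (hT.le.trans (pow_le_pow_right₀ NM ht))
  convert hasSum_sum_of_ne_finset_zero (s := rnq (T+1)) (f := fun t => rho t w) fun t ht => ?_
  · rw [show ∑ t ∈ rnq (T+1), rho t w = cut (T+1) w - cut 0 w from Finset.sum_range_sub (fun t => cut t w) _, h T le_rfl]; simp [cut]
  · have ht' : T < t := by simpa using ht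
    obtain ⟨s, rfl⟩ : ∃ s, t = s+1 := ⟨t-1, OM⟩
    rw [rho, h _ OM, h s OM, sub_self]
  · infer_instance
structure Piece (d a L : ℝ) (t : ℕ) (ψ : ℝ → ℂ) : Prop where
  bd : ∀ x, ‖ψ x‖ ≤ d
  lip : ∀ x y, ‖ψ x - ψ y‖ ≤ d * (|x-y|/L)
  sp : ∀ x, ψ x ≠ 0 → |x-a| ≤ 2^(t+1) * L
lemma Piece.cont (h : Piece d a L t ψ) : Continuous ψ := by
  refine (LipschitzWith.of_dist_le_mul (K := (d/L).toNNReal) fun x y => ?_).continuous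
  rw [dist_eq_norm, dist_eq_norm, nea]
  refine (h.lip x y).trans ?_
  rw [show d * (|x-y|/L) = d/L*|x-y| by ring]
  exact mlmv (Real.le_coe_toNNReal _) (abs_nonneg _)
lemma Piece.int (h : Piece d a L t ψ) (hL : 0 < L) :
    (∫⁻ x, ‖ψ x‖ₑ) ≤ ofq (d * (2^(t+2) * L)) := by
  have d0 : 0 ≤ d := (nnq _).trans (h.bd 0)
  have hr : (0:ℝ) ≤ 2^(t+1)*L := PZ
  calc (∫⁻ x, ‖ψ x‖ₑ) ≤ ∫⁻ x, (icz (a-2^(t+1)*L) (a+2^(t+1)*L)).indicator (fun _ => ofq d) x := by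
        refine lmq fun x => ?_
        by_cases hx : ψ x = 0
        · simp [hx]
        rw [iom (by have := abs_le.1 (h.sp x hx); constructor <;> linarith [this.1, this.2]), ← onq]
        exact olo (h.bd x)
    _ = _ := by
        rw [liq measurableSet_Icc, scz, Real.volume_Icc, ← omq d0]
        congr 1; rw [pow_succ 2 (t+1)]; ring
lemma Piece.intg (h : Piece d a L t ψ) (hL : 0 < L) : Integrable ψ :=
  ⟨h.cont.aestronglyMeasurable, (h.int hL).trans_lt ENNReal.ofReal_lt_top⟩
lemma Piece.sub {d' : ℝ} {s : ℕ} {ψ' : ℝ → ℂ} (h : Piece d a L t ψ) (h' : Piece d' a L s ψ') (hs : s ≤ t) (hL : 0 < L) (c : ℂ) :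
    Piece (d + ‖c‖*d') a L t (fun x => ψ x - c * ψ' x) := by
  refine ⟨fun x => (norm_sub_le _ _).trans (ala (h.bd x) ?_), fun x y => ?_, fun x hx => ?_⟩
  · rw [norm_mul]; exact mlmw (h'.bd x) (nnq _)
  · rw [show ψ x - c * ψ' x - (ψ y - c * ψ' y) = (ψ x - ψ y) - c * (ψ' x - ψ' y) by ring, add_mul, maq]
    refine (norm_sub_le _ _).trans (ala (h.lip x y) ?_)
    rw [norm_mul]; exact mlmw (h'.lip x y) (nnq _)
  · by_cases h1 : ψ x = 0
    · have h2 : ψ' x ≠ 0 := by rintro h2; simp [h1, h2] at hx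
      exact (h'.sp x h2).trans (mlmv (pow_le_pow_right₀ NM OM) hL.le)
    · exact h.sp x h1
lemma bump_dec {C : ℕ → ℝ} (hL : 0 < L) (h : IsBumpAdapted C a L φ) (M α : ℕ) (hα : α ≤ 5) (x : ℝ) :
    ‖iteratedDeriv α φ x‖ * L^α * (1 + |x-a|/L)^M ≤ 2^M * C M := by
  have h1 := h.2 α hα M x
  have h2 : |x-a| - L ≤ Metric.infDist x (icz a (a+L)) := by
    rw [Metric.le_infDist ⟨a, by simp [hL.le]⟩]
    intro y hy
    rw [Real.dist_eq]
    have := abs_sub_abs_le_abs_sub (x-a) (y-a)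
    rw [abs_of_nonneg (sub_nonneg.2 hy.1), show x-a-(y-a) = x-y by ring] at this
    linarith [hy.2]
  have h3 : 1 + |x-a|/L ≤ 2 * (1 + Metric.infDist x (icz a (a+L))/L) := by
    have h4 := dldq h2 hL.le
    rw [sub_div, div_self hL.ne'] at h4
    have : 0 ≤ Metric.infDist x (icz a (a+L))/L := div_nonneg Metric.infDist_nonneg hL.le
    linarith
  calc _ ≤ ‖iteratedDeriv α φ x‖ * L^α * (2 * (1 + Metric.infDist x (icz a (a+L))/L))^M := by gcongr
    _ = 2^M * (‖iteratedDeriv α φ x‖ * L^α * (1 + Metric.infDist x (icz a (a+L))/L)^M) := by rw [mul_pow]; ring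
    _ ≤ _ := by gcongr
lemma piece_rho {B : ℝ} {M : ℕ} (hL : 0 < L) (hd : Differentiable ℝ φ)
    (h0 : ∀ x, ‖φ x‖ * (1+|x-a|/L)^M ≤ B) (h1 : ∀ x, ‖deriv φ x‖ * L * (1+|x-a|/L)^M ≤ B) (t : ℕ) :
    Piece (3*2^M*2^M*B/2^(M*t)) a L t (fun x => (rho t (|x-a|/L) : ℂ) * φ x) := by
  have B0 : 0 ≤ B := ltz PZ (h0 0)
  have w0 : ∀ x, 0 ≤ |x-a|/L := fun x => PZ
  have key : ∀ x z, rho t (|x-a|/L) ≠ 0 → |x-z| ≤ L → TT^(M*t) ≤ 2^M*2^M * (1+|z-a|/L)^M := by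
    intro x z hx hz
    have h2 := (rho_supp (w0 x) hx).1
    have h3 : |x-a|/L ≤ |z-a|/L + 1 := by
      rw [div_le_iff₀ hL, add_mul, div_mul_cancel₀ _ hL.ne']
      linarith [abs_sub_le x z a]
    have h4 : TT^t ≤ 2*2*(1+|z-a|/L) := by linarith [w0 z]
    calc TT^(M*t) = (2^t)^M := by rw [mcz, pow_mul]
      _ ≤ (2*2*(1+|z-a|/L))^M := by gcongr
      _ = _ := by rw [mul_pow, mul_pow]
  have s1 : ∀ x z, rho t (|x-a|/L) ≠ 0 → |x-z| ≤ L → ‖φ z‖ ≤ 2^M*2^M*B/2^(M*t) := by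
    intro x z hx hz
    rw [le_div_iff₀ PZ]
    calc _ ≤ ‖φ z‖ * (2^M*2^M * (1+|z-a|/L)^M) := by gcongr; exact key x z hx hz
      _ = 2^M*2^M*(‖φ z‖ * (1+|z-a|/L)^M) := RG
      _ ≤ _ := by gcongr; exact h0 z
  have s2 : ∀ x z, rho t (|x-a|/L) ≠ 0 → |x-z| ≤ L → ‖deriv φ z‖ ≤ 2^M*2^M*B/2^(M*t)/L := by
    intro x z hx hz
    rw [le_div_iff₀ hL, le_div_iff₀ PZ]
    calc _ ≤ ‖deriv φ z‖ * L * (2^M*2^M * (1+|z-a|/L)^M) := by gcongr; exact key x z hx hz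
      _ = 2^M*2^M*(‖deriv φ z‖ * L * (1+|z-a|/L)^M) := RG
      _ ≤ _ := by gcongr; exact h1 z
  set b := 2^M*2^M*B/2^(M*t) with hb
  have b0 : 0 ≤ b := PZ
  have bd : ∀ x, ‖(rho t (|x-a|/L) : ℂ) * φ x‖ ≤ b := fun x => by
    by_cases hx : rho t (|x-a|/L) = 0
    · simp [hx, b0]
    rw [norm_mul, nrq]
    exact (mul_le_mul (rho_abs _ _) (s1 x x hx (by simp [hL.le])) (nnq _) zero_le_one).trans (one_mul b).le
  rw [show 3*2^M*2^M*B/2^(M*t) = 3*b by rw [hb]; ring]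
  have lipx : ∀ x y, |x-y| ≤ L → rho t (|x-a|/L) ≠ 0 → ‖(rho t (|x-a|/L) : ℂ) * φ x - (rho t (|y-a|/L) : ℂ) * φ y‖ ≤ 3*b*(|x-y|/L) := by
    intro x y hxy hx
    have m1 : ‖φ x - φ y‖ ≤ b/L*‖x-y‖ := by
      refine (convex_closedBall x L).norm_image_sub_le_of_norm_deriv_le (fun z _ => hd z) (fun z hz => s2 x z hx ?_) ?_ ?_
      · rwa [abs_sub_comm, ← Real.dist_eq]
      · rwa [Metric.mem_closedBall, Real.dist_eq, abs_sub_comm]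
      · simp [hL.le]
    have m2 : |rho t (|x-a|/L) - rho t (|y-a|/L)| ≤ 2*(|x-y|/L) := by
      refine (rho_lip _ _ _).trans (mlmw ?_ NM)
      rw [← sub_div, abs_div, aop hL]
      refine dldq ?_ hL.le
      have := abs_abs_sub_abs_le_abs_sub (x-a) (y-a)
      rwa [show x-a-(y-a) = x-y by ring] at this
    have e1 : (rho t (|x-a|/L) : ℂ) * φ x - (rho t (|y-a|/L) : ℂ) * φ y = ((rho t (|x-a|/L) - rho t (|y-a|/L) : ℝ) : ℂ) * φ x + (rho t (|y-a|/L) : ℂ) * (φ x - φ y) := by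
      push_cast; ring
    rw [e1]
    refine (norm_add_le _ _).trans ?_
    rw [norm_mul, norm_mul, nrq, nrq]
    have a1 := mul_le_mul m2 (s1 x x hx (by simp [hL.le])) (nnq _) PZ
    have a2 := mul_le_mul (rho_abs t (|y-a|/L)) m1 (nnq _) zero_le_one
    simp only [nea] at *
    calc _ ≤ _ := ala a1 a2
      _ = _ := RG
  refine ⟨fun x => (bd x).trans LI, fun x y => ?_, fun x hx => ?_⟩
  · rcases le_total |x-y| L with hxy | hxy
    · by_cases hx : rho t (|x-a|/L) = 0
      · by_cases hy : rho t (|y-a|/L) = 0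
        · simp only [hx, hy]; simp; positivity
        · rw [norm_sub_rev, abs_sub_comm x y]; exact lipx y x (by rwa [abs_sub_comm]) hy
      · exact lipx x y hxy hx
    · have : 1 ≤ |x-y|/L := (one_le_div hL).2 hxy
      refine (norm_sub_le _ _).trans ((ala (bd x) (bd y)).trans ?_)
      nlinarith
  · have : rho t (|x-a|/L) ≠ 0 := fun h => by simp [h] at hx
    exact (div_le_iff₀ hL).1 (rho_supp (w0 x) this).2
lemma piece_chi (hL : 0 < L) : Piece 2 a L 0 (fun x => (rho 0 (|x-a|/L) : ℂ)) := by
  refine ⟨fun x => ?_, fun x y => ?_, fun x hx => ?_⟩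
  · rw [nrq]; exact (rho_abs _ _).trans NM
  · rw [← Complex.ofReal_sub, nrq]
    refine (rho_lip _ _ _).trans (mlmw ?_ NM)
    rw [← sub_div, abs_div, aop hL]
    refine dldq ?_ hL.le
    have := abs_abs_sub_abs_le_abs_sub (x-a) (y-a)
    rwa [show x-a-(y-a) = x-y by ring] at this
  · exact (div_le_iff₀ hL).1 (rho_supp PZ (by exact_mod_cast hx)).2
theorem pieces (C : ℕ → ℝ) (M : ℕ) : ∃ D : ℝ, 0 < D ∧ ∀ (a L : ℝ) (φ : ℝ → ℂ), 0 < L → IsBumpAdapted C a L φ → ∀ e : Bool, (e = true → ∫ x, φ x = 0) →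
    ∃ ψ : ℕ → ℝ → ℂ, (∀ t, Piece (D/2^(M*t)) a L t (ψ t)) ∧ (∀ x, HasSum (fun t => ψ t x) (φ x)) ∧ (e = true → ∀ t, ∫ x, ψ t x = 0) := by
  set B : ℝ := max 1 (2^(M+2) * C (M+2)) with hB
  set b : ℝ := 3*2^(M+2)*2^(M+2)*B with hb
  have B1 : 1 ≤ B := le_max_left _ _
  have b0 : 0 < b := PZ
  refine ⟨b + 4*b, PZ, fun a L φ hL h e he => ?_⟩
  have pr := piece_rho (B := B) (M := M+2) (φ := φ) (a := a) hL (h.1.differentiable NM)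
    (fun x => ltz (by simpa using bump_dec hL h (M+2) 0 NM x) (le_max_right _ _))
    (fun x => ltz (by simpa using bump_dec hL h (M+2) 1 NM x) (le_max_right _ _))
  rw [← hb] at pr
  set f : ℕ → ℝ → ℂ := fun t x => (rho t (|x-a|/L) : ℂ) * φ x with hf
  have fs : ∀ x, HasSum (fun t => f t x) (φ x) := fun x => by
    simpa using ((Complex.hasSum_ofReal.2 (rho_sum (|x-a|/L))).mul_right (φ x))
  have ci := piece_chi (a := a) hL
  set η : ℝ → ℂ := fun x => (rho 0 (|x-a|/L) : ℂ) with hη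
  set I : ℝ := ∫ x, rho 0 (|x-a|/L) with hI
  have Ic : ∫ x, η x = I := integral_ofReal
  have r0 : ∀ x, 0 ≤ rho 0 (|x-a|/L) := fun x => by simp only [rho, cut]; simp
  have hI2 : 2*L ≤ I := by
    have i1 : Integrable fun x => rho 0 (|x-a|/L) := by simpa [hη] using (ci.intg hL).re
    calc 2*L = ∫ x in icz (a-L) (a+L), (1:ℝ) := by simp [hL.le, two_mul]
      _ = ∫ x in icz (a-L) (a+L), rho 0 (|x-a|/L) := by
        refine setIntegral_congr_fun measurableSet_Icc fun x hx => ?_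
        have : |x-a|/L ≤ 2^0 := by rw [div_le_iff₀ hL, abs_le]; constructor <;> linarith [hx.1, hx.2]
        simp only [rho]; rw [cut_one this]; simp [cut]
      _ ≤ I := setIntegral_le_integral i1 (Eventually.of_forall r0)
  have I0 : 0 < I := LI
  set c : ℕ → ℂ := fun t => if e then (∫ x, f t x)/I else 0 with hc
  have cb : ∀ t, ‖c t‖ * 2 ≤ 4*b/2^(M*t) := by
    intro t
    have h1 : ‖∫ x, f t x‖ ≤ b/2^((M+2)*t) * (2^(t+2)*L) := by
      have := (eil (f t)).trans ((pr t).int hL)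
      rw [← onq] at this
      exact (oloq PZ).1 this
    have h2 : b/2^((M+2)*t) * (2^(t+2)*L) ≤ 4*b/2^(M*t)*L := by
      have e1 : TT^((M+2)*t) = 2^(M*t)*2^t*2^t := by rw [add_mul, pow_add, two_mul, pow_add]; ring
      have e2 : b/2^((M+2)*t) * (2^(t+2)*L) = 4*b/2^(M*t)*L / 2^t := by
        rw [e1, pow_add]; field_simp; ring
      rw [e2]
      exact div_le_self PZ (one_le_pow₀ NM)
    simp only [hc]; split_ifs
    · rw [norm_div, nrq, non I0.le, div_mul_eq_mul_div, div_le_iff₀ I0]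
      calc _ ≤ 4*b/2^(M*t)*L * 2 := LI
        _ = 4*b/2^(M*t)*(2*L) := RG
        _ ≤ _ := by gcongr
    · simp; positivity
  have cs : HasSum c 0 := by
    cases e with
    | false => simpa [hc] using hasSum_zero
    | true =>
      have hfin : ∑' t, ∫⁻ x, ‖f t x‖ₑ ≠ ⊤ := by
        refine nto ?_ (tlt fun t => (pr t).int hL)
        have hs : Summable fun t : ℕ => b/2^((M+2)*t) * (2^(t+2)*L) := by
          refine Summable.of_nonneg_of_le (fun t => PZ) (fun t => ?_) ((summable_geometric_two).mul_left (4*b*L))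
          have e1 : TT^((M+2)*t) = 2^(M*t)*2^t*2^t := by rw [add_mul, pow_add, two_mul, pow_add]; ring
          have e2 : b/2^((M+2)*t) * (2^(t+2)*L) = 4*b*L*(1/2)^t / 2^(M*t) := by
            rw [e1, pow_add, one_div, inv_pow]; field_simp; ring
          rw [e2]
          exact div_le_self PZ (one_le_pow₀ NM)
        rw [← ENNReal.ofReal_tsum_of_nonneg (fun t => PZ) hs]; exact ont
      have := (hasSum_integral_of_summable_integral_norm (fun t => (pr t).intg hL) ?_).div_const (I:ℂ)
      · rw [show (fun x => ∑' t, f t x) = φ from funext fun x => (fs x).tsum_eq, he rfl] at this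
        simpa [hc] using this
      · refine (ENNReal.summable_toReal hfin).congr fun t => ?_
        rw [integral_norm_eq_lintegral_enorm (pr t).cont.aestronglyMeasurable]
  refine ⟨fun t x => f t x - c t * η x, fun t => ?_, fun x => by simpa using (fs x).sub (cs.mul_right (η x)), fun h1 t => ?_⟩
  · have := (pr t).sub ci (zlq t) hL (c t)
    have hd : b/2^((M+2)*t) + ‖c t‖*2 ≤ (b+4*b)/2^(M*t) := by
      rw [add_div]; refine ala ?_ (cb t)
      gcongr
      · norm_num
      · omega
    exact ⟨fun x => (this.bd x).trans hd, fun x y => (this.lip x y).trans (by gcongr), this.sp⟩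
  · rw [integral_sub ((pr t).intg hL) ((ci.intg hL).const_mul _), integral_const_mul, Ic]
    simp only [hc, h1, if_true]
    rw [div_mul_cancel₀ _ (by exact_mod_cast I0.ne'), sub_self]
end
section
variable {r u : ℕ} {b x x0 : ℝ} {f ψ : ℝ → ℂ} {K j n : ℤ}

lemma locInt (hf : Measurable f) (hb : ∀ x, ‖f x‖ ≤ b) : LocallyIntegrable f := by
  rw [locallyIntegrable_iff]
  exact fun K hK => Measure.integrableOn_of_bounded hK.measure_lt_top.ne hf.aestronglyMeasurable (Eventually.of_forall hb)
lemma intMul (hf : Measurable f) (hb : ∀ x, ‖f x‖ ≤ b) (h : Integrable ψ) : Integrable fun x => f x * ψ x :=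
  h.bdd_mul hf.aestronglyMeasurable (Eventually.of_forall hb)
namespace Grid
variable (G : Grid)
lemma E_bd (hb : ∀ x, ‖f x‖ ≤ b) (k : ℤ) (x : ℝ) : ‖G.E k f x‖ ≤ b := by
  have b0 := (nnq _).trans (hb 0)
  have := (G.enorm_E_le k f x).trans (G.av_le_of (c := ofq b) fun y _ => by rw [← onq]; exact olo (hb y))
  rw [← onq] at this
  exact (oloq b0).1 this
lemma E_sub_le (hψ : LocallyIntegrable ψ) {k : ℤ} {c : ℂ} {d : ℝ} (hd : 0 ≤ d) (h : ∀ y, G.idx k y = G.idx k x → ‖ψ y - c‖ ≤ d) :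
    ‖G.E k ψ x - c‖ ≤ d := by
  have hi : IntegrableOn ψ (G.cell k x) := by
    rw [cell_eq]; exact (hψ.integrableOn_isCompact isCompact_Icc).mono_set Set.Ico_subset_Icc_self
  have hv : volume (G.cell k x) ≠ ⊤ := by rw [volume_cell]; simp
  have e : G.E k ψ x - c = G.E k (fun y => ψ y - c) x := by
    unfold E
    rw [integral_sub hi (integrableOn_const hv), setIntegral_const, smul_sub, smul_smul, measureReal_def, volume_cell, ENNReal.toReal_ofReal PZ, inv_mul_cancel₀ PZ, one_smul]
  have := (G.enorm_E_le k (fun y => ψ y - c) x).trans (G.av_le_of (c := ofq d) fun y hy => by rw [← onq]; exact olo (h y hy))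
  rw [← e, ← onq] at this
  exact (oloq hd).1 this
lemma E_adj (k : ℤ) (hf : Measurable f) (hb : ∀ x, ‖f x‖ ≤ b) (hm : Measurable ψ) (hψ : Integrable ψ) :
    ∫ x, G.E k f x * ψ x = ∫ x, f x * G.E k ψ x := by
  classical
  set T : Set (RR) := {p | G.idx k p.1 = G.idx k p.2}
  set F : ℝ → ℝ → ℂ := fun x y => T.indicator (fun p => f p.2 * ψ p.1) (x, y) with hF
  have mF : Measurable (Function.uncurry F) := ((hf.comp msz).mul (hm.comp mfq)).indicator (G.measurableSet_idx_eq k)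
  have b0 := (nnq _).trans (hb 0)
  have iF : Integrable (Function.uncurry F) (volume.prod volume) := by
    refine ⟨mF.aestronglyMeasurable, ?_⟩
    rw [hasFiniteIntegral_iff_enorm, lintegral_prod _ mF.enorm.aemeasurable]
    refine lt_of_le_of_lt (b := ∫⁻ x, (ofq b * len k) * ‖ψ x‖ₑ) (lmq fun x => ?_) ?_
    · calc ∫⁻ y, ‖F x y‖ₑ ≤ ∫⁻ y, (G.cell k x).indicator (fun _ => ofq b * ‖ψ x‖ₑ) y := by
            refine lmq fun y => ?_
            by_cases h : G.idx k x = G.idx k y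
            · rw [iom (show y ∈ G.cell k x from h.symm)]
              simp only [hF]; rw [iom (show (x,y) ∈ T from h), enorm_mul, ← onq (f y)]
              exact mlmq (olo (hb y)) _
            · simp only [hF]; rw [ion (show (x,y) ∉ T from h)]; simp
        _ = _ := by rw [liq (G.measurableSet_cell k x), scz, volume_cell, len]; ring
    · rw [lcmq _ _ (mnt SI (len_ne_top k))]
      exact mlt (mlt SI (len_ne_top k).lt_top) hψ.2
  have h1 : ∀ x, G.E k f x * ψ x = (TT^k)⁻¹ • ∫ y, F x y := fun x => by
    unfold E
    rw [smul_mul_assoc, ← integral_mul_const, ← integral_indicator (G.measurableSet_cell k x)]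
    congr 2; ext y
    simp only [hF, Set.indicator_apply]
    exact if_congr (by exact eq_comm) rfl rfl
  have h2 : ∀ y, f y * G.E k ψ y = (TT^k)⁻¹ • ∫ x, F x y := fun y => by
    unfold E
    rw [mul_smul_comm, ← integral_const_mul, ← integral_indicator (G.measurableSet_cell k y)]
    rfl
  simp_rw [h1, h2]
  rw [integral_smul, integral_smul, integral_integral_swap iF]
lemma E_tele (K : ℤ) (f : ℝ → ℂ) (S : ℕ) (x : ℝ) : G.E (K-S) f x = G.E K f x + ∑ s ∈ rnq S, G.D (K-1-s) f x := by
  induction S with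
  | zero => simp
  | succ n ih =>
    rw [srs, ← add_assoc, ← ih, D, show K-1-(n:ℤ)+1 = K-n by ring, show K-((n+1:ℕ):ℤ) = K-1-n by push_cast; ring]; ring
lemma measurable_D (k : ℤ) (hf : Measurable f) : Measurable (G.D k f) := (G.measurable_E k hf).sub (G.measurable_E _ hf)
lemma D_bd (hb : ∀ x, ‖f x‖ ≤ b) (k : ℤ) (x : ℝ) : ‖G.D k f x‖ ≤ b + b :=
  (norm_sub_le _ _).trans (ala (G.E_bd hb _ _) (G.E_bd hb _ _))
end Grid
namespace Piece
variable {d a : ℝ} {k : ℤ} {t : ℕ} {ψ : ℝ → ℂ} (h : Piece d a (TT^k) t ψ) (G : Grid)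
include h
lemma d0 : 0 ≤ d := (nnq _).trans (h.bd 0)
lemma li : LocallyIntegrable ψ := locInt h.cont.measurable h.bd
lemma integrable : Integrable ψ := h.intg (Grid.two_pos k)
lemma E_near (j : ℤ) (x : ℝ) : ‖G.E j ψ x - ψ x‖ ≤ d * (TT^j/2^k) := by
  have := h.d0
  refine G.E_sub_le h.li PZ fun y hy => (h.lip y x).trans ?_
  gcongr; exact G.dist_of_idx hy
lemma E_zero (hK : ∀ y, ψ y ≠ 0 → G.idx K y = G.idx K x0) (hj : j ≤ K) (hx : G.idx K x ≠ G.idx K x0) : G.E j ψ x = 0 := by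
  have : ‖G.E j ψ x - 0‖ ≤ 0 := G.E_sub_le h.li le_rfl fun y hy => by
    by_cases hy0 : ψ y = 0
    · simp [hy0]
    · exact absurd ((G.idx_mono hj hy).symm.trans (hK y hy0)) hx
  simpa using this
lemma lim_E (K : ℤ) (x : ℝ) : Tendsto (fun S : ℕ => d * (TT^(K-S)/2^k)) atTop (𝓝 0) := by
  have : ∀ S : ℕ, d * (TT^(K-S)/2^k) = d * 2^K/2^k * (1/2)^S := fun S => by
    rw [zpow_sub₀ NM, znq, one_div, inv_pow]; field_simp
  simp_rw [this]
  simpa using (tendsto_pow_atTop_nhds_zero_of_lt_one NM (by norm_num : HH < 1)).const_mul (d * 2^K/2^k)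
lemma D_pair (hsb : ∀ y z, ψ z ≠ 0 → |y-z| ≤ TT^k → y ∈ sball n u k x0) (hf : Measurable f) (hb : ∀ x, ‖f x‖ ≤ b) (hj : j ≤ k + r) (s : ℕ) (hs : j = k + r - s) :
    ‖∫ x, G.D j f x * ψ x‖ₑ ≤ ofq d * (1/2)^(s-r) * ∫⁻ x in sball n u k x0, ‖G.D j f x‖ₑ := by
  have d0 := h.d0
  have hm := G.measurable_D j hf
  rcases le_or_gt s r with hsr | hsr
  · rw [Nat.sub_eq_zero_of_le hsr, pow_zero, mul_one, ← lcmq _ _ SI, ← liq (measurableSet_sball n u k x0)]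
    refine (eil _).trans (lmq fun x => ?_)
    by_cases hx : ψ x = 0
    · simp [hx]
    rw [iom (hsb x x hx (by simp; positivity)), enorm_mul, mcz, ← onq (ψ x)]
    exact mlmq (olo (h.bd x)) _
  · have hp : TT^j/2^k = (1/2)^(s-r) := by
      rw [hs, show k + (r:ℤ) - s = k - ((s-r:ℕ):ℤ) by omega, zpow_sub₀ NM, znq, one_div, inv_pow]; field_simp
    have hjk : TT^j ≤ 2^k := zpow_le_zpow_right₀ NM OM
    have i1 := intMul hm (G.D_bd hb j) h.integrable
    have i2 : Integrable fun x => G.D j f x * ψ (G.sib j x) := intMul hm (G.D_bd hb j) ((G.measurePreserving_sib j).integrable_comp_of_integrable h.integrable)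
    have e1 : ∫ x, G.D j f x * ψ x = - ∫ x, G.D j f x * ψ (G.sib j x) := by
      have emb : MeasurableEmbedding (G.sib j) := (MeasurableEquiv.mk ⟨G.sib j, G.sib j, G.sib_sib j, G.sib_sib j⟩ (G.measurable_sib j) (G.measurable_sib j)).measurableEmbedding
      rw [← (G.measurePreserving_sib j).integral_comp emb, ← integral_neg]
      congr 1; ext x
      rw [G.D_sib j (locInt hf hb)]; ring
    have e2 : ∫ x, G.D j f x * ψ x = (1/2:ℂ) * ∫ x, G.D j f x * (ψ x - ψ (G.sib j x)) := by
      simp_rw [mul_sub]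
      rw [integral_sub i1 i2, ← neg_eq_iff_eq_neg.2 e1]; ring
    have e3 : ‖(1/2:ℂ)‖ₑ ≤ 1 := by rw [← onq]; norm_num
    rw [e2, enorm_mul]
    refine (mlmq e3 _).trans ?_
    rw [one_mul, ← lcmq _ _ FI, ← liq (measurableSet_sball n u k x0)]
    refine (eil _).trans (lmq fun x => ?_)
    by_cases hx : x ∈ sball n u k x0
    · rw [iom hx, enorm_mul, mcz, ← onq (ψ x - _), show ofq d * (1/2)^(s-r) = ofq (d * (1/2)^(s-r)) by
        rw [omq d0, opq NM]; congr 2; rw [odo NM]; simp]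
      refine mlmq (olo ((h.lip _ _).trans ?_)) _
      rw [abs_sub_comm, G.abs_sib_sub, hp]
    · have a1 : ψ x = 0 := by
        by_contra hc; exact hx (hsb x x hc (by simp; positivity))
      have a2 : ψ (G.sib j x) = 0 := by
        by_contra hc; exact hx (hsb x _ hc (by rw [abs_sub_comm, G.abs_sib_sub]; exact hjk))
      simp [a1, a2]
lemma pair (hsb : ∀ y z, ψ z ≠ 0 → |y-z| ≤ TT^k → y ∈ sball n u k x0) (hK : ∀ y, ψ y ≠ 0 → G.idx K y = G.idx K x0)
    (hr : K = k + r + 1) (hf : Measurable f) (hb : ∀ x, ‖f x‖ ≤ b) :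
    ‖∫ x, f x * ψ x‖ₑ ≤ (⨆ j : ℤ, G.av j (fun y => ‖f y‖ₑ) x0) * ‖∫ x, ψ x‖ₑ + ∑' s : ℕ, ofq d * (1/2)^(s-r) * ∫⁻ x in sball n u k x0, ‖G.D (K-1-s) f x‖ₑ := by
  have d0 := h.d0
  have b0 := (nnq _).trans (hb 0)
  have step : ∀ S : ℕ, ‖∫ x, f x * G.E (K-S) ψ x‖ₑ ≤ (⨆ j : ℤ, G.av j (fun y => ‖f y‖ₑ) x0) * ‖∫ x, ψ x‖ₑ + ∑' s : ℕ, ofq d * (1/2)^(s-r) * ∫⁻ x in sball n u k x0, ‖G.D (K-1-s) f x‖ₑ := by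
    intro S
    rw [← G.E_adj _ hf hb h.cont.measurable h.integrable]
    have i1 := intMul (G.measurable_E K hf) (G.E_bd hb K) h.integrable
    have i2 : ∀ s ∈ rnq S, Integrable fun x => G.D (K-1-s) f x * ψ x := fun s _ => intMul (G.measurable_D _ hf) (G.D_bd hb _) h.integrable
    simp_rw [G.E_tele, add_mul, Finset.sum_mul]
    rw [integral_add i1 (integrable_finsetSum _ i2), integral_finsetSum _ i2]
    refine (enorm_add_le _ _).trans (ala ?_ ?_)
    · have : ∀ x, G.E K f x * ψ x = G.E K f x0 * ψ x := fun x => by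
        by_cases hx : ψ x = 0
        · simp [hx]
        · rw [G.E_congr f (hK x hx)]
      simp_rw [this]
      rw [integral_const_mul, enorm_mul]
      exact mlmq ((G.enorm_E_le K f x0).trans (le_iSup (fun j => G.av j _ x0) K)) _
    · refine (enorm_sum_le _ _).trans (ltz (sls fun s _ => ?_) (slt (rnq S)))
      exact h.D_pair G hsb hf hb (r := r) OM s OM
  have lim : Tendsto (fun S : ℕ => ∫ x, f x * G.E (K-S) ψ x) atTop (𝓝 (∫ x, f x * ψ x)) := by
    rw [tendsto_iff_norm_sub_tendsto_zero]
    refine squeeze_zero (fun _ => nnq _) (g := fun S : ℕ => b * (d * (TT^(K-S)/2^k)) * TT^K) (fun S => ?_) (by simpa using ((h.lim_E K 0).const_mul b).mul_const (TT^K))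
    have iE : Integrable (G.E (K-S) ψ) := by
      refine ⟨(G.measurable_E _ h.cont.measurable).aestronglyMeasurable, lt_of_le_of_lt (lmq fun x => G.enorm_E_le _ _ _) ?_⟩
      rw [G.lintegral_av _ h.cont.measurable.enorm]; exact h.integrable.2
    rw [← integral_sub (intMul hf hb iE) (intMul hf hb h.integrable)]
    have e : ∀ x, f x * G.E (K-S) ψ x - f x * ψ x = (G.cell K x0).indicator (fun x => f x * (G.E (K-S) ψ x - ψ x)) x := fun x => by
      by_cases hx : G.idx K x = G.idx K x0
      · rw [iom (show x ∈ G.cell K x0 from hx)]; ring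
      · rw [ion (show x ∉ G.cell K x0 from hx), h.E_zero G hK OM hx]
        have : ψ x = 0 := by by_contra hc; exact hx (hK x hc)
        simp [this]
    simp_rw [e]
    rw [integral_indicator (G.measurableSet_cell K x0)]
    refine (norm_setIntegral_le_of_norm_le_const (by rw [G.volume_cell]; simp) fun x _ => (norm_mul_le _ _).trans (mul_le_mul (hb x) (h.E_near G (K-S) x) (nnq _) b0)).trans_eq ?_
    rw [measureReal_def, G.volume_cell, ENNReal.toReal_ofReal PZ]
  exact le_of_tendsto' (continuous_enorm.continuousAt.tendsto.comp lim) step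
end Piece
end

abbrev Ix := ℕ × Bool × ℕ
def kap (D : ℝ) (e : Bool) (τ L : ℕ) (P : Ix) : EE :=
  if e = true ∧ P.2.2 = 0 then 0 else ofq (D/2^(3*P.1)*2^(P.1+τ+3)) * (1/2)^(P.2.2 - 1 - (P.1+τ+L+6))
def Lop (n : ℤ) (τ : ℕ) (k : ℤ) (P : Ix) (g : ℝ → EE) (x : ℝ) : EE :=
  if P.2.2 = 0 then ⨆ j : ℤ, (grid P.2.1).av j g x else BB n ((P.1+τ+3 : ℕ):ℤ) k g x
def Dop (τ L : ℕ) (k : ℤ) (P : Ix) (f : ℝ → ℂ) : ℝ → ℂ :=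
  if P.2.2 = 0 then f else (grid P.2.1).D (k + ((P.1+τ+L+6:ℕ):ℤ) - ((P.2.2-1:ℕ):ℤ)) f
lemma tsum_half (r : ℕ) : ∑' o : ℕ, (1/2:EE)^(o-1-r) ≤ r + 3 := by
  rw [← (ENNReal.summable (f := fun o : ℕ => (1/2:EE)^(o+(r+1)-1-r))).sum_add_tsum_nat_add' (f := fun o : ℕ => (1/2:EE)^(o-1-r))]
  have h1 : ∑ o ∈ rnq (r+1), (1/2:EE)^(o-1-r) = r+1 := by
    rw [scq rfl (g := fun _ => (1:EE)) fun o ho => by rw [Nat.sub_eq_zero_of_le (by have := mrq.1 ho; omega), pow_zero]]; simp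
  have h2 : ∑' o : ℕ, (1/2:EE)^(o+(r+1)-1-r) = 2 := by
    simp_rw [show ∀ o : ℕ, o+(r+1)-1-r = o from fun o => OM, one_div]
    rw [tgq, osi, inv_inv]
  rw [h1, h2, add_assoc]; norm_num
lemma kap_sum (D : ℝ) : ∃ A : EE, A ≠ ⊤ ∧ ∀ e τ (L : ℕ), ∑' P, kap D e τ L P ≤ A * 4^τ * (L+3) := by
  refine ⟨2 * (ofq D * 8 * 9 * 2), FI, fun e τ L => ?_⟩
  have h : ∀ t : ℕ, ∑' a : Bool × ℕ, kap D e τ L (t, a) ≤ 2 * (ofq D * 8 * 9 * 4^τ * (L+3)) * (2⁻¹)^t := fun t => by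
    rw [tpq]
    have h1 : ∀ a, ∑' o, kap D e τ L (t, a, o) ≤ ofq D * 8 * 9 * 4^τ * (L+3) * (2⁻¹)^t := fun a => by
      refine (tlt (g := fun o => ofq (D/2^(3*t)*2^(t+τ+3)) * (1/2)^(o - 1 - (t+τ+L+6))) fun o => ?_).trans ?_
      · unfold kap; split_ifs <;> simp
      rw [tml]
      refine (mlm (tsum_half _) _).trans ?_
      have e1 : (((t+τ+L+6:ℕ):EE)+3) ≤ 9 * (2^t*2^τ*(L+3)) := by
        have a1 := Nat.lt_two_pow_self (n := t)
        have a2 := Nat.lt_two_pow_self (n := τ)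
        have : t+τ+L+6+3 ≤ 9*(2^t*2^τ*(L+3)) := by nlinarith [Nat.mul_le_mul (slo a1) (slo a2), zlq (t*τ), mul_le_mul (Nat.mul_le_mul (slo a1) (slo a2)) le_rfl (zlq (L+3)) (zlq _), zlq (t*τ*L), zlq (t*L), zlq (τ*L)]
        exact_mod_cast this
      refine (mlm e1 _).trans_eq ?_
      have e2 : ofq (D/2^(3*t)*2^(t+τ+3)) = ofq D * 8 * 2^τ * (2⁻¹^t * 2⁻¹^t) := by
        rw [show D/2^(3*t)*2^(t+τ+3) = D * (8 * 2^τ * ((1/2)^t*(1/2)^t)) by rw [pow_add, pow_add, one_div, inv_pow, show 3*t = t+t+t by ring, pow_add, pow_add]; field_simp; norm_num]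
        rw [ENNReal.ofReal_mul' PZ, omq PZ, omq PZ, omq PZ, opq NM, opq NM, one_div, oio NM]
        norm_num; ring
      rw [e2, show (4:EE) = 2*2 by norm_num, mul_pow]
      have : (2⁻¹:EE)^t * 2^t = 1 := by rw [← mul_pow, imc SI SI, one_pow]
      calc _ = (ofq D * 8 * 2^τ * 9 * 2^τ * (L+3) * (2⁻¹)^t) * ((2⁻¹:EE)^t * 2^t) := RG
        _ = _ := by rw [this]; ring
    rw [tsum_bool]
    refine (ala (h1 _) (h1 _)).trans_eq ?_; ring
  rw [tpq]
  refine (tlt h).trans_eq ?_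
  rw [tml, tgq, osi, inv_inv]; ring
lemma Piece.conj {d a L : ℝ} {t : ℕ} {ψ : ℝ → ℂ} (h : Piece d a L t ψ) : Piece d a L t (fun x => CJ (ψ x)) where
  bd x := by simpa using h.bd x
  lip x y := by rw [← map_sub, RCLike.norm_conj]; exact h.lip x y
  sp x hx := h.sp x (by simpa using hx)
theorem ana (C : ℕ → ℝ) : ∃ D : ℝ, ∀ (k m n : ℤ) (τ L : ℕ) (x0 : ℝ) (φ : ℝ → ℂ) (e : Bool), |(n:ℝ)| ≤ 2^L →
    IsBumpAdapted C (TT^k*((m+n:ℤ):ℝ)) (TT^k) φ → (e = true → ∫ x, φ x = 0) → |x0 - TT^k*m| ≤ TT^k*2^τ →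
    ∀ (f : ℝ → ℂ) (b : ℝ), Measurable f → (∀ x, ‖f x‖ ≤ b) →
    ‖∫ x, f x * CJ (φ x)‖ₑ ≤ Grid.len k * ∑' P, kap D e τ L P * Lop n τ k P (fun y => ‖Dop τ L k P f y‖ₑ) x0 := by
  obtain ⟨D, D0, hD⟩ := pieces C 3
  refine ⟨D, fun k m n τ L x0 φ e hn hφ he hx0 f b hf hb => ?_⟩
  have k0 := Grid.two_pos k
  obtain ⟨ψ, hψ, hs, h0⟩ := hD _ _ φ k0 hφ e he
  have b0 := (nnq _).trans (hb 0)
  have hψ' := fun t => (hψ t).conj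
  have hs' : ∀ x, HasSum (fun t => CJ (ψ t x)) (CJ (φ x)) := fun x => (hs x).map CJ RCLike.continuous_conj
  have e1 : ∫ x, f x * CJ (φ x) = ∑' t, ∫ x, f x * CJ (ψ t x) := by
    rw [← integral_tsum (fun t => (intMul hf hb (hψ' t).integrable).aestronglyMeasurable)]
    · congr 1; ext x; rw [tsum_mul_left, (hs' x).tsum_eq]
    · have : ∀ t, ∫⁻ x, ‖f x * CJ (ψ t x)‖ₑ ≤ ofq (b * D * 4 * 2^k) * (2⁻¹)^t := fun t => by
        refine (lintegral_mono (g := fun x => ofq b * ‖CJ (ψ t x)‖ₑ) fun x => ?_).trans ?_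
        · rw [enorm_mul, ← onq (f x)]; exact mlmq (olo (hb x)) _
        rw [lcmq _ _ SI]
        refine (mlm ((hψ' t).int k0) _).trans ?_
        rw [← omq b0, show (2⁻¹:EE)^t = ofq ((1/2)^t) by rw [opq NM, one_div, oio NM]; norm_num, ← omq PZ]
        refine olo ?_
        rw [show b * (D/2^(3*t)*(2^(t+2)*2^k)) = b*D*4*2^k*((1/2)^t*(1/2)^t) by rw [pow_add, one_div, inv_pow, show 3*t = t+t+t by ring, pow_add, pow_add]; field_simp; norm_num]
        refine mlmw ?_ PZ
        exact mul_le_of_le_one_left PZ (pow_le_one₀ NM NM)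
      refine nto ?_ (tlt this)
      rw [tml, tgq, osi, inv_inv]; finiteness
  rw [e1, tpq, ← tml]
  refine enorm_tsum_le_tsum_enorm.trans (tlt fun t => ?_)
  have p1 : (1:ℝ) ≤ 2^t := one_le_pow₀ NM
  have p2 : (1:ℝ) ≤ 2^τ := one_le_pow₀ NM
  have p3 : (1:ℝ) ≤ 2^L := one_le_pow₀ NM
  have hsp : ∀ z, CJ (ψ t z) ≠ 0 → |z - x0 - n*2^k| ≤ (2*2^t+2^τ)*2^k := fun z hz => by
    have h1 := (hψ' t).sp z hz
    rw [show z - x0 - n*2^k = (z - 2^k*((m+n:ℤ):ℝ)) - (x0 - 2^k*m) by push_cast; ring]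
    refine (abs_sub _ _).trans ?_
    rw [pow_succ] at h1; nlinarith
  obtain ⟨α, hα⟩ := grid_cover (k+(t+τ+L+6:ℕ)+1) (c := x0) (ρ := 2^k*(2^t*2^τ*2^L*16)) PZ (by
    rw [zpow_add₀ NM, zpow_add₀ NM, znq, pow_add, pow_add, pow_add]
    have : 0 < TT^k*(2^t*2^τ*2^L) := PZ
    norm_num; nlinarith)
  have q1 : TT^t ≤ 2^t*2^τ := le_mul_of_one_le_right PZ p2
  have q2 : TT^τ ≤ 2^t*2^τ := lmo PZ p1
  have q3 : TT^t*2^τ ≤ 2^t*2^τ*2^L := le_mul_of_one_le_right PZ p3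
  have q4 : TT^L ≤ 2^t*2^τ*2^L := lmo PZ (one_le_mul_of_one_le_of_one_le p1 p2)
  have key := (hψ' t).pair (grid α) (n := n) (u := t+τ+3) (x0 := x0) (fun y z hz hyz => by
      rw [mem_sball, zpow_add₀ NM, znq, pow_add, pow_add, show y - x0 - n*2^k = (y-z) + (z-x0-n*2^k) by ring]
      refine (abs_add_le _ _).trans ((ala hyz (hsp z hz)).trans ?_)
      nlinarith) (fun y hy => hα y (by
      have h1 := hsp y hy
      have h2 : |y - x0| ≤ 2^k*(2^t*2^τ*2^L*16) := by
        rw [show y - x0 = (y-x0-n*2^k)+n*2^k by ring]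
        refine (abs_add_le _ _).trans ?_
        rw [abs_mul, aop k0]
        nlinarith
      rw [abs_le] at h2; constructor <;> linarith)) (r := t+τ+L+6) rfl hf hb
  refine key.trans ?_
  rw [tpq, ← tml]
  refine ltz ?_ (ltq α)
  rw [tsum_eq_zero_add' (f := fun o => kap D e τ L (t, α, o) * _) ENNReal.summable, mul_add, ← tml]
  have hlen : Grid.len k * ofq (D/2^(3*t)*2^(t+τ+3)) = ofq (D/2^(3*t)) * Grid.len (k+((t+τ+3:ℕ):ℤ)) := by
    rw [Grid.len_add, omq PZ, Grid.len_nat, opq NM]; norm_num; ring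
  refine ala ?_ (tlt fun s => ?_)
  · by_cases h : e = true
    · have : ∫ x, CJ (ψ t x) = 0 := by rw [integral_conj, h0 h t, map_zero]
      rw [this]; simp
    · have h2 : ‖∫ x, CJ (ψ t x)‖ₑ ≤ Grid.len k * ofq (D/2^(3*t)*2^(t+τ+3)) := by
        refine (eil _).trans (((hψ' t).int k0).trans ?_)
        rw [Grid.len, ← omq PZ]
        refine olo ?_
        rw [show TT^k*(D/2^(3*t)*2^(t+τ+3)) = D/2^(3*t)*(2^(t+τ+3)*2^k) by ring]
        exact mlmw (mlmv (pow_le_pow_right₀ NM OM) k0.le) PZ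
      simp only [kap, Lop, Dop, h, false_and, if_false, if_true, zero_tsub, pow_zero, mul_one]
      rw [mcz, ← maq]
      exact mlmq h2 _
  · simp only [kap, Lop, Dop, Nat.add_eq_zero_iff, one_ne_zero, and_false, if_false, Nat.add_sub_cancel]
    rw [← maq, ← maq, hlen, BB, show k + ((t+τ+L+6:ℕ):ℤ)+1-1-(s:ℤ) = k + ((t+τ+L+6:ℕ):ℤ) - s by ring]
    rw [mul_right_comm _ (Grid.len _), maq _ (Grid.len _), mdcq (Grid.len_ne_zero _) (Grid.len_ne_top _)]
section
variable {C Λ : EE} {f : RR → ℂ} {b θ : ℝ} {Z g v : ℝ → EE} {φ : ℝ → ℂ} {n : ℤ}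

lemma bump_int {C : ℕ → ℝ} {a L : ℝ} (hL : 0 < L) (h : IsBumpAdapted C a L φ) : Integrable φ := by
  have i : Integrable fun x : ℝ => (1 + ((x-a)/L)^2)⁻¹ := (integrable_inv_one_add_sq.comp_div hL.ne').comp_sub_right a
  refine (i.const_mul (2^2*C 2)).mono' h.1.continuous.aestronglyMeasurable (Eventually.of_forall fun x => ?_)
  have := bump_dec hL h 2 0 NM x
  simp only [iteratedDeriv_zero, pow_zero, mul_one] at this
  rw [← dem, le_div_iff₀ PZ]
  refine ltz ?_ this
  gcongr
  rw [show ((x-a)/L)^2 = (|x-a|/L)^2 by rw [div_pow, div_pow, sq_abs]]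
  have : 0 ≤ |x-a|/L := PZ
  nlinarith
lemma conj_int (h : Integrable φ) : Integrable fun x => CJ (φ x) :=
  h.mono (RCLike.continuous_conj.comp_aestronglyMeasurable h.1) SI
def om (P : Ix) (k : ℤ) : EE := if P.2.2 = 0 ∧ k ≠ 0 then 0 else 1
def cL (C : EE) : EE := 32 * C^2 + C^2 * (4^TT * geoC (2-1))^2
def cD (θ : ℝ) (C : EE) : EE := 1 + C * (ofq (θ*(1-θ)/4))⁻¹
lemma Lop_w (H : GW θ C Λ n v Z) (hΛ : 1 ≤ Λ) (τ : ℕ) (k : ℤ) (P : Ix) (hg : Measurable g) :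
    ∫⁻ x, Lop n τ k P g x^2 * v x ≤ cL C * Λ * ∫⁻ x, g x^2 * v x := by
  unfold Lop cL; rw [add_mul]
  split_ifs
  · refine (H.F3 _ hg).trans (mlmq ?_ _)
    exact (lmoq hΛ).trans le_add_self
  · exact (H.F2u k _ hg).trans (mlmq le_self_add _)
lemma Dop_w (H : GW θ C Λ n v Z) (τ L : ℕ) (P : Ix) {f : ℝ → ℂ} (hf : Measurable f) (hb : ∀ x, ‖f x‖ ≤ b) :
    ∑' k, om P k * ∫⁻ x, ‖Dop τ L k P f x‖ₑ^2 * v x ≤ cD θ C * ∫⁻ x, ‖f x‖ₑ^2 * v x := by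
  unfold om Dop cD; rw [add_mul]
  by_cases h : P.2.2 = 0
  · simp only [h, true_and, if_true]
    rw [tsum_eq_single 0 fun k hk => by simp [hk]]
    simp
  · simp only [h, false_and, if_false, one_mul]
    refine ltz (loe ?_) ((H.F4 (grid P.2.1) (locInt hf hb) hf).trans le_add_self)
    rw [← (Equiv.addRight (((P.1+τ+L+6:ℕ):ℤ) - ((P.2.2-1:ℕ):ℤ))).tsum_eq fun j => ∫⁻ x, ‖(grid P.2.1).D j f x‖ₑ^2 * v x]
    simp only [Equiv.coe_addRight, add_sub_assoc]
lemma Lop_tsum (n : ℤ) (τ : ℕ) (k : ℤ) (P : Ix) {c : Ix → EE} {h : Ix → ℝ → EE} (hm : ∀ Q, Measurable (h Q)) (H : ∀ y, g y ≤ ∑' Q, c Q * h Q y) (x : ℝ) :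
    Lop n τ k P g x ≤ ∑' Q, c Q * Lop n τ k P (h Q) x := by
  unfold Lop; split_ifs
  · refine iSup_le fun j => ((Grid.av_mono _ x H).trans_eq ?_).trans (tlt fun Q => mlm (le_iSup (fun j => (grid P.2.1).av j (h Q) x) j) _)
    unfold Grid.av
    rw [ltw fun Q => ((hm Q).const_mul _).aemeasurable, dem, ← tmr]
    simp_rw [lcmz _ (hm _), maq, dem]
  · refine (BB_mono x H).trans_eq ?_
    unfold BB
    rw [ltw fun Q => ((hm Q).const_mul _).aemeasurable, dem, ← tmr]
    simp_rw [lcmz _ (hm _), maq, dem]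
lemma Lop_param {Y : Type*} [MeasurableSpace Y] (n : ℤ) (τ : ℕ) (k : ℤ) (P : Ix) {g : ℝ × Y → EE} (hg : Measurable g) :
    Measurable fun p : ℝ × Y => Lop n τ k P (fun y => g (y, p.2)) p.1 := by
  unfold Lop; split_ifs
  · exact Measurable.iSup fun j => Grid.measurable_av_param _ j hg
  · exact measurable_BB_param _ _ _ hg
lemma Dop_param {Y : Type*} [MeasurableSpace Y] (τ L : ℕ) (k : ℤ) (P : Ix) {f : ℝ × Y → ℂ} (hf : Measurable f) :
    Measurable fun p : ℝ × Y => Dop τ L k P (fun y => f (y, p.2)) p.1 := by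
  unfold Dop; split_ifs
  · exact hf
  · exact (Grid.measurable_E_param _ _ hf).sub (Grid.measurable_E_param _ _ hf)
lemma Dop_bd {f : ℝ → ℂ} (hb : ∀ x, ‖f x‖ ≤ b) (τ L : ℕ) (k : ℤ) (P : Ix) (x : ℝ) : ‖Dop τ L k P f x‖ ≤ b + b := by
  unfold Dop; split_ifs
  · linarith [hb x, nnq (f x)]
  · exact Grid.D_bd _ hb _ _
lemma sw {α β γ : Type*} [MeasurableSpace α] [MeasurableSpace β] [MeasurableSpace γ] {f : α × β → γ} (hf : Measurable f) : Measurable fun p : β × α => f (p.2, p.1) := hf.comp measurable_swap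
lemma ms1 {γ : Type*} [MeasurableSpace γ] {w : RR → γ} (hw : Measurable w) (y : ℝ) : Measurable (fun x => w (x, y)) := hw.comp (measurable_id.prodMk mcq)
lemma ms2 {γ : Type*} [MeasurableSpace γ] {w : RR → γ} (hw : Measurable w) (x : ℝ) : Measurable (fun y => w (x, y)) := hw.comp (measurable_const.prodMk miv)
section
variable {f : RR → ℂ} (hf : Measurable f) {b : ℝ} (hb : ∀ z, ‖f z‖ ≤ b) {g : ℝ → ℂ} (hg : Integrable g)
include hf hb hg
lemma E_fub (G : Grid) (k : ℤ) (y : ℝ) : G.E k (fun y => ∫ x, f (x,y) * g x) y = ∫ x, G.E k (fun y' => f (x,y')) y * g x := by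
  unfold Grid.E
  simp_rw [smul_mul_assoc, ← integral_mul_const]
  rw [integral_smul]; congr 1
  have hv : volume (G.cell k y) ≠ ⊤ := by rw [Grid.volume_cell]; simp
  have : IsFiniteMeasure (volume.restrict (G.cell k y)) := ⟨by rw [rau]; exact hv.lt_top⟩
  rw [integral_integral_swap]
  have h1 : Integrable (fun p : RR => (1:ℂ) * g p.2) ((volume.restrict (G.cell k y)).prod volume) := (integrable_const (1:ℂ)).mul_prod hg
  simp only [one_mul] at h1
  exact h1.bdd_mul (f := fun p : RR => f (p.2, p.1)) (sw hf).aestronglyMeasurable (Eventually.of_forall fun p => hb _)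
lemma Dop_fub (τ L : ℕ) (k : ℤ) (P : Ix) (y : ℝ) : Dop τ L k P (fun y => ∫ x, f (x,y) * g x) y = ∫ x, Dop τ L k P (fun y' => f (x,y')) y * g x := by
  unfold Dop; split_ifs
  · rfl
  have me := fun (G : Grid) j => ms1 (sw (G.measurable_E_param j (sw hf))) y
  simp only [Grid.D, E_fub hf hb hg, sub_mul]
  rw [integral_sub (intMul (me _ _) (fun x => Grid.E_bd _ (fun y' => hb _) _ _) hg) (intMul (me _ _) (fun x => Grid.E_bd _ (fun y' => hb _) _ _) hg)]
end
structure Par where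
  n : ℤ
  τ : ℕ
  L : ℕ
def Bt (a c : Par) (f : RR → ℂ) (P Q : Ix) (k j : ℤ) (z : RR) : EE :=
  Lop c.n c.τ j Q (fun y => Lop a.n a.τ k P (fun x => ‖Dop a.τ a.L k P (fun x' => Dop c.τ c.L j Q (fun y' => f (x',y')) y) x‖ₑ) z.1) z.2
lemma mDy (c : Par) (hf : Measurable f) (Q : Ix) (j : ℤ) : Measurable fun z : RR => Dop c.τ c.L j Q (fun y' => f (z.1,y')) z.2 :=
  sw (Dop_param c.τ c.L j Q (sw hf))
lemma mDD (a c : Par) (hf : Measurable f) (P Q : Ix) (k j : ℤ) : Measurable fun z : RR => Dop a.τ a.L k P (fun x' => Dop c.τ c.L j Q (fun y' => f (x',y')) z.2) z.1 :=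
  Dop_param a.τ a.L k P (mDy c hf Q j)
lemma mL (a c : Par) (hf : Measurable f) (P Q : Ix) (k j : ℤ) : Measurable fun z : RR => Lop a.n a.τ k P (fun x => ‖Dop a.τ a.L k P (fun x' => Dop c.τ c.L j Q (fun y' => f (x',y')) z.2) x‖ₑ) z.1 :=
  Lop_param a.n a.τ k P (g := fun z : RR => ‖Dop a.τ a.L k P (fun x' => Dop c.τ c.L j Q (fun y' => f (x',y')) z.2) z.1‖ₑ) (mDD a c hf P Q k j).enorm
lemma measurable_Bt (a c : Par) (hf : Measurable f) (P Q : Ix) (k j : ℤ) : Measurable (Bt a c f P Q k j) :=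
  sw (Lop_param c.n c.τ j Q (sw (mL a c hf P Q k j)))
def ka (D : ℝ) (e e' : Bool) (a c : Par) (R : Ix × Ix) : EE := kap D e a.τ a.L R.1 * kap D e' c.τ c.L R.2
theorem ana2 (C : ℕ → ℝ) : ∃ D : ℝ, ∀ (a c : Par) (k m j i : ℤ) (x0 : RR) (φ χ : ℝ → ℂ) (e e' : Bool), |(a.n:ℝ)| ≤ 2^a.L → |(c.n:ℝ)| ≤ 2^c.L →
    IsBumpAdapted C (TT^k*((m+a.n:ℤ):ℝ)) (TT^k) φ → IsBumpAdapted C (TT^j*((i+c.n:ℤ):ℝ)) (TT^j) χ →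
    (e = true → ∫ x, φ x = 0) → (e' = true → ∫ x, χ x = 0) → |x0.1 - TT^k*m| ≤ TT^k*2^a.τ → |x0.2 - TT^j*i| ≤ TT^j*2^c.τ →
    ∀ (f : RR → ℂ) (b : ℝ), Measurable f → (∀ x, ‖f x‖ ≤ b) →
    ‖∫ z : RR, f z * CJ (φ z.1 * χ z.2)‖ₑ ≤ Grid.len k * Grid.len j * ∑' R, ka D e e' a c R * Bt a c f R.1 R.2 k j x0 := by
  obtain ⟨D, hD⟩ := ana C
  refine ⟨D, fun a c k m j i x0 φ χ e e' ha hc hφ hχ he he' hx hy f b hf hb => ?_⟩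
  have b0 := (nnq _).trans (hb 0)
  have iφ : Integrable fun x => CJ (φ x) := conj_int (bump_int (Grid.two_pos k) hφ)
  have iχ : Integrable fun x => CJ (χ x) := conj_int (bump_int (Grid.two_pos j) hχ)
  have e1 : ∫ z : RR, f z * CJ (φ z.1 * χ z.2) = ∫ y, (∫ x, f (x,y) * CJ (φ x)) * CJ (χ y) := by
    rw [vep, integral_prod_symm]
    · congr 1; ext y; rw [← integral_mul_const]; congr 1; ext x; simp only [map_mul]; ring
    · simp only [map_mul]
      exact (iφ.mul_prod iχ).bdd_mul hf.aestronglyMeasurable (Eventually.of_forall hb)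
  set F : ℝ → ℂ := fun y => ∫ x, f (x,y) * CJ (φ x)
  have mφ : Measurable fun x => CJ (φ x) := RCLike.continuous_conj.measurable.comp hφ.1.continuous.measurable
  have mF : Measurable F := ((hf.mul (mφ.comp mfq)).stronglyMeasurable.integral_prod_left' (μ := volume)).measurable
  have bF : ∀ y, ‖F y‖ ≤ b * ∫ x, ‖CJ (φ x)‖ := fun y => by
    rw [← integral_const_mul]
    refine norm_integral_le_of_norm_le (iφ.norm.const_mul b) (Eventually.of_forall fun x => ?_)
    rw [norm_mul]; exact mlmv (hb _) (nnq _)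
  have e2 : ∑' R, ka D e e' a c R * Bt a c f R.1 R.2 k j x0 = ∑' Q, kap D e' c.τ c.L Q * ∑' P, kap D e a.τ a.L P * Bt a c f P Q k j x0 := by
    rw [tpq, tcq]
    simp_rw [← tml, ka]
    exact tsum_congr fun Q => tsum_congr fun P => RG
  rw [e1, e2]
  refine (hD j i c.n c.τ c.L x0.2 χ e' hc hχ he' hy F _ mF bF).trans ?_
  rw [mcz (Grid.len k), maq, ← tml (a := Grid.len k)]
  refine mlm (tlt fun Q => ?_) _
  rw [mul_left_comm]
  refine mlm ?_ _
  rw [← tml]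
  simp_rw [← maq]
  refine Lop_tsum c.n c.τ j Q (fun P => ms2 (mL a c hf P Q k j) x0.1) (fun y => ?_) x0.2
  simp_rw [maq]
  rw [Dop_fub hf hb iφ, tml]
  exact hD k m a.n a.τ a.L x0.1 φ e ha hφ he hx (fun x => Dop c.τ c.L j Q (fun y' => f (x,y')) y) _ (ms1 (mDy c hf Q j) y) (fun x => Dop_bd (fun y' => hb _) _ _ _ _ _)
end
section
variable {L τ : ℕ}

lemma cs_tsum {ι : Type*} (κ b : ι → EE) : (∑' i, κ i * b i)^2 ≤ (∑' i, κ i) * ∑' i, κ i * b i^2 := by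
  letI : MeasurableSpace ι := ⊤
  have h1 := lmn (μ := Measure.count) (f := κ) (g := fun i => κ i * b i^2) (measurable_from_top (f := κ)).aemeasurable (measurable_from_top (f := fun i => κ i * b i^2)).aemeasurable (by norm_num : (0:ℝ) ≤ 1/2) (by norm_num : (0:ℝ) ≤ 1/2) NM
  have h2 : ∀ x : EE, (x^HH)^2 = x := fun x => by rw [← rnz, ← rmq]; norm_num
  have h3 : ∀ i, κ i^HH * (κ i * b i^2)^HH = κ i * b i := fun i => by
    rw [← mro _ _ NM, show κ i * (κ i * b i^2) = (κ i * b i)^2 by ring, ← rnz, ← rmq]; norm_num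
  simp_rw [h3, lintegral_count' (measurable_from_top (f := κ)), lintegral_count' (measurable_from_top (f := fun i => κ i * b i^2)), lintegral_count' (measurable_from_top (f := fun i => κ i * b i))] at h1
  refine (plpq h1 2).trans_eq ?_
  rw [mul_pow, h2, h2]
lemma tsum_abs {ι : Type*} (w X Y : ι → EE) {A B I : EE} (h : ∀ J, X J ≤ A * (B * Y J)) (d : ∑' J, w J * Y J ≤ I) : ∑' J, w J * X J ≤ A * B * I := by
  refine ltz (tlt fun J => mlm (h J) _) (ltz (loe ?_) (mlm d _))
  rw [← tml]; exact tsum_congr fun J => RG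
def chi (e : Bool) (k k' : ℤ) : EE := if e = true ∧ k' ≠ k then 0 else 1
def Tt (e e' : Bool) (X : ℤ × ℤ → EE) (K : ℤ × ℤ) : EE := ∑' J : ℤ × ℤ, chi e K.1 J.1 * chi e' K.2 J.2 * X J
def Xf (D : ℝ) (e e' : Bool) (a c : Par) (f : RR → ℂ) (z : RR) (K : ℤ × ℤ) : EE :=
  (∑' R, ka D e e' a c R) * ∑' R : Ix × Ix, ka D e e' a c R * (om R.1 K.1 * om R.2 K.2 * Bt a c f R.1 R.2 K.1 K.2 z^2)
lemma kap_zero {D : ℝ} {P : Ix} (h : P.2.2 = 0) : kap D true τ L P = 0 := by simp [kap, h]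
lemma Lop_k {n : ℤ} {P : Ix} (h : P.2.2 = 0) (k k' : ℤ) : Lop n τ k P = Lop n τ k' P := by unfold Lop; simp only [h, if_true]
lemma Dop_k {P : Ix} (h : P.2.2 = 0) (k k' : ℤ) : Dop τ L k P = Dop τ L k' P := by unfold Dop; simp only [h, if_true]
lemma dom (D : ℝ) (e e' : Bool) (a c : Par) (f : RR → ℂ) (z : RR) (k j : ℤ) :
    (∑' R, ka D e e' a c R * Bt a c f R.1 R.2 k j z)^2 ≤ Tt e e' (Xf D e e' a c f z) (k, j) := by
  refine (cs_tsum _ _).trans ?_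
  unfold Tt Xf
  rw [show ∀ S : EE, (∑' J : ℤ × ℤ, chi e k J.1 * chi e' j J.2 * (S * ∑' R : Ix × Ix, ka D e e' a c R * (om R.1 J.1 * om R.2 J.2 * Bt a c f R.1 R.2 J.1 J.2 z^2))) =
      S * ∑' R : Ix × Ix, ∑' J : ℤ × ℤ, ka D e e' a c R * (chi e k J.1 * chi e' j J.2 * om R.1 J.1 * om R.2 J.2 * Bt a c f R.1 R.2 J.1 J.2 z^2) from fun S => by
    rw [tcq, ← tml]
    refine tsum_congr fun J => ?_
    rw [mul_left_comm, ← tml]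
    congr 1; exact tsum_congr fun R => RG]
  refine mlm (tlt fun R => ?_) _
  by_cases h0 : ka D e e' a c R = 0
  · simp [h0]
  obtain ⟨h1, h2⟩ := mul_ne_zero_iff.1 h0
  have hx : ∀ (E : Bool) (P : Ix) τ L (k : ℤ), kap D E τ L P ≠ 0 → chi E k (if P.2.2 = 0 then 0 else k) * om P (if P.2.2 = 0 then 0 else k) = 1 := fun E P τ L k h => by
    have : P.2.2 = 0 → E ≠ true := fun h3 h4 => h (by rw [h4]; exact kap_zero h3)
    unfold chi om
    split_ifs <;> simp_all
  refine ltz ?_ (ltq (if R.1.2.2 = 0 then 0 else k, if R.2.2.2 = 0 then 0 else j))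
  rw [show ∀ p q r s t : EE, p*q*r*s*t = (p*r)*(q*s)*t from fun p q r s t => RG, hx e R.1 _ _ k h1, hx e' R.2 _ _ j h2, one_mul, one_mul]
  refine loe ?_; congr 2
  unfold Bt
  split_ifs with p q q
  · rw [Lop_k p k 0, Lop_k q j 0, Dop_k p k 0, Dop_k q j 0]
  · rw [Lop_k p k 0, Dop_k p k 0]
  · rw [Lop_k q j 0, Dop_k q j 0]
  · rfl
section
variable {θ : ℝ} {C Λ₁ Λ₂ : EE} {a c : Par} {V Z : RR → EE} (H : GW2 θ C Λ₁ Λ₂ a.n c.n V Z) {f : RR → ℂ} (hf : Measurable f) {b : ℝ} (hb : ∀ z, ‖f z‖ ≤ b)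
include H hf
lemma Bt_w (h1 : 1 ≤ Λ₁) (h2 : 1 ≤ Λ₂) (t1 : Λ₁ ≠ ⊤) (t2 : Λ₂ ≠ ⊤) (hC : cL C ≠ ⊤) (P Q : Ix) (k j : ℤ) :
    ∫⁻ z, Bt a c f P Q k j z^2 * V z ≤ cL C * Λ₂ * (cL C * Λ₁ * ∫⁻ y, ∫⁻ x, ‖Dop a.τ a.L k P (fun x' => Dop c.τ c.L j Q (fun y' => f (x',y')) y) x‖ₑ^2 * V (x,y)) := by
  have m1 := mL a c hf P Q k j
  have m2 := mDD a c hf P Q k j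
  calc _ = ∫⁻ x, ∫⁻ y, Bt a c f P Q k j (x,y)^2 * V (x,y) := lint_snd (((measurable_Bt a c hf P Q k j).pow_const 2).mul H.mV)
    _ ≤ ∫⁻ x, cL C * Λ₂ * ∫⁻ y, (Lop a.n a.τ k P (fun x => ‖Dop a.τ a.L k P (fun x' => Dop c.τ c.L j Q (fun y' => f (x',y')) y) x‖ₑ) x)^2 * V (x,y) := lmq fun x => Lop_w (H.g2 x) h2 _ _ _ (ms2 m1 x)
    _ = cL C * Λ₂ * ∫⁻ y, ∫⁻ x, (Lop a.n a.τ k P (fun x => ‖Dop a.τ a.L k P (fun x' => Dop c.τ c.L j Q (fun y' => f (x',y')) y) x‖ₑ) x)^2 * V (x,y) := by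
      rw [lcmq _ _ FI]; congr 1
      have m3 := (m1.pow_const 2).mul H.mV
      exact (lint_snd m3).symm.trans (lint_fst m3)
    _ ≤ cL C * Λ₂ * ∫⁻ y, cL C * Λ₁ * ∫⁻ x, ‖Dop a.τ a.L k P (fun x' => Dop c.τ c.L j Q (fun y' => f (x',y')) y) x‖ₑ^2 * V (x,y) :=
      mlm (lmq fun y => Lop_w (H.g1 y) h1 _ _ _ (ms1 m2 y).enorm) _
    _ = _ := by rw [lcmq _ _ FI]
include hb
lemma DD_w (hC : cD θ C ≠ ⊤) (P Q : Ix) :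
    ∑' K : ℤ × ℤ, om P K.1 * om Q K.2 * ∫⁻ y, ∫⁻ x, ‖Dop a.τ a.L K.1 P (fun x' => Dop c.τ c.L K.2 Q (fun y' => f (x',y')) y) x‖ₑ^2 * V (x,y) ≤ cD θ C * (cD θ C * ∫⁻ z, ‖f z‖ₑ^2 * V z) := by
  have ho : ∀ P k, om P k ≠ ⊤ := fun P k => by unfold om; split_ifs <;> simp
  rw [tpq, tcq]
  calc _ = ∑' j, om Q j * ∫⁻ y, ∑' k, om P k * ∫⁻ x, ‖Dop a.τ a.L k P (fun x' => Dop c.τ c.L j Q (fun y' => f (x',y')) y) x‖ₑ^2 * V (x,y) := by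
        refine tsum_congr fun j => ?_
        rw [ltw fun k => ?_, ← tml]
        · refine tsum_congr fun k => ?_
          rw [lcmq _ _ (ho P k)]; ring
        · exact ((((mDD a c hf P Q k j).enorm.pow_const 2).mul H.mV).lintegral_prod_left'.const_mul _).aemeasurable
    _ ≤ ∑' j, om Q j * ∫⁻ y, cD θ C * ∫⁻ x, ‖Dop c.τ c.L j Q (fun y' => f (x,y')) y‖ₑ^2 * V (x,y) :=
      tlt fun j => mlm (lmq fun y => Dop_w (H.g1 y) _ _ P (ms1 (mDy c hf Q j) y) fun x => Dop_bd (fun y' => hb _) _ _ _ _ _) _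
    _ = cD θ C * ∫⁻ x, ∑' j, om Q j * ∫⁻ y, ‖Dop c.τ c.L j Q (fun y' => f (x,y')) y‖ₑ^2 * V (x,y) := by
      have m : ∀ j, Measurable fun z : RR => ‖Dop c.τ c.L j Q (fun y' => f (z.1,y')) z.2‖ₑ^2 * V z := fun j => ((mDy c hf Q j).enorm.pow_const 2).mul H.mV
      rw [ltw fun j => ((m j).lintegral_prod_right'.const_mul _).aemeasurable, ← tml]
      refine tsum_congr fun j => ?_
      rw [lcmq _ _ hC, lcmq _ _ (ho Q j), ← lint_fst (m j), ← lint_snd (m j)]; ring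
    _ ≤ cD θ C * ∫⁻ x, cD θ C * ∫⁻ y, ‖f (x,y)‖ₑ^2 * V (x,y) := mlm (lmq fun x => Dop_w (H.g2 x) _ _ Q (ms2 hf x) fun y => hb _) _
    _ = _ := by
      have m : Measurable fun z : RR => ‖f z‖ₑ^2 * V z := (hf.enorm.pow_const 2).mul H.mV
      rw [lcmq _ _ hC, lint_snd m]
lemma BD_w (h1 : 1 ≤ Λ₁) (h2 : 1 ≤ Λ₂) (t1 : Λ₁ ≠ ⊤) (t2 : Λ₂ ≠ ⊤) (hC : cL C ≠ ⊤) (hD : cD θ C ≠ ⊤) (P Q : Ix) :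
    ∑' J : ℤ × ℤ, om P J.1 * om Q J.2 * ∫⁻ z, Bt a c f P Q J.1 J.2 z^2 * V z ≤ cL C * Λ₂ * (cL C * Λ₁) * (cD θ C * (cD θ C * ∫⁻ z, ‖f z‖ₑ^2 * V z)) := by
  have d := DD_w H hf hb hD P Q
  have h := fun J : ℤ × ℤ => Bt_w H hf h1 h2 t1 t2 hC P Q J.1 J.2
  exact tsum_abs (fun J : ℤ × ℤ => om P J.1 * om Q J.2) _ _ h d
end
lemma measurable_Xf (D : ℝ) (e e' : Bool) (a c : Par) {f : RR → ℂ} (hf : Measurable f) : Measurable fun z => ∑' K, Xf D e e' a c f z K := by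
  unfold Xf
  exact Measurable.tsum fun K => (Measurable.tsum fun R => (((measurable_Bt a c hf _ _ _ _).pow_const 2).const_mul _).const_mul _).const_mul _
def WW (a c : Par) : EE := 4^a.τ * 4^c.τ * (a.L+3)^2 * (c.L+3)^2
set_option maxHeartbeats 400000 in
theorem anaN (D : ℝ) {p : ℝ} (hp : 1 < p) : ∃ K : EE, K ≠ ⊤ ∧ ∀ (a c : Par) (e e' : Bool) (f : RR → ℂ) (b : ℝ), |(a.n:ℝ)| ≤ 2^a.L → |(c.n:ℝ)| ≤ 2^c.L →
    Measurable f → (∀ z, ‖f z‖ ≤ b) → ∫⁻ z, ‖f z‖ₑ^p ≠ ⊤ →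
    ∫⁻ z, ((∑' J, Xf D e e' a c f z J)^HH)^p ≤ K * WW a c^p * ∫⁻ z, ‖f z‖ₑ^p := by
  obtain ⟨θ, C, K, t0, t1, hC, hK, H⟩ := extrap hp
  obtain ⟨A, hA, hS⟩ := kap_sum D
  have hL : cL C ≠ ⊤ := by have := geoC_ne_top (s := 2-1) NM; unfold cL; finiteness
  have hD : cD θ C ≠ ⊤ := by
    have : 0 < θ * (1-θ)/4 := by have := mul_pos t0 (sub_pos.2 t1); linarith
    have : (ofq (θ*(1-θ)/4))⁻¹ ≠ ⊤ := by simpa using this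
    unfold cD; finiteness
  refine ⟨K * ((A*A)^2 * (cL C)^2 * (cD θ C)^2)^(p/2), mnt hK (rnt LI FI), fun a c e e' f b h1 h2 hf hb hi => ?_⟩
  have h2' : ∀ x : EE, (x^HH)^2 = x := fun x => by rw [← rnz, ← rmq]; norm_num
  refine (H a.n c.n a.L c.L h1 h2 ((A*A)^2 * (cL C)^2 * (cD θ C)^2 * WW a c^2) (ofq b) (fun z => ‖f z‖ₑ) _ hf.enorm ((measurable_Xf D e e' a c hf).pow_const _) SI (fun z => by rw [← onq]; exact olo (hb z)) hi fun V Z G => ?_).trans_eq ?_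
  · simp_rw [h2']
    set S := ∑' R, ka D e e' a c R with hSd
    have S1 : S ≤ (A * 4^a.τ * (a.L+3)) * (A * 4^c.τ * (c.L+3)) := by
      refine ltz (loe ?_) (mlmz (hS e a.τ a.L) (hS e' c.τ c.L))
      rw [hSd, tpq, ← tmr]
      exact tsum_congr fun P => by rw [← tml]; rfl
    have St : S ≠ ⊤ := nto FI S1
    have kt : ∀ R, ka D e e' a c R ≠ ⊤ := fun R => nto St (ltq R)
    have l1 : (1:EE) ≤ a.L+3 := by exact_mod_cast (by omega : 1 ≤ a.L+3)
    have l2 : (1:EE) ≤ c.L+3 := by exact_mod_cast (by omega : 1 ≤ c.L+3)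
    have ho : ∀ P k, om P k ≠ ⊤ := fun P k => by unfold om; split_ifs <;> simp
    set I := ∫⁻ z, ‖f z‖ₑ^2 * V z
    have mB : ∀ (R : Ix × Ix) (J : ℤ × ℤ), Measurable fun z => om R.1 J.1 * om R.2 J.2 * Bt a c f R.1 R.2 J.1 J.2 z^2 * V z := fun R J => (((measurable_Bt a c hf _ _ _ _).pow_const 2).const_mul _).mul G.mV
    calc ∫⁻ z, (∑' J, Xf D e e' a c f z J) * V z = ∫⁻ z, S * ∑' R : Ix × Ix, ka D e e' a c R * ∑' J : ℤ × ℤ, om R.1 J.1 * om R.2 J.2 * Bt a c f R.1 R.2 J.1 J.2 z^2 * V z := by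
          refine lintegral_congr fun z => ?_
          unfold Xf
          simp_rw [← hSd, ← tml, ← tmr]
          rw [tcq]
          exact tsum_congr fun R => tsum_congr fun J => RG
      _ = S * ∑' R : Ix × Ix, ka D e e' a c R * ∑' J : ℤ × ℤ, om R.1 J.1 * om R.2 J.2 * ∫⁻ z, Bt a c f R.1 R.2 J.1 J.2 z^2 * V z := by
          rw [lcmq _ _ St, ltw fun R => ((Measurable.tsum fun J => mB R J).const_mul _).aemeasurable]
          congr 1; refine tsum_congr fun R => ?_
          rw [lcmq _ _ (kt R), ltw fun J => (mB R J).aemeasurable]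
          congr 1; refine tsum_congr fun J => ?_
          simp_rw [maq (om R.1 J.1 * om R.2 J.2)]
          rw [lcmq _ _ (mnt (ho _ _) (ho _ _))]
      _ ≤ S * ∑' R : Ix × Ix, ka D e e' a c R * (cL C * (c.L+3) * (cL C * (a.L+3)) * (cD θ C * (cD θ C * I))) := by
          refine mlm (tlt fun R => mlm ?_ _) _
          exact BD_w G hf hb l1 l2 FI FI hL hD R.1 R.2
      _ = S * S * ((a.L+3) * (c.L+3)) * ((cL C)^2 * (cD θ C)^2 * I) := by rw [tmr]; ring
      _ ≤ ((A * 4^a.τ * (a.L+3)) * (A * 4^c.τ * (c.L+3))) * ((A * 4^a.τ * (a.L+3)) * (A * 4^c.τ * (c.L+3))) * (((a.L+3) * (c.L+3)) * ((a.L+3) * (c.L+3))) * ((cL C)^2 * (cD θ C)^2 * I) :=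
          mlmq (mlmz (mlmz S1 S1) (lmoq (one_le_mul l1 l2))) _
      _ = _ := by unfold WW; generalize cL C = x, cD θ C = y, I = z; ring
  · rw [mro _ _ LI, ← rnz (WW a c), ← rmq, show ((2:ℕ):ℝ) * (p/2) = p by push_cast; ring]; ring
end

structure Exd (e : Bool) (k : ℤ) (a b : ℝ) (J : Ix) (g : ℝ → ℂ) : Prop where
  ms : Measurable g
  bd : ∀ x, ‖g x‖ ≤ b * (1/2)^J.2.2
  sp : ∀ x, g x ≠ 0 → |x - a| ≤ TT^k * 2^(J.1+4)
  ct : e = true → ∀ x y, (grid J.2.1).idx (k+J.1+3-J.2.2) x = (grid J.2.1).idx (k+J.1+3-J.2.2) y → g x = g y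
  an : e = true → ∀ x, g ((grid J.2.1).sib (k+J.1+3-J.2.2) x) = - g x
lemma exp1 {d a : ℝ} {k : ℤ} {t : ℕ} {ψ : ℝ → ℂ} (h : Piece d a (TT^k) t ψ) (e : Bool) (he : e = true → ∫ x, ψ x = 0) :
    ∃ g : Bool × ℕ → ℝ → ℂ, (∀ J, Exd e k a (24*d*2^t) (t, J) (g J)) ∧ ∀ x, HasSum (fun J => g J x) (ψ x) := by
  have d0 := h.d0
  have t1 : (1:ℝ) ≤ 2^t := one_le_pow₀ NM
  cases e with
  | false =>
    refine ⟨fun J => if J = (true, 0) then ψ else 0, fun J => ⟨?_, fun x => ?_, fun x hx => ?_, SI, SI⟩, fun x => ?_⟩ <;> beta_reduce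
    · split_ifs; exacts [h.cont.measurable, mcq]
    · split_ifs with hJ
      · rw [hJ]; refine (h.bd x).trans ?_; simp; nlinarith
      · simp; positivity
    · beta_reduce at hx; split_ifs at hx with hJ
      · refine (h.sp x hx).trans ?_
        rw [mcz]; gcongr <;> simp
      · simp at hx
    · convert hasSum_ite_eq ((true, 0) : Bool × ℕ) (ψ x) using 2 with J
      beta_reduce; split_ifs <;> rfl
  | true =>
    obtain ⟨α, hα⟩ := grid_cover (c := a) (k+t+4) (ρ := 2^(t+1)*2^k) PZ (by
      rw [show k+(t:ℤ)+4 = k+((t+4:ℕ):ℤ) by push_cast; ring, zpow_add₀ NM, znq, pow_add, pow_add]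
      have : 0 < TT^k := PZ
      nlinarith [mul_pos this (zero_lt_one.trans_le t1)])
    set G := grid α
    set K : ℤ := k+t+4 with hKd
    have hK : ∀ y, ψ y ≠ 0 → G.idx K y = G.idx K a := fun y hy => hα y (by have := abs_le.1 (h.sp y hy); constructor <;> linarith)
    have hz : ∀ x, G.E K ψ x = 0 := fun x => by
      by_cases hx : G.idx K x = G.idx K a
      · have : ∫ y in G.cell K x, ψ y = 0 := by
          rw [← he rfl]; refine setIntegral_eq_integral_of_forall_compl_eq_zero fun y hy => ?_
          by_contra h0; exact hy ((hK y h0).trans hx.symm)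
        unfold Grid.E; rw [this, smul_zero]
      · exact h.E_zero G hK le_rfl hx
    have hb : ∀ (s : ℕ) x, ‖G.D (K-1-s) ψ x‖ ≤ 24*d*2^t*(1/2)^s := fun s x => by
      have e1 := h.E_near G (K-1-s) x
      have e2 := h.E_near G (K-1-s+1) x
      have e3 : TT^(K-1-s)/2^k = 8*2^t*(1/2)^s := by
        rw [show K-1-(s:ℤ) = k + ((t+3:ℕ):ℤ) - s by push_cast; omega, zpow_sub₀ NM, zpow_add₀ NM, znq, znq, one_div, inv_pow, pow_add]; field_simp; norm_num
      rw [zpow_add_one₀ NM, mul_div_right_comm] at e2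
      rw [e3] at e1 e2
      calc _ = ‖(G.E (K-1-s) ψ x - ψ x) - (G.E (K-1-s+1) ψ x - ψ x)‖ := by rw [sub_sub_sub_cancel_right]; rfl
        _ ≤ _ := (norm_sub_le _ _).trans LI
    refine ⟨fun J => if J.1 = α then G.D (K-1-J.2) ψ else 0, fun J => ⟨?_, fun x => ?_, fun x hx => ?_, fun _ x y hxy => ?_, fun _ x => ?_⟩, fun x => ?_⟩ <;> beta_reduce
    · split_ifs; exacts [G.measurable_D _ h.cont.measurable, mcq]
    · split_ifs
      · exact hb _ x
      · simp; positivity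
    · beta_reduce at hx; split_ifs at hx with hJ
      · have hx' : G.idx K x = G.idx K a := by
          by_contra h0
          exact hx (by unfold Grid.D; rw [h.E_zero G hK OM h0, h.E_zero G hK OM h0, sub_zero])
        refine (G.dist_of_idx hx').trans_eq ?_
        rw [hKd, show k+(t:ℤ)+4 = k+((t+4:ℕ):ℤ) by push_cast; ring, zpow_add₀ NM, znq]
      · simp at hx
    · split_ifs with hJ
      · rw [show k+((t,J) : Ix).1+3-((t,J) : Ix).2.2 = K-1-J.2 by simp [hKd]; ring, show grid ((t,J):Ix).2.1 = G by simp [G, hJ]] at hxy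
        exact G.D_congr _ hxy
      · rfl
    · split_ifs with hJ
      · rw [show k+((t,J) : Ix).1+3-((t,J) : Ix).2.2 = K-1-J.2 by simp [hKd]; ring, show grid ((t,J):Ix).2.1 = G by simp [G, hJ]]
        exact G.D_sib _ h.li x
      · simp
    · have hi : inz (fun s : ℕ => (α, s)) := fun a b hab => by simpa using hab
      rw [← hi.hasSum_iff (fun J hJ => by
        rw [if_neg fun h0 => hJ ⟨J.2, by rw [← h0]⟩]; rfl)]
      simp only [cdq, if_true]
      have hs : Summable fun s : ℕ => G.D (K-1-s) ψ x := Summable.of_norm_bounded ((summable_geometric_of_lt_one NM (by norm_num : HH < 1)).mul_left (24*d*2^t)) fun s => hb s x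
      rw [hs.hasSum_iff_tendsto_nat]
      have : ∀ S : ℕ, ∑ s ∈ rnq S, G.D (K-1-s) ψ x = G.E (K-S) ψ x := fun S => by rw [G.E_tele, hz, zero_add]
      simp_rw [this]
      rw [tendsto_iff_norm_sub_tendsto_zero]
      exact squeeze_zero (fun _ => nnq _) (fun S => h.E_near G _ x) (h.lim_E K x)
theorem bexp (C : ℕ → ℝ) (M : ℕ) : ∃ d : ℝ, 0 < d ∧ ∀ a (k : ℤ) φ, IsBumpAdapted C a (TT^k) φ → ∀ e : Bool, (e = true → ∫ x, φ x = 0) →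
    ∃ g : Ix → ℝ → ℂ, (∀ J, Exd e k a (d/2^(M*J.1)) J (g J)) ∧ ∀ x, HasSum (fun J => g J x) (φ x) := by
  obtain ⟨D, hD, h⟩ := pieces C (M+2)
  refine ⟨24*D, PZ, fun a k φ hφ e he => ?_⟩
  obtain ⟨ψ, h1, h2, h3⟩ := h a _ φ PZ hφ e he
  choose g h4 h5 using fun t => exp1 (h1 t) e fun e1 => h3 e1 t
  have hd : ∀ t : ℕ, 24*(D/2^((M+2)*t))*2^t = 24*D/2^(M*t)*(1/2)^t := fun t => by
    rw [show (M+2)*t = M*t+t+t by ring, pow_add, pow_add, one_div, inv_pow]; field_simp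
  refine ⟨fun J => g J.1 J.2, fun J => ?_, fun x => ?_⟩
  · have := h4 J.1 J.2
    refine ⟨this.ms, fun x => (this.bd x).trans ?_, this.sp, this.ct, this.an⟩
    rw [hd]; gcongr
    exact mul_le_of_le_one_right PZ (pow_le_one₀ NM NM)
  · have hs : Summable fun J : Ix => g J.1 J.2 x := by
      have g1 := summable_geometric_of_lt_one NM (by norm_num : HH < 1)
      have g2 : Summable fun J : Bool × ℕ => (1:ℝ) * (1/2)^J.2 := (Summable.of_finite (f := fun _ : Bool => (1:ℝ))).mul_of_nonneg g1 (fun _ => SI) (fun _ => SI)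
      have g3 : Summable fun J : Ix => HH^J.1 * (1 * (1/2)^J.2.2) := g1.mul_of_nonneg g2 (fun _ => SI) (fun _ => SI)
      refine Summable.of_norm_bounded (g3.mul_left (24*D)) fun J => ((h4 J.1 J.2).bd x).trans ?_
      rw [hd, one_mul, ← maq]
      gcongr
      exact div_le_self PZ (one_le_pow₀ NM)
    have := hs.hasSum.prod_fiberwise (g := fun t => ψ t x) fun t => h5 t x
    rw [(h2 x).unique this]; exact hs.hasSum
section
variable {a : EE}

def tag (r : Bool) (k : ℤ) : ℤ := if r = true then k else 0
def del (J : Ix) : EE := (1/2)^J.1 * (3/4)^J.2.2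
lemma geo_ne (h : a < 1) : ∑' n : ℕ, a^n ≠ ⊤ := by
  rw [tgq]; exact intq.2 (tsub_pos_of_lt h).ne'
lemma tsumIx (a b : EE) : ∑' J : Ix, a^J.1 * b^J.2.2 = (∑' n : ℕ, a^n) * (2 * ∑' n : ℕ, b^n) := by
  rw [tpq, ← tmr]
  refine tsum_congr fun t => ?_
  dsimp only
  rw [tml, tpq, tsum_fintype]; simp [two_mul]
lemma tsumIx_ne {b : EE} (h : a < 1) (h' : b < 1) : ∑' J : Ix, a^J.1 * b^J.2.2 ≠ ⊤ := by
  rw [tsumIx]; exact mnt (geo_ne h) (mnt SI (geo_ne h'))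
lemma half_lt : (1/2:EE) < 1 := SI
lemma tq_lt : (3/4:EE) < 1 := by rw [ENNReal.div_lt_iff SI SI]; norm_num
section
variable {q : ℝ} (hq : 0 < q) {C : EE} (hC : Grid.Syn q C) {ι : Type} {H : Type} [NormedAddCommGroup H] [InnerProductSpace ℂ H]
include hq hC in
lemma synJ (S : Finset ι) (k : ι → ℤ) (a : ι → ℝ) (w : ι → H) (r : Bool) (b : ℝ) (J : Ix) (g : ι → ℝ → ℂ) (h : ∀ i ∈ S, Exd r (k i) (a i) b J (g i)) :
    ∫⁻ x, ‖∑ i ∈ S, g i x • w i‖ₑ^q ≤ (C+1) * ∫⁻ x, (∑' κ : ℤ, ‖∑ i ∈ S.filter (fun i => tag r (k i) = κ), g i x • w i‖ₑ^2)^(q/2) := by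
  cases r with
  | false =>
    refine ltz ?_ (lmo (zero_le) le_add_self)
    refine lmq fun x => ?_
    refine ltz (loe ?_) (rlr (ltq (0:ℤ)) PZ)
    rw [← rnz, ← rmq]; rw [Finset.filter_true_of_mem (by simp [tag])]; congr 1; push_cast; ring
  | true =>
    set B : ℕ := ∑ i ∈ S, (k i).natAbs
    have hB : ∀ i ∈ S, (k i).natAbs ≤ B := fun i hi => Finset.single_le_sum (f := fun i => (k i).natAbs) (fun _ _ => zlq _) hi
    set c : ℤ := J.1+3-J.2.2 with hc
    set e : ℕ → ℝ → H := fun n x => ∑ i ∈ S.filter (fun i => k i = B - n), g i x • w i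
    have hk : ∀ (n : ℕ) i, i ∈ S.filter (fun i => k i = B - n) → i ∈ S ∧ k i+J.1+3-J.2.2 = B + c - n := fun n i hi => by
      rw [Finset.mem_filter] at hi; exact ⟨hi.1, by rw [hi.2, hc]; ring⟩
    have he : (grid J.2.1).Adp (B+c) e := by
      refine ⟨fun n x y hxy => scq rfl fun i hi => ?_, fun n x => ?_⟩
      · rw [(h i (hk n i hi).1).ct rfl x y (by rw [(hk n i hi).2]; exact hxy)]
      · simp only [e]; rw [← Finset.sum_neg_distrib]
        refine scq rfl fun i hi => ?_
        rw [← (hk n i hi).2, (h i (hk n i hi).1).an rfl x, neg_smul]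
    have h1 := hC (grid J.2.1) (B+c) H e (2*B+1) he
    have h2 : ∀ x, ∑ i ∈ S, g i x • w i = ∑ n ∈ rnq (2*B+1), e n x := fun x => by
      rw [← Finset.sum_fiberwise_of_maps_to (s := S) (t := rnq (2*B+1)) (g := fun i => (B - k i).toNat) fun i hi => by
        have := hB i hi; rw [mrq]; omega]
      refine scq rfl fun n hn => scq (Finset.filter_congr fun i hi => ?_) fun _ _ => rfl
      have := hB i hi; omega
    simp_rw [h2]
    refine h1.trans (mlmz le_self_add (lmq fun x => rlr ?_ PZ))
    have hi : inz fun n : ℕ => (B:ℤ) - n := fun a b hab => by simpa using hab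
    refine ltz (slt _) (ltz (loe ?_) (tcl hi _))
    rfl
include hq hC in
lemma synX (S : Finset ι) (k : ι → ℤ) (a : ι → ℝ) (w : ι → H) (r : Bool) (b : Ix → ℝ) (g : ι → Ix → ℝ → ℂ) (φ : ι → ℝ → ℂ)
    (h : ∀ i ∈ S, ∀ J, Exd r (k i) (a i) (b J) J (g i J)) (hs : ∀ i ∈ S, ∀ x, HasSum (fun J => g i J x) (φ i x)) :
    ∫⁻ x, ‖∑ i ∈ S, φ i x • w i‖ₑ^q ≤ (∑' J, del J)^q * (C+1) * ∑' J, (del J)⁻¹^q * ∫⁻ x, (∑' κ : ℤ, ‖∑ i ∈ S.filter (fun i => tag r (k i) = κ), g i J x • w i‖ₑ^2)^(q/2) := by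
  have d0 : ∀ J, del J ≠ 0 := fun J => by unfold del; simp
  have dt : ∀ J, del J ≠ ⊤ := fun J => by unfold del; finiteness
  have dS : ∑' J, del J ≠ ⊤ := tsumIx_ne half_lt tq_lt
  have m1 : ∀ J, Measurable fun x => ‖∑ i ∈ S, g i J x • w i‖ₑ := fun J => by
    refine StronglyMeasurable.enorm (Finset.stronglyMeasurable_fun_sum _ fun i hi => ?_)
    exact (h i hi J).ms.stronglyMeasurable.smul_const _
  calc _ ≤ ∫⁻ x, (∑' J, del J)^q * ∑' J, (‖∑ i ∈ S, g i J x • w i‖ₑ/del J)^q := by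
        refine lmq fun x => ltz (rlr ?_ hq.le) (tsum_rpow_le _ _ d0 dt hq)
        have : HasSum (fun J => ∑ i ∈ S, g i J x • w i) (∑ i ∈ S, φ i x • w i) := hasSum_sum fun i hi => (hs i hi x).smul_const _
        have hS : ∀ i ∈ S, Summable fun J => ‖g i J x‖ := fun i hi => (hs i hi x).summable.norm
        have hn : Summable fun J => ‖∑ i ∈ S, g i J x • w i‖ := Summable.of_nonneg_of_le (fun _ => nnq _) (fun J => norm_sum_le _ _) (summable_sum (fun i hi => by simp_rw [norm_smul]; exact (hS i hi).mul_right _))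
        rw [← onq, ← this.tsum_eq]
        refine (olo (norm_tsum_le_tsum_norm hn)).trans_eq ?_
        rw [ENNReal.ofReal_tsum_of_nonneg (fun _ => nnq _) hn]; simp_rw [onq]
    _ = (∑' J, del J)^q * ∑' J, (del J)⁻¹^q * ∫⁻ x, ‖∑ i ∈ S, g i J x • w i‖ₑ^q := by
        rw [lcmq _ _ (rnt hq.le dS), ltw fun J => (((m1 J).div_const _).pow_const q).aemeasurable]
        congr 1; refine tsum_congr fun J => ?_
        rw [← lcmq _ _ (rnt hq.le (intq.2 (d0 J)))]
        refine lintegral_congr fun x => ?_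
        rw [dem, mro _ _ hq.le, mcz]
    _ ≤ _ := by
        rw [maq]; refine mlm ?_ _
        rw [← tml]
        refine tlt fun J => ?_
        rw [mul_left_comm]
        exact mlm (synJ hq hC S k a w r (b J) J _ fun i hi => h i hi J) _
end
end

def Vv {ι : Type} (S : Finset ι) (τ : ι → ℤ) (v : ι → ℂ) (i : ι) : EuclideanSpace ℂ (S.image τ) := WithLp.toLp 2 fun κ => if τ i = κ then v i else 0
lemma eucl {ι : Type} {U S : Finset ι} (hU : U ⊆ S) (τ : ι → ℤ) (v x : ι → ℂ) :
    ‖∑ i ∈ U, x i • Vv S τ v i‖ₑ^2 = ∑' κ : ℤ, ‖∑ i ∈ U.filter (fun i => τ i = κ), x i * v i‖ₑ^2 := by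
  rw [tsum_eq_sum (s := S.image τ) fun κ hκ => by
    rw [Finset.filter_false_of_mem fun i hi h => hκ (Finset.mem_image.2 ⟨i, hU hi, h⟩)]; simp]
  rw [← Finset.sum_coe_sort (S.image τ), ← onq, ← opq (nnq _), EuclideanSpace.norm_sq_eq, oso fun _ _ => PZ]
  refine scq rfl fun κ _ => ?_
  rw [opq (nnq _), onq]
  congr 2
  rw [WithLp.ofLp_sum, Finset.sum_apply, Finset.sum_filter]
  refine scq rfl fun i _ => ?_
  simp [Vv]
section
variable {q : ℝ} (hq : 0 < q) {C : EE} (hC : Grid.Syn q C) (hCt : C ≠ ⊤) {ι : Type}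
lemma sq_rpow_half (x : EE) (q : ℝ) : (x^2)^(q/2) = x^q := by
  rw [← rnz, ← rmq]; congr 1; push_cast; ring
def Ff (S : Finset ι) (k j : ι → ℤ) (r r' : Bool) (h : ι → ℂ) : EE :=
  ∑' κ : ℤ, ∑' κ' : ℤ, ‖∑ i ∈ (S.filter (fun i => tag r (k i) = κ)).filter (fun i => tag r' (j i) = κ'), h i‖ₑ^2
include hq hC hCt in
lemma syn2 (S : Finset ι) (k j : ι → ℤ) (a c : ι → ℝ) (w : ι → ℂ) (r r' : Bool) (b b' : Ix → ℝ) (g g' : ι → Ix → ℝ → ℂ) (φ χ : ι → ℝ → ℂ)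
    (h : ∀ i ∈ S, ∀ J, Exd r (k i) (a i) (b J) J (g i J)) (hs : ∀ i ∈ S, ∀ x, HasSum (fun J => g i J x) (φ i x))
    (h' : ∀ i ∈ S, ∀ J, Exd r' (j i) (c i) (b' J) J (g' i J)) (hs' : ∀ i ∈ S, ∀ x, HasSum (fun J => g' i J x) (χ i x))
    (hφ : ∀ i ∈ S, Measurable (φ i)) (hχ : ∀ i ∈ S, Measurable (χ i)) :
    ∫⁻ z : RR, ‖∑ i ∈ S, w i * φ i z.1 * χ i z.2‖ₑ^q ≤ ((∑' J, del J)^q * (C+1))^2 * ∑' J', (del J')⁻¹^q * ∑' J, (del J)⁻¹^q *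
      ∫⁻ z : RR, Ff S k j r r' (fun i => w i * g i J z.1 * g' i J' z.2)^(q/2) := by
  set Λ := (∑' J, del J)^q * (C+1) with hΛ
  have Λt : Λ ≠ ⊤ := mnt (rnt hq.le (tsumIx_ne half_lt tq_lt)) FI
  have d0 : ∀ J, (del J)⁻¹^q ≠ ⊤ := fun J => rnt hq.le (intq.2 (by unfold del; simp))
  have mm : ∀ {U : Finset ι} {u v : ι → ℝ → ℂ}, U ⊆ S → (∀ i ∈ S, Measurable (u i)) → (∀ i ∈ S, Measurable (v i)) → Measurable fun z : RR => ‖∑ i ∈ U, w i * u i z.1 * v i z.2‖ₑ := fun hU hu hv =>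
    (Finset.measurable_fun_sum _ fun i hi => (((hu i (hU hi)).comp mfq).const_mul _).mul ((hv i (hU hi)).comp msz)).enorm
  set G : Ix → RR → EE := fun J' z => (∑' κ' : ℤ, ‖∑ i ∈ S.filter (fun i => tag r' (j i) = κ'), w i * φ i z.1 * g' i J' z.2‖ₑ^2)^(q/2) with hG
  have mG : ∀ J', Measurable (G J') := fun J' => (Measurable.tsum fun κ' => (mm (fsq _ _) hφ fun i hi => (h' i hi J').ms).pow_const 2).pow_const _
  have mF : ∀ J J', Measurable fun z : RR => Ff S k j r r' (fun i => w i * g i J z.1 * g' i J' z.2)^(q/2) := fun J J' =>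
    (Measurable.tsum fun κ => Measurable.tsum fun κ' => (mm ((fsq _ _).trans (fsq _ _)) (fun i hi => (h i hi J).ms) fun i hi => (h' i hi J').ms).pow_const 2).pow_const _
  have s1 : ∀ x, ∫⁻ y, ‖∑ i ∈ S, w i * φ i x * χ i y‖ₑ^q ≤ Λ * ∑' J', (del J')⁻¹^q * ∫⁻ y, G J' (x, y) := fun x => by
    have := synX hq hC S j c (fun i => w i * φ i x) r' b' g' χ h' hs'
    rw [← hΛ] at this
    simpa only [smul_eq_mul, mcz (χ _ _), mcz (g' _ _ _), hG] using this
  have s2 : ∀ J' y, ∫⁻ x, G J' (x, y) ≤ Λ * ∑' J, (del J)⁻¹^q * ∫⁻ x, Ff S k j r r' (fun i => w i * g i J x * g' i J' y)^(q/2) := fun J' y => by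
    have := synX hq hC S k a (Vv S (fun i => tag r' (j i)) fun i => w i * g' i J' y) r b g φ h hs
    convert this using 2
    · ext x
      rw [← sq_rpow_half, eucl subset_rfl]
      simp only [hG, maq, mul_left_comm (w _)]
    · refine tsum_congr fun J => ?_
      congr 1; refine lintegral_congr fun x => ?_
      congr 1; unfold Ff; refine tsum_congr fun κ => ?_
      rw [eucl (fsq _ _)]
      simp only [maq, mul_left_comm (w _)]
  rw [lint_snd ((mm subset_rfl hφ hχ).pow_const q)]
  refine (lmq s1).trans ?_
  rw [lcmq _ _ Λt, ltw fun J' => ((mG J').lintegral_prod_right'.const_mul _).aemeasurable, sq Λ, maq Λ]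
  refine mlm ?_ _
  rw [← tml]
  refine tlt fun J' => ?_
  rw [lcmq _ _ (d0 J'), ← lint_snd (mG J'), lint_fst (mG J'), mul_left_comm]
  refine mlm ((lmq (s2 J')).trans_eq ?_) _
  rw [lcmq _ _ Λt, ltw fun J => ((mF J J').lintegral_prod_left'.const_mul _).aemeasurable]
  congr 1; refine tsum_congr fun J => ?_
  rw [lcmq _ _ (d0 J), lint_fst (mF J J')]
end
section
variable {r r' : Bool}

lemma sq_half (x : EE) : (x^HH)^2 = x := by rw [← rnz, ← rmq]; norm_num
lemma half_sq (x : EE) : (x^2)^HH = x := by rw [← rnz, ← rmq]; norm_num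
lemma le_half {x y : EE} (h : x^2 ≤ y) : x ≤ y^HH := by
  have := rlr h (by norm_num : (0:ℝ) ≤ 1/2)
  rwa [half_sq] at this
lemma cs_tsum' {ι : Type*} (a b : ι → EE) : (∑' i, a i * b i)^2 ≤ (∑' i, a i^2) * ∑' i, b i^2 := by
  letI : MeasurableSpace ι := ⊤
  have m : ∀ f : ι → EE, Measurable f := fun f => measurable_from_top
  have h1 := lmn (μ := Measure.count) (m fun i => a i^2).aemeasurable (m fun i => b i^2).aemeasurable (by norm_num : (0:ℝ) ≤ 1/2) (by norm_num : (0:ℝ) ≤ 1/2) NM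
  simp_rw [half_sq, lintegral_count' (m _)] at h1
  refine (plpq h1 2).trans_eq ?_
  rw [mul_pow, sq_half, sq_half]
def T1 (e : Bool) (X : ℤ → EE) (k : ℤ) : EE := ∑' k', chi e k k' * X k'
lemma chi_le (e : Bool) (k k' : ℤ) : chi e k k' ≤ 1 := by unfold chi; split_ifs <;> simp
lemma T1_le (e : Bool) (X : ℤ → EE) (k : ℤ) : T1 e X k ≤ ∑' k', X k' := tlt fun k' => mul_le_of_le_one_left zero_le (chi_le e k k')
lemma T1_true (X : ℤ → EE) (k : ℤ) : T1 true X k = X k := by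
  unfold T1; rw [tsum_eq_single k fun b hb => by simp [chi, hb]]; simp [chi]
def Us (r : Bool) (h : ℤ → EE) : EE := if r = true then ∑' k, h k^2 else (∑' k, h k)^2
def Cnd {l : ℕ} (r : Bool) (e : Fin l → Bool) : Prop := if r = true then ∃ i, e i = true else ∃ i i', i ≠ i' ∧ e i = true ∧ e i' = true
section
variable {l : ℕ}
lemma hold1 {e : Fin l → Bool} (hc : Cnd r e) (X A : Fin l → ℤ → EE) (hA : ∀ i k, A i k^2 ≤ T1 (e i) (X i) k) :
    Us r (fun k => ∏ i, A i k) ≤ ∏ i, ∑' k, X i k := by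
  have hA' : ∀ i k, A i k^2 ≤ ∑' k', X i k' := fun i k => (hA i k).trans (T1_le _ _ _)
  have hAe : ∀ i, e i = true → ∀ k, A i k^2 ≤ X i k := fun i hi k => by have := hA i k; rwa [hi, T1_true] at this
  unfold Us; unfold Cnd at hc
  split_ifs at hc ⊢
  · obtain ⟨i, hi⟩ := hc
    rw [← mpe _ _ (muq i), ← tmr]
    refine tlt fun k => ?_
    beta_reduce
    rw [← mpe _ _ (muq i), mul_pow, ← Finset.prod_pow]
    exact mlmz (hAe i hi k) (plp fun j _ => hA' j k)
  · obtain ⟨i, i', hne, hi, hi'⟩ := hc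
    have hm : i' ∈ Finset.univ.erase i := Finset.mem_erase.2 ⟨hne.symm, muq _⟩
    set P := ∏ j ∈ (Finset.univ.erase i).erase i', ∑' k, X j k
    have : ∑' k, ∏ j, A j k ≤ (∑' k, A i k * A i' k) * P^HH := by
      rw [← tmr]
      refine tlt fun k => ?_
      rw [← mpe _ _ (muq i), ← mpe _ _ hm, ← maq]
      refine mlm (le_half ?_) _
      rw [← Finset.prod_pow]; exact plp fun j _ => hA' j k
    refine (plpq this 2).trans ?_
    rw [mul_pow, sq_half, ← mpe _ _ (muq i), ← mpe _ _ hm, ← maq]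
    refine mlmq ((cs_tsum' _ _).trans ?_) _
    exact mlmz (tlt (hAe i hi)) (tlt (hAe i' hi'))
def U2 (r r' : Bool) (h : ℤ × ℤ → EE) : EE :=
  if r = true then ∑' k, Us r' (fun j => h (k, j)) else if r' = true then ∑' j, (∑' k, h (k, j))^2 else (∑' k, ∑' j, h (k, j))^2
lemma hold_aux (hr : r' = true → r = true) {e e' : Fin l → Bool} (hc : Cnd r e) (hc' : Cnd r' e') (X A : Fin l → ℤ × ℤ → EE)
    (hA : ∀ i K, A i K^2 ≤ Tt (e i) (e' i) (X i) K) : U2 r r' (fun K => ∏ i, A i K) ≤ ∏ i, ∑' K, X i K := by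
  have h1 : ∀ k, Us r' (fun j => ∏ i, A i (k, j)) ≤ ∏ i, T1 (e i) (fun k' => ∑' j', X i (k', j')) k := fun k => by
    refine (hold1 hc' (fun i j' => ∑' k', chi (e i) k k' * X i (k', j')) (fun i j => A i (k, j)) fun i j => (hA i (k, j)).trans_eq ?_).trans_eq ?_
    · unfold Tt T1; rw [tpq, tcq]
      refine tsum_congr fun j' => ?_
      rw [← tml]; exact tsum_congr fun k' => by dsimp only; ring
    · refine pcq rfl fun i _ => ?_
      unfold T1; rw [tcq]; simp_rw [tml]
  have h2 := hold1 hc (fun i k' => ∑' j', X i (k', j')) (fun i k => T1 (e i) (fun k' => ∑' j', X i (k', j')) k^HH) fun i k => (sq_half _).le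
  simp_rw [tpq]
  refine ltz ?_ h2
  unfold U2; beta_reduce
  split_ifs with hh hh'
  · rw [hh, Us, if_pos rfl]
    refine tlt fun k => ?_
    refine (h1 k).trans_eq ?_
    rw [← Finset.prod_pow]; simp_rw [sq_half]
  · exact absurd (hr hh') hh
  · rw [Us, if_neg hh]
    refine plpq (tlt fun k => ?_) 2
    rw [ENNReal.prod_rpow_of_nonneg NM]
    refine le_half ?_
    have := h1 k; unfold Us at this; rwa [if_neg hh'] at this
lemma hold2 {e e' : Fin l → Bool} (hc : Cnd r e) (hc' : Cnd r' e') (X A : Fin l → ℤ × ℤ → EE)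
    (hA : ∀ i K, A i K^2 ≤ Tt (e i) (e' i) (X i) K) : U2 r r' (fun K => ∏ i, A i K) ≤ ∏ i, ∑' K, X i K := by
  by_cases hr : r' = true → r = true
  · exact hold_aux hr hc hc' X A hA
  · push Not at hr
    have := hold_aux (r := r') (r' := r) (fun h => absurd h hr.2) hc' hc (fun i K => X i K.swap) (fun i K => A i K.swap) fun i K => (hA i K.swap).trans_eq ?_
    · have e1 : ∀ i, ∑' K : ℤ × ℤ, X i K.swap = ∑' K, X i K := fun i => (Equiv.prodComm ℤ ℤ).tsum_eq (X i)
      simp_rw [e1] at this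
      refine ltz (loe ?_) this
      unfold U2 Us; simp [hr.1, hr.2]
    · unfold Tt; rw [← (Equiv.prodComm ℤ ℤ).tsum_eq]
      exact tsum_congr fun J => by simp [mcz (chi (e i) _ _)]
end
lemma Us_tag (r : Bool) (h : ℤ → EE) : ∑' κ : ℤ, (∑' k : ℤ, if tag r k = κ then h k else 0)^2 = Us r h := by
  unfold Us tag
  split_ifs with hr
  · refine tsum_congr fun κ => ?_
    rw [tsum_ite_eq]
  · rw [tsum_eq_single 0 fun b hb => by simp [hb.symm]]; simp
lemma U2_tag (r r' : Bool) (h : ℤ × ℤ → EE) : ∑' κ : ℤ, ∑' κ' : ℤ, (∑' K : ℤ × ℤ, if tag r K.1 = κ ∧ tag r' K.2 = κ' then h K else 0)^2 = U2 r r' h := by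
  have : ∀ κ κ' : ℤ, (∑' K : ℤ × ℤ, if tag r K.1 = κ ∧ tag r' K.2 = κ' then h K else 0) = ∑' j : ℤ, if tag r' j = κ' then (∑' k : ℤ, if tag r k = κ then h (k, j) else 0) else 0 := fun κ κ' => by
    rw [tpq, tcq]
    refine tsum_congr fun j => ?_
    split_ifs with hj <;> simp [hj]
  simp_rw [this, Us_tag]
  unfold U2
  split_ifs with h1 h2
  · refine tsum_congr fun κ => ?_
    congr 1; ext j; simp [tag, h1]
  · rw [tsum_eq_single 0 fun b hb => by simp [tag, h1, hb.symm, Us]]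
    simp [tag, h1, h2, Us]
  · rw [tsum_eq_single 0 fun b hb => by simp [tag, h1, hb.symm, Us]]
    simp only [tag, h1, Us, if_false, if_true, h2]
    rw [tcq]; simp
end

abbrev Rc := (ℤ × ℤ) × (ℤ × ℤ)
def nr (k : ℤ) (τ : ℕ) (x : ℝ) (m : ℤ) : EE := if |x - TT^k*m| ≤ 2^k*2^τ then 1 else 0
lemma count (k : ℤ) (τ : ℕ) (x : ℝ) : ∑' m : ℤ, nr k τ x m ≤ 2^(τ+2) := by
  have h2 : (0:ℝ) < 2^k := PZ
  set y := x/2^k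
  rw [tsum_eq_sum (s := icq (⌊y⌋ - 2^τ) (⌊y⌋ + 2^τ + 1)) (f := nr k τ x) fun m hm => if_neg fun h => hm ?_]
  · refine (Finset.sum_le_card_nsmul _ _ 1 fun m _ => by unfold nr; split_ifs <;> simp).trans ?_
    rw [Int.card_Icc, show ⌊y⌋ + 2^τ + 1 + 1 - (⌊y⌋ - 2^τ) = ((2^(τ+1) + 2 : ℕ) : ℤ) by push_cast; ring, Int.toNat_natCast]
    simp only [nsmul_eq_mul, mul_one]
    exact_mod_cast (by rw [pow_add, pow_add]; have := Nat.one_le_two_pow (n := τ); omega : 2^(τ+1) + 2 ≤ 2^(τ+2))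
  · have e : |y - m| ≤ 2^τ := by
      rw [show x - TT^k*m = 2^k*(y-m) by rw [mul_sub, mul_div_cancel₀ _ h2.ne'], abs_mul, aop h2] at h
      exact le_of_mul_le_mul_left h h2
    obtain ⟨e1, e2⟩ := abs_le.1 e
    have f1 := Int.floor_le y
    have f2 := Int.lt_floor_add_one y
    rw [miq]; constructor
    · exact_mod_cast (by push_cast; linarith : ((⌊y⌋ - 2^τ : ℤ):ℝ) ≤ m)
    · exact_mod_cast (by push_cast; linarith : (m:ℝ) ≤ ((⌊y⌋ + 2^τ + 1 : ℤ):ℝ))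
lemma sumR (S : Finset Rc) (r r' : Bool) (κ κ' : ℤ) (v : Rc → ℂ) (h : ℤ × ℤ → EE) (B : EE) (τ τ' : ℕ) (z : RR)
    (hv : ∀ R ∈ S, ‖v R‖ₑ ≤ B * (nr R.1.1 τ z.1 R.1.2 * nr R.2.1 τ' z.2 R.2.2 * h (R.1.1, R.2.1))) :
    ‖∑ i ∈ (S.filter (fun i => tag r i.1.1 = κ)).filter (fun i => tag r' i.2.1 = κ'), v i‖ₑ ≤ B * (2^(τ+2) * 2^(τ'+2)) * ∑' K : ℤ × ℤ, if tag r K.1 = κ ∧ tag r' K.2 = κ' then h K else 0 := by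
  rw [Finset.filter_filter, maq]
  refine (enorm_sum_le _ _).trans ?_
  refine (sls (g := fun R => B * (nr R.1.1 τ z.1 R.1.2 * (nr R.2.1 τ' z.2 R.2.2 * if tag r R.1.1 = κ ∧ tag r' R.2.1 = κ' then h (R.1.1, R.2.1) else 0))) fun R hR => ?_).trans ?_
  · obtain ⟨h1, h2⟩ := Finset.mem_filter.1 hR
    rw [if_pos h2, ← maq (nr _ _ _ _)]; exact hv R h1
  · rw [← msq]
    refine mlm ((slt _).trans ?_) _
    rw [tpq, tpq, tpq, ← tml]
    refine tlt fun k => ?_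
    simp_rw [tml]
    rw [tmr, maq]
    refine mlmz (count k τ z.1) ?_
    rw [tpq, ← tml]
    refine tlt fun j => ?_
    have := mlmq (count j τ' z.2) (if tag r k = κ ∧ tag r' j = κ' then h (k, j) else 0)
    rwa [← tmr] at this
lemma Ff_le (S : Finset Rc) (r r' : Bool) (v : Rc → ℂ) (h : ℤ × ℤ → EE) (B : EE) (τ τ' : ℕ) (z : RR)
    (hv : ∀ R ∈ S, ‖v R‖ₑ ≤ B * (nr R.1.1 τ z.1 R.1.2 * nr R.2.1 τ' z.2 R.2.2 * h (R.1.1, R.2.1))) :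
    Ff S (fun R => R.1.1) (fun R => R.2.1) r r' v ≤ (B * (2^(τ+2) * 2^(τ'+2)))^2 * U2 r r' h := by
  rw [← U2_tag, ← tml]; unfold Ff
  refine tlt fun κ => ?_
  rw [← tml]
  refine tlt fun κ' => ?_
  rw [← mul_pow]; exact plpq (sumR S r r' κ κ' v h B τ τ' z hv) 2
section
variable {q : ℝ}

section
variable {l : ℕ} (C : ℕ → ℝ) (S : Finset Rc) (n : Fin l → ℤ × ℤ) (Lx Ly : Fin l → ℕ) (φ χ : Fin l → Rc → ℝ → ℂ) (e e' : Fin l → Bool) (f : Fin l → RR → ℂ) (w : Rc → ℂ)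
structure Dat : Prop where
  nx : ∀ i, |((n i).1:ℝ)| ≤ 2^Lx i
  ny : ∀ i, |((n i).2:ℝ)| ≤ 2^Ly i
  bx : ∀ i, ∀ R ∈ S, IsBumpAdapted C (TT^R.1.1*((R.1.2+(n i).1:ℤ):ℝ)) (TT^R.1.1) (φ i R)
  bY : ∀ i, ∀ R ∈ S, IsBumpAdapted C (TT^R.2.1*((R.2.2+(n i).2:ℤ):ℝ)) (TT^R.2.1) (χ i R)
  zx : ∀ i, e i = true → ∀ R ∈ S, ∫ x, φ i R x = 0
  zy : ∀ i, e' i = true → ∀ R ∈ S, ∫ x, χ i R x = 0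
  mf : ∀ i, Measurable (f i)
  bf : ∃ b, ∀ i z, ‖f i z‖ ≤ b
  hw : ∀ R ∈ S, ‖w R‖ₑ ≤ ∏ i, (Grid.len R.1.1 * Grid.len R.2.1)⁻¹ * ‖∫ z : RR, f i z * CJ (φ i R z.1 * χ i R z.2)‖ₑ
variable {C S n Lx Ly φ χ e e' f w}
lemma nr_of {k m : ℤ} {τ : ℕ} {x : ℝ} (h : |x - TT^k*m| ≤ 2^k*2^τ) : nr k τ x m = 1 := if_pos h
lemma rpc (a : EE) (q : ℝ) (n : ℕ) : (a^q)^n = (a^n)^q := by rw [← rnz, ← rnz, ← rmq, ← rmq, mcz]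
lemma gam (hq : 0 < q) {d : ℝ} (d0 : 0 < d) : ∑' J : Ix, ((del J)⁻¹ * (ofq (d/2^((2*l+3)*J.1)*(1/2)^J.2.2) * 2^(J.1+6) * (4^(J.1+4))^l))^q ≠ ⊤ := by
  have dl0 : ∀ J, del J ≠ 0 := fun J => by unfold del; simp
  have h1 : ∀ J, ((del J)⁻¹ * (ofq (d/2^((2*l+3)*J.1)*(1/2)^J.2.2) * 2^(J.1+6) * (4^(J.1+4))^l))^q ≤ ofq (d*2^6*4^(4*l))^q * (((1/2)^q)^J.1 * ((3/4)^q)^J.2.2) := fun J => by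
    rw [rpc, rpc, ← mro _ _ hq.le, ← mro _ _ hq.le]
    refine rlr ?_ hq.le
    rw [ENNReal.inv_mul_le_iff (dl0 J) (by unfold del; finiteness)]
    have c2 : ofq (1/2) = 1/2 := by rw [odo NM]; simp
    have c3 : ofq (3/4) = 3/4 := by rw [odo NM]; simp
    have e1 : ofq (d/2^((2*l+3)*J.1)*(1/2)^J.2.2) * 2^(J.1+6) * (4^(J.1+4))^l = ofq (d/2^((2*l+3)*J.1)*(1/2)^J.2.2 * 2^(J.1+6) * (4^(J.1+4))^l) := by
      have hX : 0 ≤ d/2^((2*l+3)*J.1)*(1/2)^J.2.2 := PZ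
      generalize d/2^((2*l+3)*J.1)*(1/2)^J.2.2 = X at hX
      rw [omq PZ, omq hX, opq PZ, opq NM, opq NM]; simp
    have e2 : del J * (ofq (d*2^6*4^(4*l)) * ((1/2)^J.1 * (3/4)^J.2.2)) = ofq ((1/2)^J.1 * (3/4)^J.2.2 * (d*2^6*4^(4*l) * ((1/2)^J.1 * (3/4)^J.2.2))) := by
      have hA : 0 ≤ d*2^6*4^(4*l) := PZ
      generalize d*2^6*4^(4*l) = A at hA
      rw [omq (p := (1/2)^J.1 * (3/4)^J.2.2) PZ, omq (p := (1/2)^J.1) PZ, omq (p := A) PZ, omq (p := (1/2)^J.1) PZ, opq NM, opq NM, c2, c3]; rfl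
    rw [e1, e2]
    refine olo ?_
    have e3 : d/2^((2*l+3)*J.1)*(1/2)^J.2.2 * 2^(J.1+6) * (4^(J.1+4))^l = d*2^6*4^(4*l)*((1/2)^J.1*(1/2)^J.1)*(1/2)^J.2.2 := by
      rw [show (4:ℝ) = 2^2 by norm_num, one_div, inv_pow, inv_pow, ← pow_mul, ← pow_mul, ← pow_mul, show 2*((J.1+4)*l) = 2*l*J.1 + 2*(4*l) by ring, show (2*l+3)*J.1 = 2*l*J.1 + (J.1+J.1+J.1) by ring, pow_add, pow_add, pow_add, pow_add, pow_add]; field_simp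
    rw [e3]
    have e4 : (HH)^J.2.2 ≤ (3/4)^J.2.2*(3/4)^J.2.2 := by rw [← mul_pow]; gcongr; norm_num
    calc _ ≤ d*2^6*4^(4*l)*((1/2)^J.1*(1/2)^J.1)*((3/4)^J.2.2*(3/4)^J.2.2) := by gcongr
      _ = _ := RG
  refine nto ?_ (tlt h1)
  rw [tml]
  exact mnt FI (tsumIx_ne (ENNReal.rpow_lt_one half_lt hq) (ENNReal.rpow_lt_one tq_lt hq))
set_option maxHeartbeats 1000000 in
theorem mainB (C : ℕ → ℝ) {P : Fin l → ℝ} (hP : ∀ i, 1 < P i) (hq : 0 < q) (hs : ∑ i, q / P i = 1) : ∃ K : EE, K ≠ ⊤ ∧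
    ∀ S n Lx Ly φ χ e e' f w, Dat C S n Lx Ly φ χ e e' f w → (∀ i, ∫⁻ z, ‖f i z‖ₑ^P i ≠ ⊤) → ∀ r r', Cnd r e → Cnd r' e' → ∀ φ0 χ0 : Rc → ℝ → ℂ,
    (∀ R ∈ S, IsBumpAdapted C (TT^R.1.1*R.1.2) (TT^R.1.1) (φ0 R) ∧ (r = true → ∫ x, φ0 R x = 0)) →
    (∀ R ∈ S, IsBumpAdapted C (TT^R.2.1*R.2.2) (TT^R.2.1) (χ0 R) ∧ (r' = true → ∫ x, χ0 R x = 0)) →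
    ∫⁻ z : RR, ‖∑ R ∈ S, w R * φ0 R z.1 * χ0 R z.2‖ₑ^q ≤ K * ∏ i, (((Lx i:EE)+3)^2*((Ly i:EE)+3)^2)^q * (∫⁻ z, ‖f i z‖ₑ^P i)^(q/P i) := by
  obtain ⟨D, hD⟩ := ana2 C
  choose Ka Kt hK using fun i => anaN D (hP i)
  obtain ⟨d, d0, hd⟩ := bexp C (2*l+3)
  obtain ⟨Cq, Ct, hC⟩ := Grid.syn hq
  have P0 : ∀ i, 0 < P i := fun i => zero_lt_one.trans (hP i)
  set β : Ix → EE := fun J => ofq (d/2^((2*l+3)*J.1)*(1/2)^J.2.2) with hβ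
  set Γ : Ix → EE := fun J => ((del J)⁻¹ * (β J * 2^(J.1+6) * (4^(J.1+4))^l))^q with hΓ
  have hΓt : ∑' J, Γ J ≠ ⊤ := gam hq d0
  set Λ := (∑' J, del J)^q * (Cq+1) with hΛ
  have Λt : Λ ≠ ⊤ := mnt (rnt hq.le (tsumIx_ne half_lt tq_lt)) FI
  refine ⟨Λ^2 * ((∑' J, Γ J) * (∑' J, Γ J)) * ∏ i, Ka i^(q/P i), ?_, fun S n Lx Ly φ χ e e' f w H hf r r' hc hc' φ0 χ0 h0 h0' => ?_⟩
  · have : ∏ i, Ka i^(q/P i) ≠ ⊤ := ENNReal.prod_ne_top fun i _ => rnt (by have := P0 i; positivity) (Kt i)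
    finiteness
  choose! g G1 G2 using fun R hR => hd _ _ _ (h0 R hR).1 r (h0 R hR).2
  choose! g' G1' G2' using fun R hR => hd _ _ _ (h0' R hR).1 r' (h0' R hR).2
  obtain ⟨b, hb⟩ := H.bf
  set Q := ∏ i, (((Lx i:EE)+3)^2*((Ly i:EE)+3)^2)^q * (∫⁻ z, ‖f i z‖ₑ^P i)^(q/P i) with hQ
  have per : ∀ J J', (del J')⁻¹^q * ((del J)⁻¹^q * ∫⁻ z : RR, Ff S (fun R => R.1.1) (fun R => R.2.1) r r' (fun R => w R * g R J z.1 * g' R J' z.2)^(q/2)) ≤ Γ J' * (Γ J * ((∏ i, Ka i^(q/P i)) * Q)) := fun J J' => by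
    set a : Fin l → Par := fun i => ⟨(n i).1, J.1+4, Lx i⟩ with ha
    set c : Fin l → Par := fun i => ⟨(n i).2, J'.1+4, Ly i⟩ with hcp
    set X : Fin l → RR → EE := fun i z => ∑' K, Xf D (e i) (e' i) (a i) (c i) (f i) z K with hX
    have mX : ∀ i, Measurable (X i) := fun i => measurable_Xf D _ _ _ _ (H.mf i)
    set B := β J * β J' * (2^(J.1+4+2) * 2^(J'.1+4+2)) with hB
    have p1 : ∀ z, Ff S (fun R => R.1.1) (fun R => R.2.1) r r' (fun R => w R * g R J z.1 * g' R J' z.2) ≤ B^2 * ∏ i, X i z := fun z => by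
      set A : Fin l → ℤ × ℤ → EE := fun i K => ∑' Y, ka D (e i) (e' i) (a i) (c i) Y * Bt (a i) (c i) (f i) Y.1 Y.2 K.1 K.2 z with hA
      have hA2 : ∀ i K, A i K^2 ≤ Tt (e i) (e' i) (Xf D (e i) (e' i) (a i) (c i) (f i) z) K := fun i K => dom D _ _ _ _ _ z K.1 K.2
      have hh := hold2 hc hc' (fun i => Xf D (e i) (e' i) (a i) (c i) (f i) z) A hA2
      clear_value A
      refine ltz (Ff_le S r r' _ (fun K => ∏ i, A i K) (β J * β J') (J.1+4) (J'.1+4) z fun R hR => ?_) (mlm hh _)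
      by_cases hg : g R J z.1 = 0
      · simp [hg]
      by_cases hg' : g' R J' z.2 = 0
      · simp [hg']
      have s1 := (G1 R hR J).sp _ hg
      have s2 := (G1' R hR J').sp _ hg'
      rw [nr_of s1, nr_of s2, enorm_mul, enorm_mul, one_mul, one_mul, maq, mcz]
      refine mlmz (mlmz ?_ ?_) ((H.hw R hR).trans (plp fun i _ => ?_))
      · rw [← onq]; exact olo ((G1 R hR J).bd _)
      · rw [← onq]; exact olo ((G1' R hR J').bd _)
      · rw [ENNReal.inv_mul_le_iff (mul_ne_zero (Grid.len_ne_zero _) (Grid.len_ne_zero _)) (mnt (Grid.len_ne_top _) (Grid.len_ne_top _))]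
        rw [hA]; exact hD (a i) (c i) _ _ _ _ z _ _ (e i) (e' i) (H.nx i) (H.ny i) (H.bx i R hR) (H.bY i R hR) (fun h => H.zx i h R hR) (fun h => H.zy i h R hR) s1 s2 (f i) b (H.mf i) (hb i)
    have p2 : ∫⁻ z : RR, Ff S (fun R => R.1.1) (fun R => R.2.1) r r' (fun R => w R * g R J z.1 * g' R J' z.2)^(q/2) ≤ B^q * ∏ i, (Ka i * WW (a i) (c i)^P i * ∫⁻ z, ‖f i z‖ₑ^P i)^(q/P i) := by
      calc _ ≤ ∫⁻ z, B^q * ∏ i, ((X i z^HH)^P i)^(q/P i) := by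
            refine lmq fun z => (rlr (p1 z) PZ).trans_eq ?_
            rw [mro _ _ PZ, sq_rpow_half, ← ENNReal.prod_rpow_of_nonneg PZ]
            congr 1; refine pcq rfl fun i _ => ?_
            rw [← rmq, ← rmq]; congr 1
            have := (P0 i).ne'; field_simp
        _ = B^q * ∫⁻ z, ∏ i, ((X i z^HH)^P i)^(q/P i) := lcmq _ _ (by simp only [hB, hβ]; finiteness)
        _ ≤ _ := by
            refine mlm ((ENNReal.lintegral_prod_norm_pow_le _ (fun i _ => (((mX i).pow_const _).pow_const _).aemeasurable) hs fun i _ => by have := P0 i; positivity).trans (plp fun i _ => rlr ?_ (by have := P0 i; positivity))) _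
            exact hK i (a i) (c i) (e i) (e' i) (f i) b (H.nx i) (H.ny i) (H.mf i) (hb i) (hf i)
    refine (mlm (mlm p2 _) _).trans_eq ?_
    have p3 : ∀ i, (Ka i * WW (a i) (c i)^P i * ∫⁻ z, ‖f i z‖ₑ^P i)^(q/P i) = (4^(J.1+4) * 4^(J'.1+4))^q * (Ka i^(q/P i) * ((((Lx i:EE)+3)^2*((Ly i:EE)+3)^2)^q * (∫⁻ z, ‖f i z‖ₑ^P i)^(q/P i))) := fun i => by
      have h1 : 0 ≤ q/P i := by have := P0 i; positivity
      rw [mro _ _ h1, mro _ _ h1, ← rmq, mul_div_cancel₀ _ (P0 i).ne', WW, maq (4^(a i).τ * 4^(c i).τ), mro _ _ hq.le]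
      ring
    simp_rw [p3]
    rw [pmd, pmd, ← hQ, pcz, Finset.card_univ, Fintype.card_fin]
    simp only [hΓ, hB, mro _ _ hq.le, mul_pow]
    rw [rpc, rpc]
    ring
  refine (syn2 hq hC Ct S _ _ _ _ w r r' _ _ g g' φ0 χ0 G1 G2 G1' G2' (fun R hR => (h0 R hR).1.1.continuous.measurable) fun R hR => (h0' R hR).1.1.continuous.measurable).trans ?_
  rw [← hΛ, maq (Λ^2), maq (Λ^2)]
  refine mlm ?_ _
  calc _ ≤ ∑' J', ∑' J, Γ J' * (Γ J * ((∏ i, Ka i^(q/P i)) * Q)) := tlt fun J' => by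
        rw [← tml]; exact tlt fun J => per J J'
    _ = _ := by
        simp_rw [tml, tmr]; ring
end
end

section
variable {l : ℕ}
lemma bump_bd {C : ℕ → ℝ} {a L : ℝ} {φ : ℝ → ℂ} (h : IsBumpAdapted C a L φ) (x : ℝ) : ‖φ x‖ ≤ C 0 := by
  simpa using h.2 0 NM 0 x
def wt (φ χ : Fin l → Rc → ℝ → ℂ) (f : Fin l → RR → ℂ) (R : Rc) : ℂ :=
  ∏ i, ((TT^R.1.1*TT^R.2.1 : ℝ) : ℂ)⁻¹ * ∫ z : RR, f i z * CJ (φ i R z.1 * χ i R z.2)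
def tr (N : ℕ) (f : RR → ℂ) (z : RR) : ℂ := if ‖f z‖ ≤ N then f z else 0
lemma tr_le (N : ℕ) (f : RR → ℂ) (z : RR) : ‖tr N f z‖ ≤ ‖f z‖ := by
  unfold tr; split_ifs <;> simp
lemma tr_tend {P : ℝ} (hP : 1 < P) {f : RR → ℂ} (hf : Measurable f) (h : ∫⁻ z, ‖f z‖ₑ^P ≠ ⊤) {g k : ℝ → ℂ} {b : ℝ} (hg : Integrable g) (hk : Integrable k) (bg : ∀ x, ‖g x‖ ≤ b) (bk : ∀ x, ‖k x‖ ≤ b) :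
    Tendsto (fun N => ∫ z, tr N f z * CJ (g z.1 * k z.2)) atTop (𝓝 (∫ z, f z * CJ (g z.1 * k z.2))) := by
  have hG : Integrable (fun z : RR => g z.1 * k z.2) := hg.mul_prod hk
  have b0 : 0 ≤ b := (nnq _).trans (bg 0)
  have h1 : Integrable (fun z => ‖f z‖^P) := by
    refine ⟨(hf.norm.pow_const P).aestronglyMeasurable, ?_⟩
    rw [HasFiniteIntegral, lt_top_iff_ne_top]
    convert h using 3 with z
    rw [Real.enorm_rpow_of_nonneg (nnq _) LI, enorm_norm]
  refine tendsto_integral_of_dominated_convergence (fun z => ‖g z.1 * k z.2‖ + ‖f z‖^P * (b*b)) (fun N => ?_) (hG.norm.add (h1.mul_const _)) (fun N => ae_of_all _ fun z => ?_) (ae_of_all _ fun z => ?_)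
  · refine Measurable.aestronglyMeasurable (Measurable.ite (measurableSet_le hf.norm mcq) hf mcq) |>.mul ?_
    exact continuous_star.comp_aestronglyMeasurable hG.1
  · rw [norm_mul, RCLike.norm_conj]
    refine (mlmv (tr_le N f z) (nnq _)).trans ?_
    rcases le_total ‖f z‖ 1 with h2 | h2
    · have := mlmv h2 (nnq (g z.1 * k z.2))
      have : 0 ≤ ‖f z‖^P * (b*b) := PZ
      linarith
    · have h3 : ‖f z‖ ≤ ‖f z‖^P := by simpa using Real.rpow_le_rpow_of_exponent_le h2 hP.le
      have h4 : ‖g z.1 * k z.2‖ ≤ b*b := by rw [norm_mul]; exact mul_le_mul (bg _) (bk _) (nnq _) b0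
      have := mul_le_mul h3 h4 (nnq _) PZ
      have := nnq (g z.1 * k z.2)
      linarith
  · refine tendsto_const_nhds.congr' ?_
    filter_upwards [eventually_ge_atTop ⌈‖f z‖⌉₊] with N hN
    rw [tr, if_pos ((Nat.le_ceil _).trans (by exact_mod_cast hN))]
set_option maxHeartbeats 200000 in
theorem mainC (C : ℕ → ℝ) {P : Fin l → ℝ} (hP : ∀ i, 1 < P i) {q : ℝ} (hq : 0 < q) (hs : ∑ i, q / P i = 1) : ∃ K : EE, K ≠ ⊤ ∧
    ∀ S n Lx Ly φ χ e e' f, Dat C S n Lx Ly φ χ e e' (fun _ _ => 0) (fun _ => 0) → (∀ i, Measurable (f i)) → (∀ i, ∫⁻ z, ‖f i z‖ₑ^P i ≠ ⊤) → ∀ r r', Cnd r e → Cnd r' e' → ∀ φ0 χ0 : Rc → ℝ → ℂ,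
    (∀ R ∈ S, IsBumpAdapted C (TT^R.1.1*R.1.2) (TT^R.1.1) (φ0 R) ∧ (r = true → ∫ x, φ0 R x = 0)) →
    (∀ R ∈ S, IsBumpAdapted C (TT^R.2.1*R.2.2) (TT^R.2.1) (χ0 R) ∧ (r' = true → ∫ x, χ0 R x = 0)) →
    ∫⁻ z : RR, ‖∑ R ∈ S, wt φ χ f R * φ0 R z.1 * χ0 R z.2‖ₑ^q ≤ K * ∏ i, (((Lx i:EE)+3)^2*((Ly i:EE)+3)^2)^q * (∫⁻ z, ‖f i z‖ₑ^P i)^(q/P i) := by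
  obtain ⟨K, hK, H⟩ := mainB C hP hq hs
  refine ⟨K, hK, fun S n Lx Ly φ χ e e' f D mf hf r r' hc hc' φ0 χ0 h0 h0' => ?_⟩
  have en : ∀ (N : ℕ) i z, ‖tr N (f i) z‖ₑ ≤ ‖f i z‖ₑ := fun N i z => enorm_le_iff_norm_le.2 (tr_le N _ z)
  have P0 : ∀ i, 0 ≤ P i := fun i => (zero_lt_one.trans (hP i)).le
  have hN : ∀ N : ℕ, ∫⁻ z : RR, ‖∑ R ∈ S, wt φ χ (fun i => tr N (f i)) R * φ0 R z.1 * χ0 R z.2‖ₑ^q ≤ K * ∏ i, (((Lx i:EE)+3)^2*((Ly i:EE)+3)^2)^q * (∫⁻ z, ‖f i z‖ₑ^P i)^(q/P i) := fun N => by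
    have hm : ∀ i, ∫⁻ z, ‖tr N (f i) z‖ₑ^P i ≤ ∫⁻ z, ‖f i z‖ₑ^P i := fun i => lmq fun z => rpow_le_rpow (en N i z) (P0 i)
    refine (H S n Lx Ly φ χ e e' (fun i => tr N (f i)) _ ⟨D.nx, D.ny, D.bx, D.bY, D.zx, D.zy, fun i => Measurable.ite (measurableSet_le (mf i).norm mcq) (mf i) mcq, ⟨N, fun i z => ?_⟩, fun R hR => ?_⟩ (fun i => nto (hf i) (hm i)) r r' hc hc' φ0 χ0 h0 h0').trans ?_
    · unfold tr; split_ifs with h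
      · exact h
      · simp
    · have e1 : ∀ a : ℂ, ‖((TT^R.1.1*TT^R.2.1 : ℝ) : ℂ)⁻¹ * a‖ₑ = (Grid.len R.1.1 * Grid.len R.2.1)⁻¹ * ‖a‖ₑ := fun a => by
        have h2 : (0:ℝ) < TT^R.1.1*TT^R.2.1 := PZ
        rw [enorm_mul, enorm_inv (by exact_mod_cast h2.ne'), Grid.len, Grid.len, ← ofReal_mul PZ, ← onq ((TT^R.1.1*TT^R.2.1 : ℝ) : ℂ), nrq, non h2.le]
      rw [wt, ← onq, norm_prod, ofReal_prod_of_nonneg fun _ _ => nnq _]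
      refine loe (pcq rfl fun i _ => ?_)
      rw [onq, e1]
    · refine mlm (plp fun i _ => mlm (rpow_le_rpow (hm i) ?_) _) _
      have := P0 i; positivity
  have hw : ∀ R ∈ S, Tendsto (fun N : ℕ => wt φ χ (fun i => tr N (f i)) R) atTop (𝓝 (wt φ χ f R)) := fun R hR => by
    unfold wt
    exact tendsto_finsetProd _ fun i _ => (tr_tend (hP i) (mf i) (hf i) (bump_int PZ (D.bx i R hR)) (bump_int PZ (D.bY i R hR)) (bump_bd (D.bx i R hR)) (bump_bd (D.bY i R hR))).const_mul _
  have hl : ∀ z : RR, Tendsto (fun N : ℕ => ‖∑ R ∈ S, wt φ χ (fun i => tr N (f i)) R * φ0 R z.1 * χ0 R z.2‖ₑ^q) atTop (𝓝 (‖∑ R ∈ S, wt φ χ f R * φ0 R z.1 * χ0 R z.2‖ₑ^q)) := fun z =>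
    (ENNReal.continuous_rpow_const.tendsto _).comp ((continuous_enorm.tendsto _).comp (tendsto_finsetSum _ fun R hR => ((hw R hR).mul_const _).mul_const _))
  set T : ℕ → RR → EE := fun N z => ‖∑ R ∈ S, wt φ χ (fun i => tr N (f i)) R * φ0 R z.1 * χ0 R z.2‖ₑ^q with hT
  have mT : ∀ N, Measurable (T N) := fun N => by
    refine Measurable.pow_const (Measurable.enorm ?_) _
    refine Finset.measurable_fun_sum _ fun R hR => ?_
    exact (((h0 R hR).1.1.continuous.measurable.comp mfq).const_mul _).mul ((h0' R hR).1.1.continuous.measurable.comp msz)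
  have hN' : ∀ N, ∫⁻ z, T N z ≤ _ := hN
  have hl' : ∀ z, Tendsto (fun N => T N z) atTop _ := hl
  clear_value T
  rw [lintegral_congr fun z => (hl' z).liminf_eq.symm]
  refine (lintegral_liminf_le (u := atTop) mT).trans (liminf_le_of_le (by isBoundedDefault) fun b hb => ?_)
  obtain ⟨N, h⟩ := hb.exists
  exact h.trans (hN' N)
lemma model_eq (S : Finset Rc) (φ χ : Fin (l+1) → Rc → ℝ → ℂ) (Φ : Fin (l+1) → Rc → RR → ℂ) (h : ∀ j r, Φ j r = rectBumpProd r.1.1 r.2.1 (φ j r) (χ j r)) (f : Fin l → RR → ℂ) (z : RR) :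
    modelOp l S Φ f z = ∑ R ∈ S, wt (fun i => φ i.castSucc) (fun i => χ i.castSucc) f R * φ (Fin.last l) R z.1 * χ (Fin.last l) R z.2 := by
  refine scq rfl fun R _ => ?_
  have a0 : (0:ℝ) < TT^R.1.1*TT^R.2.1 := PZ
  have e1 : ∀ i : Fin l, pairing (f i) (Φ i.castSucc R) = (((TT^R.1.1*TT^R.2.1)^(-(1/2):ℝ) : ℝ) : ℂ) * ∫ z : RR, f i z * CJ (φ i.castSucc R z.1 * χ i.castSucc R z.2) := fun i => by
    rw [← integral_const_mul, pairing]
    refine integral_congr_ae (ae_of_all _ fun z => ?_)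
    simp only [h, rectBumpProd]
    rw [mrz PZ PZ, maq (Complex.ofReal _), map_mul, Complex.conj_ofReal]
    ring
  simp_rw [e1, h, rectBumpProd, wt]
  rw [← mrz PZ PZ]
  generalize TT^R.1.1*TT^R.2.1 = A at *
  rw [pmd, pmd, pcz, pcz, Finset.card_univ, Fintype.card_fin]
  have e2 : A^(-(((l : ℝ) - 1) / 2)) * (A^(-(1/2):ℝ))^l * A^(-(1/2):ℝ) = (A⁻¹)^l := by
    rw [← Real.rpow_natCast, ← Real.rpow_mul a0.le, ← Real.rpow_add a0, ← Real.rpow_add a0, inv_pow, ← Real.rpow_natCast, ← rnv a0.le]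
    congr 1; ring
  have e3 := congrArg (fun x : ℝ => (x : ℂ)) e2
  push_cast at e3 ⊢
  rw [← e3]; ring
end

lemma log_ch (m : ℤ) : ∃ L : ℕ, |(m:ℝ)| ≤ 2^L ∧ (L:ℝ)+3 ≤ 10 * lgq (2+|(m:ℝ)|) := by
  have hm : |(m:ℝ)| = (m.natAbs : ℝ) := by rw [Nat.cast_natAbs, Int.cast_abs]
  rw [hm]
  refine ⟨Nat.log 2 m.natAbs + 1, by exact_mod_cast (Nat.lt_pow_succ_log_self one_lt_two _).le, ?_⟩
  have h1 : TT^Nat.log 2 m.natAbs ≤ 2 + m.natAbs := by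
    by_cases h : m.natAbs = 0
    · simp [h]
    · have : TT^Nat.log 2 m.natAbs ≤ m.natAbs := by exact_mod_cast Nat.pow_log_le_self 2 h
      linarith
  have h2 := Real.log_le_log PZ h1
  have h3 : lgq 2 ≤ lgq (2 + m.natAbs) := Real.log_le_log NM SI
  rw [Real.log_pow] at h2
  have := Real.log_two_gt_d9
  have h4 : (Nat.log 2 m.natAbs:ℝ) * (1/2) ≤ Nat.log 2 m.natAbs * lgq 2 := by gcongr; linarith
  push_cast
  linarith
lemma cnd_of {l : ℕ} {j j' : Fin (l+1)} (h : j ≠ j') : Cnd (decide (Fin.last l = j ∨ Fin.last l = j')) (fun i : Fin l => decide (i.castSucc = j ∨ i.castSucc = j')) := by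
  unfold Cnd
  rcases eco j with ⟨i, rfl⟩ | rfl <;> rcases eco j' with ⟨i', rfl⟩ | rfl
  · rw [if_neg (by simp [(Fin.castSucc_lt_last _).ne'])]
    exact ⟨i, i', fun h' => h (by rw [h']), SI, SI⟩
  · rw [if_pos SI]; exact ⟨i, SI⟩
  · rw [if_pos SI]; exact ⟨i', SI⟩
  · exact absurd rfl h
end
/-- The discrete model operators `T_𝓡` associated to shifted `L²`-normalized
bump families (with at least two `Ψ`-type families in each coordinate) map
`L^{p₁} × ⋯ × L^{p_l} → L^p` for `1 < pᵢ < ∞`, `0 < p < ∞`, `∑ 1/pᵢ = 1/p`, with a bound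
independent of `𝓡` of the form `K ∏_{j=1}^{2} log²⟨n₁^j⟩ ⋯ log²⟨n_l^j⟩`, `⟨m⟩ = 2 + |m|`. -/
theorem stmt7 (l : ℕ) (hl : 1 ≤ l) (Cad : ℕ → ℝ)
    (p : Fin l → ℝ≥0∞) (hp : ∀ i, 1 < p i ∧ p i < ⊤)
    (q : ℝ≥0∞) (hq0 : 0 < q) (hqtop : q < ⊤) (hHolder : (∑ i, (p i)⁻¹) = q⁻¹) :
    ∃ K : ℝ, 0 < K ∧
      ∀ (𝓡 : Finset ((ℤ × ℤ) × (ℤ × ℤ))) (n : Fin (l + 1) → ℤ × ℤ),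
        n (Fin.last l) = (0, 0) →
        ∀ (φa φb : Fin (l + 1) → ((ℤ × ℤ) × (ℤ × ℤ)) → ℝ → ℂ)
          (Φ : Fin (l + 1) → ((ℤ × ℤ) × (ℤ × ℤ)) → ℝ × ℝ → ℂ),
          (∀ j r, Φ j r = rectBumpProd r.1.1 r.2.1 (φa j r) (φb j r)) →
          (∀ j, ∀ r ∈ 𝓡,
            IsBumpAdapted Cad ((2:ℝ)^r.1.1 * ((r.1.2 + (n j).1 : ℤ) : ℝ)) ((2:ℝ)^r.1.1)
              (φa j r) ∧
            IsBumpAdapted Cad ((2:ℝ)^r.2.1 * ((r.2.2 + (n j).2 : ℤ) : ℝ)) ((2:ℝ)^r.2.1)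
              (φb j r)) →
          (∃ j j' : Fin (l + 1), j ≠ j' ∧ ∀ r ∈ 𝓡,
            (∫ x : ℝ, φa j r x) = 0 ∧ (∫ x : ℝ, φa j' r x) = 0) →
          (∃ j j' : Fin (l + 1), j ≠ j' ∧ ∀ r ∈ 𝓡,
            (∫ x : ℝ, φb j r x) = 0 ∧ (∫ x : ℝ, φb j' r x) = 0) →
          ∀ f : Fin l → ℝ × ℝ → ℂ, (∀ i, MemLp (f i) (p i) (volume : Measure (ℝ × ℝ))) →
            eLpNorm (modelOp l 𝓡 Φ f) q (volume : Measure (ℝ × ℝ)) ≤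
              ENNReal.ofReal
                  (K * ∏ j : Fin l,
                    (Real.log (2 + |((n j.castSucc).1 : ℝ)|)) ^ 2 *
                      (Real.log (2 + |((n j.castSucc).2 : ℝ)|)) ^ 2) *
                ∏ i, eLpNorm (f i) (p i) (volume : Measure (ℝ × ℝ)) := by
  obtain ⟨P, rfl⟩ : ∃ P : Fin l → ℝ, p = fun i => ofq (P i) := ⟨fun i => (p i).toReal, funext fun i => (ofReal_toReal (hp i).2.ne).symm⟩
  obtain ⟨Q, rfl⟩ : ∃ Q : ℝ, q = ofq Q := ⟨q.toReal, (ofReal_toReal hqtop.ne).symm⟩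
  have hP : ∀ i, 1 < P i := fun i => by simpa using (hp i).1
  have hQ : 0 < Q := by simpa using hq0
  have P0 : ∀ i, 0 < P i := fun i => zero_lt_one.trans (hP i)
  have hs : ∑ i, Q / P i = 1 := by
    simp_rw [fun i => (ofReal_inv_of_pos (P0 i)).symm] at hHolder
    rw [← ofReal_inv_of_pos hQ, ← ofReal_sum_of_nonneg fun i _ => (inv_pos.2 (P0 i)).le, ofReal_eq_ofReal_iff (Finset.sum_nonneg fun i _ => (inv_pos.2 (P0 i)).le) (inv_pos.2 hQ).le] at hHolder
    simp_rw [dem]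
    rw [← msq, hHolder, mul_inv_cancel₀ hQ.ne']
  obtain ⟨K, hK, H⟩ := mainC Cad hP hQ hs
  have hK1 : (K+1)^(1/Q) ≠ ⊤ := rpow_ne_top_of_nonneg PZ FI
  have hK0 : 0 < ((K+1)^(1/Q)).toReal := toReal_pos (rpow_pos SI FI).ne' hK1
  refine ⟨((K+1)^(1/Q)).toReal * (10^4)^l, PZ, fun S n hn φ χ Φ hΦ hb ⟨j, j', jj, hj⟩ ⟨k, k', kk, hk⟩ f hf => ?_⟩
  choose Lx hx hx' using fun i : Fin l => log_ch (n i.castSucc).1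
  choose Ly hy hy' using fun i : Fin l => log_ch (n i.castSucc).2
  choose g mg fg using fun i => (hf i).1
  have eN : ∀ i, eLpNorm (f i) (ofq (P i)) volume = (∫⁻ z, ‖g i z‖ₑ^P i)^(1/P i) := fun i => by
    rw [eLpNorm_congr_ae (fg i), eLpNorm_eq_lintegral_rpow_enorm_toReal (by simpa using P0 i) SI, toReal_ofReal (P0 i).le]
  have hg : ∀ i, ∫⁻ z, ‖g i z‖ₑ^P i ≠ ⊤ := fun i h => by
    have := (hf i).2.ne
    rw [eN, h, top_rpow_of_pos (by have := P0 i; positivity)] at this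
    exact this rfl
  have ew : ∀ R, wt (fun i => φ i.castSucc) (fun i => χ i.castSucc) f R = wt (fun i => φ i.castSucc) (fun i => χ i.castSucc) g R := fun R => by
    refine pcq rfl fun i _ => ?_
    congr 1
    exact integral_congr_ae ((fg i).mono fun z hz => by simp only [hz])
  have z1 : ∀ {φ : Fin (l+1) → Rc → ℝ → ℂ} {j j'}, (∀ r ∈ S, (∫ x : ℝ, φ j r x) = 0 ∧ (∫ x : ℝ, φ j' r x) = 0) → ∀ i, decide (i = j ∨ i = j') = true → ∀ R ∈ S, ∫ x, φ i R x = 0 := fun h i hi R hR => by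
    rcases of_decide_eq_true hi with rfl | rfl
    · exact (h R hR).1
    · exact (h R hR).2
  have D : Dat Cad S (fun i => n i.castSucc) Lx Ly (fun i => φ i.castSucc) (fun i => χ i.castSucc) (fun i => decide (i.castSucc = j ∨ i.castSucc = j')) (fun i => decide (i.castSucc = k ∨ i.castSucc = k')) (fun _ _ => 0) (fun _ => 0) :=
    ⟨hx, hy, fun i R hR => (hb _ R hR).1, fun i R hR => (hb _ R hR).2, fun i h => z1 hj _ h, fun i h => z1 hk _ h, fun i => mcq, ⟨0, SI⟩, fun R hR => SI⟩
  have M := H S _ Lx Ly _ _ _ _ g D (fun i => (mg i).measurable) hg _ _ (cnd_of jj) (cnd_of kk) (φ (Fin.last l)) (χ (Fin.last l))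
    (fun R hR => ⟨by simpa [hn] using (hb (Fin.last l) R hR).1, fun h => z1 hj _ h R hR⟩)
    (fun R hR => ⟨by simpa [hn] using (hb (Fin.last l) R hR).2, fun h => z1 hk _ h R hR⟩)
  rw [eLpNorm_eq_lintegral_rpow_enorm_toReal (by simpa using hQ) SI, toReal_ofReal hQ.le]
  simp_rw [model_eq S φ χ Φ hΦ f, ew]
  refine (rpow_le_rpow M PZ).trans ?_
  rw [mul_rpow_of_nonneg _ _ PZ, ← prod_rpow_of_nonneg PZ]
  have l0 : ∀ m : ℤ, 0 ≤ lgq (2+|(m:ℝ)|) := fun m => Real.log_nonneg (by have := abs_nonneg (m:ℝ); linarith)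
  have cL : ∀ (L : ℕ) (m : ℤ), (L:ℝ)+3 ≤ 10 * lgq (2+|(m:ℝ)|) → ((L:EE)+3)^2 ≤ ofq (10^2 * lgq (2+|(m:ℝ)|)^2) := fun L m h => by
    rw [← mul_pow, ofReal_pow (by have := l0 m; positivity)]
    gcongr
    refine ltz (loe ?_) (ofReal_le_ofReal h)
    rw [ofReal_add PZ PZ]; simp
  calc _ ≤ (K+1)^(1/Q) * ∏ i, ofq (10^4 * (lgq (2 + |((n i.castSucc).1 : ℝ)|) ^ 2 * lgq (2 + |((n i.castSucc).2 : ℝ)|) ^ 2)) * eLpNorm (f i) (ofq (P i)) volume := by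
        refine mlmz (rpow_le_rpow le_self_add PZ) (plp fun i _ => ?_)
        rw [mul_rpow_of_nonneg _ _ PZ, ← rpow_mul, ← rpow_mul, mul_one_div_cancel hQ.ne', rpow_one, eN, show Q/P i*(1/Q) = 1/P i by field_simp]
        refine mlmq ((mlmz (cL _ _ (hx' i)) (cL _ _ (hy' i))).trans_eq ?_) _
        rw [← ofReal_mul PZ]; congr 1; ring
    _ = _ := by
        rw [pmd, ← maq, ← ofReal_prod_of_nonneg fun i _ => PZ, pmd, pcz, Finset.card_univ, Fintype.card_fin, maq (ENNReal.toReal _), ofReal_mul hK0.le, ofReal_toReal hK1]
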